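/- Theorem (proof of the Kanade–Russell conjecture). Let a,b,k be integers with k ≥ 1 and 0 ≤ a,b ≤ k, let τ ∈ {−1,0,1} and set K := 3k+τ+3. Then, as an identity of formal power series in q (equivalently for complex |q| < 1): Σ over integer sequences λ_1 ≥ ⋯ ≥ λ_k ≥ 0 and μ_1 ≥ ⋯ ≥ μ_k ≥ 0 of [(1 − q^{λ_a+μ_b+1})/(1−q)] · q^{Σ_{i=1}^k (λ_i²−λ_iμ_i+μ_i²) + Σ_{i=a+1}^k λ_i + Σ_{i=b+1}^k μ_i} / [∏_{i=1}^{k−1} (q;q)_{λ_i−λ_{i+1}} (q;q)_{μ_i−μ_{i+1}}] · g_{λ_k,μ_k;τ}(q) equals (q^K;q^K)_∞² / (q;q)_∞³ · θ(q^{a+1}, q^{b+1}, q^{a+b+2}; q^K), where the convention q^{λ_0} = q^{μ_0} := 0 is used (so that the term q^{λ_a+μ_b+1} is replaced by 0 whenever a = 0 or b = 0). -/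

import Mathlib

noncomputable section

namespace Stmt0

/-- `(a; q)_n`, the finite q-Pochhammer symbol. -/
def qPoch (a q : ℂ) (n : ℕ) : ℂ := ∏ j ∈ Finset.range n, (1 - a * q ^ j)

/-- `(a; q)_∞`. -/
def qPochInf (a q : ℂ) : ℂ := ∏' j : ℕ, (1 - a * q ^ j)

/-- `1/(q;q)_n` for `n : ℤ`, with the convention that it vanishes for `n < 0`. -/
def qFacInv (q : ℂ) (n : ℤ) : ℂ := if 0 ≤ n then (qPoch q q n.toNat)⁻¹ else 0

/-- The modified theta function `θ(z; q) = (z;q)_∞ (q/z;q)_∞`. -/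
def theta (z q : ℂ) : ℂ := qPochInf z q * qPochInf (q / z) q

/-- The q-binomial coefficient, vanishing unless `0 ≤ m ≤ n`. -/
def qBinom (q : ℂ) (n m : ℤ) : ℂ :=
  if 0 ≤ m ∧ m ≤ n then
    qPoch q q n.toNat / (qPoch q q m.toNat * qPoch q q (n - m).toNat)
  else 0

/-- `g_{n,m;τ}(q) = q^{τ(τ-1)nm}/((q;q)_{n+m}(q²;q)_{n+m}) · [n+m, n]_p`,
with `p = q` if `τ² = 1` and `p = q³` if `τ = 0`. -/
def g (q : ℂ) (τ : ℤ) (n m : ℕ) : ℂ :=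
  q ^ ((τ * (τ - 1)).toNat * (n * m)) /
      (qPoch q q (n + m) * qPoch (q ^ 2) q (n + m)) *
    qBinom (if τ = 0 then q ^ 3 else q) (n + m) n

/-- `f₁, …, f_k` read as a sequence indexed by `1, …, k` and extended by zero. -/
def nth {k : ℕ} (f : Fin k → ℕ) (i : ℕ) : ℕ :=
  if h : 1 ≤ i ∧ i ≤ k then f ⟨i - 1, by omega⟩ else 0

/-- Decreasing sequences `λ_1 ≥ λ_2 ≥ ⋯ ≥ λ_k ≥ 0` of nonnegative integers. -/
def Decr (k : ℕ) : Type := {f : Fin k → ℕ // ∀ i j : Fin k, i ≤ j → f j ≤ f i}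

section Basic

variable {q : ℂ}

lemma one_sub_pow_ne_zero (hq : ‖q‖ < 1) {j : ℕ} (hj : j ≠ 0) : 1 - q ^ j ≠ 0 := by
  intro h
  have h1 : q ^ j = 1 := (sub_eq_zero.mp h).symm
  have h2 : ‖q‖ ^ j < 1 := pow_lt_one₀ (norm_nonneg _) hq hj
  rw [← norm_pow, h1, norm_one] at h2
  exact lt_irrefl _ h2

lemma zpow_ne_one (hq0 : q ≠ 0) (hq : ‖q‖ < 1) {z : ℤ} (hz : z ≠ 0) : q ^ z ≠ 1 := by
  intro h
  have h0 : 0 < ‖q‖ := norm_pos_iff.mpr hq0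
  have h1 : ‖q‖ ^ z = 1 := by rw [← norm_zpow, h, norm_one]
  rcases (zpow_eq_one_iff_right₀ h0.le hq.ne).mp h1 with h2
  exact hz h2

lemma one_sub_zpow_ne_zero (hq0 : q ≠ 0) (hq : ‖q‖ < 1) {z : ℤ} (hz : z ≠ 0) :
    1 - q ^ z ≠ 0 :=
  fun h => zpow_ne_one hq0 hq hz (sub_eq_zero.mp h).symm

lemma zpow_inj_of_norm_lt_one (hq0 : q ≠ 0) (hq : ‖q‖ < 1) {x y : ℤ} (hxy : x ≠ y) :
    q ^ x ≠ q ^ y := by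
  intro h
  apply zpow_ne_one hq0 hq (sub_ne_zero.mpr hxy)
  rw [zpow_sub₀ hq0, h, div_self (zpow_ne_zero _ hq0)]

lemma qPoch_zero (a q : ℂ) : qPoch a q 0 = 1 := by simp [qPoch]

lemma qPoch_succ (a q : ℂ) (n : ℕ) : qPoch a q (n + 1) = qPoch a q n * (1 - a * q ^ n) := by
  simp [qPoch, Finset.prod_range_succ]

lemma qPoch_self_succ (q : ℂ) (n : ℕ) :
    qPoch q q (n + 1) = qPoch q q n * (1 - q ^ (n + 1)) := by
  rw [qPoch_succ, pow_succ']

lemma qPoch_self_ne_zero (hq : ‖q‖ < 1) (n : ℕ) : qPoch q q n ≠ 0 := by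
  induction n with
  | zero => simp [qPoch_zero]
  | succ n ih => rw [qPoch_self_succ]; exact mul_ne_zero ih (one_sub_pow_ne_zero hq n.succ_ne_zero)

lemma qFacInv_of_neg (q : ℂ) {z : ℤ} (hz : z < 0) : qFacInv q z = 0 := by
  simp [qFacInv, not_le.mpr hz]

lemma qFacInv_natCast (q : ℂ) (n : ℕ) : qFacInv q n = (qPoch q q n)⁻¹ := by
  simp [qFacInv]

lemma qFacInv_zero (q : ℂ) : qFacInv q 0 = 1 := by
  simp [qFacInv, qPoch_zero]

lemma qFacInv_sub_one (hq : ‖q‖ < 1) (z : ℤ) :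
    qFacInv q (z - 1) = (1 - q ^ z) * qFacInv q z := by
  rcases lt_trichotomy z 0 with h | h | h
  · rw [qFacInv_of_neg q h, qFacInv_of_neg q (by omega), mul_zero]
  · subst h; rw [qFacInv_of_neg q (by omega)]; simp
  · obtain ⟨n, rfl⟩ : ∃ n : ℕ, z = n + 1 := ⟨(z - 1).toNat, by omega⟩
    have h1 := one_sub_pow_ne_zero hq n.succ_ne_zero
    have h2 := qPoch_self_ne_zero hq n
    rw [add_sub_cancel_right, qFacInv_natCast]
    have h3 : ((n : ℤ) + 1) = ((n + 1 : ℕ) : ℤ) := by push_cast; rfl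
    rw [h3, qFacInv_natCast, qPoch_self_succ, zpow_natCast]
    field_simp

/-- `(q;q)_z` for an integer `z`, with value `1` for negative `z`. -/
def qFac (q : ℂ) (z : ℤ) : ℂ := qPoch q q z.toNat

lemma qFac_natCast (q : ℂ) (n : ℕ) : qFac q n = qPoch q q n := by simp [qFac]

lemma qFac_ne_zero (hq : ‖q‖ < 1) (z : ℤ) : qFac q z ≠ 0 := qPoch_self_ne_zero hq _

lemma qFac_eq (q : ℂ) {z : ℤ} (hz : 1 ≤ z) : qFac q z = (1 - q ^ z) * qFac q (z - 1) := by
  obtain ⟨n, rfl⟩ : ∃ n : ℕ, z = n + 1 := ⟨(z - 1).toNat, by omega⟩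
  have h3 : ((n : ℤ) + 1) = ((n + 1 : ℕ) : ℤ) := by push_cast; rfl
  rw [add_sub_cancel_right, qFac_natCast, h3, qFac_natCast, qPoch_self_succ, zpow_natCast,
    mul_comm]

/-- The `A₂` kernel `(q;q)_{n+m} ∏ᵢ 1/((q;q)_{n-kᵢ} (q;q)_{m+kᵢ})`. -/
def kernel (q : ℂ) (n m k₁ k₂ k₃ : ℤ) : ℂ :=
  qFac q (n + m) * (qFacInv q (n - k₁) * qFacInv q (n - k₂) * qFacInv q (n - k₃) *
    (qFacInv q (m + k₁) * qFacInv q (m + k₂) * qFacInv q (m + k₃)))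

lemma kernel_swap₁₂ (q : ℂ) (n m k₁ k₂ k₃ : ℤ) :
    kernel q n m k₂ k₁ k₃ = kernel q n m k₁ k₂ k₃ := by
  unfold kernel; ring

lemma kernel_swap₂₃ (q : ℂ) (n m k₁ k₂ k₃ : ℤ) :
    kernel q n m k₁ k₃ k₂ = kernel q n m k₁ k₂ k₃ := by
  unfold kernel; ring

lemma kernel_swap₁₃ (q : ℂ) (n m k₁ k₂ k₃ : ℤ) :
    kernel q n m k₃ k₂ k₁ = kernel q n m k₁ k₂ k₃ := by
  unfold kernel; ring

lemma kernel_neg (q : ℂ) (n m k₁ k₂ k₃ : ℤ) :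
    kernel q m n (-k₁) (-k₂) (-k₃) = kernel q n m k₁ k₂ k₃ := by
  unfold kernel
  simp only [sub_neg_eq_add, ← sub_eq_add_neg, add_comm m n]
  ring

lemma kernel_eq_zero (q : ℂ) {n m k₁ k₂ k₃ : ℤ}
    (h : n < k₁ ∨ n < k₂ ∨ n < k₃ ∨ k₁ < -m ∨ k₂ < -m ∨ k₃ < -m) :
    kernel q n m k₁ k₂ k₃ = 0 := by
  unfold kernel
  rcases h with h | h | h | h | h | h
  · rw [qFacInv_of_neg q (z := n - k₁) (by omega)]; ring
  · rw [qFacInv_of_neg q (z := n - k₂) (by omega)]; ring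
  · rw [qFacInv_of_neg q (z := n - k₃) (by omega)]; ring
  · rw [qFacInv_of_neg q (z := m + k₁) (by omega)]; ring
  · rw [qFacInv_of_neg q (z := m + k₂) (by omega)]; ring
  · rw [qFacInv_of_neg q (z := m + k₃) (by omega)]; ring

/-- The factor by which lowering `n` and `k₁` changes the kernel. -/
lemma kernel_lower (hq : ‖q‖ < 1) {n m : ℤ} (k₁ k₂ k₃ : ℤ) :
    kernel q (n - 1) m (k₁ - 1) k₂ k₃ =
      (1 - q ^ (n - k₂)) * (1 - q ^ (n - k₃)) * (1 - q ^ (m + k₁)) * (qFac q (n + m - 1) *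
      (qFacInv q (n - k₁) * qFacInv q (n - k₂) * qFacInv q (n - k₃) *
    (qFacInv q (m + k₁) * qFacInv q (m + k₂) * qFacInv q (m + k₃)))) := by
  unfold kernel
  rw [show n - 1 - (k₁ - 1) = n - k₁ by ring, show n - 1 - k₂ = n - k₂ - 1 by ring,
    show n - 1 - k₃ = n - k₃ - 1 by ring, show m + (k₁ - 1) = m + k₁ - 1 by ring,
    show n - 1 + m = n + m - 1 by ring,
    qFacInv_sub_one hq, qFacInv_sub_one hq, qFacInv_sub_one hq]
  ring

lemma kernel_lower₂ (hq : ‖q‖ < 1) {n m : ℤ} (k₁ k₂ k₃ : ℤ) :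
    kernel q (n - 1) m k₁ (k₂ - 1) k₃ =
      (1 - q ^ (n - k₁)) * (1 - q ^ (n - k₃)) * (1 - q ^ (m + k₂)) * (qFac q (n + m - 1) *
      (qFacInv q (n - k₁) * qFacInv q (n - k₂) * qFacInv q (n - k₃) *
    (qFacInv q (m + k₁) * qFacInv q (m + k₂) * qFacInv q (m + k₃)))) := by
  rw [← kernel_swap₁₂, kernel_lower hq]
  ring

lemma kernel_lower₃ (hq : ‖q‖ < 1) {n m : ℤ} (k₁ k₂ k₃ : ℤ) :
    kernel q (n - 1) m k₁ k₂ (k₃ - 1) =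
      (1 - q ^ (n - k₁)) * (1 - q ^ (n - k₂)) * (1 - q ^ (m + k₃)) * (qFac q (n + m - 1) *
      (qFacInv q (n - k₁) * qFacInv q (n - k₂) * qFacInv q (n - k₃) *
    (qFacInv q (m + k₁) * qFacInv q (m + k₂) * qFacInv q (m + k₃)))) := by
  rw [← kernel_swap₂₃, kernel_lower₂ hq]
  ring

lemma kernel_eq (q : ℂ) {n m : ℤ} (h : 1 ≤ n + m) (k₁ k₂ k₃ : ℤ) :
    kernel q n m k₁ k₂ k₃ = (1 - q ^ (n + m)) * (qFac q (n + m - 1) *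
      (qFacInv q (n - k₁) * qFacInv q (n - k₂) * qFacInv q (n - k₃) *
    (qFacInv q (m + k₁) * qFacInv q (m + k₂) * qFacInv q (m + k₃)))) := by
  rw [kernel, qFac_eq q h]; ring

lemma kernel_rel_one (hq0 : q ≠ 0) (hq : ‖q‖ < 1) (n m : ℤ) {k₁ k₂ k₃ : ℤ}
    (h₁₂ : k₁ ≠ k₂) (h₁₃ : k₁ ≠ k₃) (h₂₃ : k₂ ≠ k₃) :
    kernel q n m k₁ k₂ k₃ =
      kernel q (n - 1) m (k₁ - 1) k₂ k₃ / ((1 - q ^ (k₁ - k₂)) * (1 - q ^ (k₁ - k₃))) +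
      kernel q (n - 1) m k₁ (k₂ - 1) k₃ / ((1 - q ^ (k₂ - k₁)) * (1 - q ^ (k₂ - k₃))) +
      kernel q (n - 1) m k₁ k₂ (k₃ - 1) / ((1 - q ^ (k₃ - k₁)) * (1 - q ^ (k₃ - k₂))) := by
  rcases le_or_gt 1 (n + m) with h | h
  · rw [kernel_lower hq, kernel_lower₂ hq, kernel_lower₃ hq, kernel_eq q h]
    generalize qFac q (n + m - 1) * _ = P
    have e₁₂ := zpow_inj_of_norm_lt_one hq0 hq h₁₂
    have e₁₃ := zpow_inj_of_norm_lt_one hq0 hq h₁₃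
    have e₂₃ := zpow_inj_of_norm_lt_one hq0 hq h₂₃
    have z₁ := zpow_ne_zero k₁ hq0
    have z₂ := zpow_ne_zero k₂ hq0
    have z₃ := zpow_ne_zero k₃ hq0
    simp only [zpow_add₀ hq0, zpow_sub₀ hq0]
    generalize q ^ k₁ = y₁ at *
    generalize q ^ k₂ = y₂ at *
    generalize q ^ k₃ = y₃ at *
    generalize q ^ n = N at *
    generalize q ^ m = M at *
    have d₁₂ : y₁ - y₂ ≠ 0 := sub_ne_zero.mpr e₁₂
    have d₁₃ : y₁ - y₃ ≠ 0 := sub_ne_zero.mpr e₁₃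
    have d₂₃ : y₂ - y₃ ≠ 0 := sub_ne_zero.mpr e₂₃
    rw [show 1 - y₁ / y₂ = -(y₁ - y₂) / y₂ by field_simp; ring,
      show 1 - y₁ / y₃ = -(y₁ - y₃) / y₃ by field_simp; ring,
      show 1 - y₂ / y₁ = (y₁ - y₂) / y₁ by field_simp,
      show 1 - y₂ / y₃ = -(y₂ - y₃) / y₃ by field_simp; ring,
      show 1 - y₃ / y₁ = (y₁ - y₃) / y₁ by field_simp,
      show 1 - y₃ / y₂ = (y₂ - y₃) / y₂ by field_simp]
    field_simp
    ring
  · rw [kernel_eq_zero q (by omega), kernel_eq_zero q (by omega), kernel_eq_zero q (by omega),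
      kernel_eq_zero q (by omega)]
    simp

lemma kernel_rel_pow (hq0 : q ≠ 0) (hq : ‖q‖ < 1) (n m : ℤ) {k₁ k₂ k₃ : ℤ}
    (h₁₂ : k₁ ≠ k₂) (h₁₃ : k₁ ≠ k₃) (h₂₃ : k₂ ≠ k₃) :
    q ^ n * kernel q n m k₁ k₂ k₃ =
      q ^ k₁ * kernel q (n - 1) m (k₁ - 1) k₂ k₃ /
        ((1 - q ^ (k₁ - k₂)) * (1 - q ^ (k₁ - k₃))) +
      q ^ k₂ * kernel q (n - 1) m k₁ (k₂ - 1) k₃ /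
        ((1 - q ^ (k₂ - k₁)) * (1 - q ^ (k₂ - k₃))) +
      q ^ k₃ * kernel q (n - 1) m k₁ k₂ (k₃ - 1) /
        ((1 - q ^ (k₃ - k₁)) * (1 - q ^ (k₃ - k₂))) := by
  rcases le_or_gt 1 (n + m) with h | h
  · rw [kernel_lower hq, kernel_lower₂ hq, kernel_lower₃ hq, kernel_eq q h]
    generalize qFac q (n + m - 1) * _ = P
    have e₁₂ := zpow_inj_of_norm_lt_one hq0 hq h₁₂
    have e₁₃ := zpow_inj_of_norm_lt_one hq0 hq h₁₃
    have e₂₃ := zpow_inj_of_norm_lt_one hq0 hq h₂₃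
    have z₁ := zpow_ne_zero k₁ hq0
    have z₂ := zpow_ne_zero k₂ hq0
    have z₃ := zpow_ne_zero k₃ hq0
    simp only [zpow_add₀ hq0, zpow_sub₀ hq0]
    generalize q ^ k₁ = y₁ at *
    generalize q ^ k₂ = y₂ at *
    generalize q ^ k₃ = y₃ at *
    generalize q ^ n = N at *
    generalize q ^ m = M at *
    have d₁₂ : y₁ - y₂ ≠ 0 := sub_ne_zero.mpr e₁₂
    have d₁₃ : y₁ - y₃ ≠ 0 := sub_ne_zero.mpr e₁₃
    have d₂₃ : y₂ - y₃ ≠ 0 := sub_ne_zero.mpr e₂₃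
    rw [show 1 - y₁ / y₂ = -(y₁ - y₂) / y₂ by field_simp; ring,
      show 1 - y₁ / y₃ = -(y₁ - y₃) / y₃ by field_simp; ring,
      show 1 - y₂ / y₁ = (y₁ - y₂) / y₁ by field_simp,
      show 1 - y₂ / y₃ = -(y₂ - y₃) / y₃ by field_simp; ring,
      show 1 - y₃ / y₁ = (y₁ - y₃) / y₁ by field_simp,
      show 1 - y₃ / y₂ = (y₂ - y₃) / y₂ by field_simp]
    field_simp
    ring
  · rw [kernel_eq_zero q (by omega), kernel_eq_zero q (by omega), kernel_eq_zero q (by omega),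
      kernel_eq_zero q (by omega)]
    simp

/-- Lowering relation with distinguished index `3`. -/
lemma kernel_rel_lower (hq0 : q ≠ 0) (hq : ‖q‖ < 1) (n m : ℤ) {k₁ k₂ : ℤ} (k₃ : ℤ)
    (h₁₂ : k₁ ≠ k₂) :
    (1 - q ^ (n - k₃)) * kernel q n m k₁ k₂ k₃ =
      kernel q (n - 1) m (k₁ - 1) k₂ k₃ / (1 - q ^ (k₁ - k₂)) +
      kernel q (n - 1) m k₁ (k₂ - 1) k₃ / (1 - q ^ (k₂ - k₁)) := by
  rcases le_or_gt 1 (n + m) with h | h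
  · rw [kernel_lower hq, kernel_lower₂ hq, kernel_eq q h]
    generalize qFac q (n + m - 1) * _ = P
    have e₁₂ := zpow_inj_of_norm_lt_one hq0 hq h₁₂
    have z₁ := zpow_ne_zero k₁ hq0
    have z₂ := zpow_ne_zero k₂ hq0
    have z₃ := zpow_ne_zero k₃ hq0
    simp only [zpow_add₀ hq0, zpow_sub₀ hq0]
    generalize q ^ k₁ = y₁ at *
    generalize q ^ k₂ = y₂ at *
    generalize q ^ k₃ = y₃ at *
    generalize q ^ n = N at *
    generalize q ^ m = M at *
    have d₁₂ : y₁ - y₂ ≠ 0 := sub_ne_zero.mpr e₁₂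
    rw [show 1 - y₁ / y₂ = -(y₁ - y₂) / y₂ by field_simp; ring,
      show 1 - y₂ / y₁ = (y₁ - y₂) / y₁ by field_simp]
    field_simp
    ring
  · rw [kernel_eq_zero q (by omega), kernel_eq_zero q (by omega), kernel_eq_zero q (by omega)]
    simp

/-- Raising relation with distinguished index `3`. -/
lemma kernel_rel_raise (hq0 : q ≠ 0) (hq : ‖q‖ < 1) (n m : ℤ) {k₁ k₂ : ℤ} (k₃ : ℤ)
    (h₁₂ : k₁ ≠ k₂) :
    (1 - q ^ (m + k₃)) * kernel q n m k₁ k₂ k₃ =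
      kernel q n (m - 1) (k₁ + 1) k₂ k₃ / (1 - q ^ (k₂ - k₁)) +
      kernel q n (m - 1) k₁ (k₂ + 1) k₃ / (1 - q ^ (k₁ - k₂)) := by
  have h := kernel_rel_lower hq0 hq m n (k₁ := -k₁) (k₂ := -k₂) (-k₃) (by omega)
  rw [kernel_neg, show -k₁ - 1 = -(k₁ + 1) by ring, show -k₂ - 1 = -(k₂ + 1) by ring,
    kernel_neg, kernel_neg] at h
  rw [show m + k₃ = m - -k₃ by ring, h, show -k₁ - -k₂ = k₂ - k₁ by ring,
    show -k₂ - -k₁ = k₁ - k₂ by ring]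

end Basic

section Chain

variable {q : ℂ}

/-- Summand of the `A₂` Bailey-type chain identity. -/
def chainTerm (q : ℂ) (n m k₁ k₂ k₃ : ℤ) (p : ℤ × ℤ) : ℂ :=
  q ^ (p.1 ^ 2 - p.1 * p.2 + p.2 ^ 2 - (k₁ + k₂ + k₃) * (p.1 - p.2)) *
    (qFacInv q (n - p.1) * qFacInv q (m - p.2) * kernel q p.1 p.2 k₁ k₂ k₃)

/-- Right-hand side of the `A₂` Bailey-type chain identity. -/
def chainValue (q : ℂ) (n m k₁ k₂ k₃ : ℤ) : ℂ :=
  q ^ (-(k₁ * k₂ + k₁ * k₃ + k₂ * k₃)) * kernel q n m k₁ k₂ k₃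

/-- The `A₂` Bailey-type chain identity. -/
def ChainIdentity (q : ℂ) (n m k₁ k₂ k₃ : ℤ) : Prop :=
  HasSum (chainTerm q n m k₁ k₂ k₃) (chainValue q n m k₁ k₂ k₃)

lemma ChainIdentity.swap₂₃ {n m k₁ k₂ k₃ : ℤ} (h : ChainIdentity q n m k₁ k₂ k₃) :
    ChainIdentity q n m k₁ k₃ k₂ := by
  unfold ChainIdentity at *
  convert h using 1
  · funext p
    simp only [chainTerm, kernel_swap₂₃, add_right_comm k₁ k₃ k₂]
  · simp only [chainValue, kernel_swap₂₃]
    congr 2; ring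

lemma ChainIdentity.neg {n m k₁ k₂ k₃ : ℤ} (h : ChainIdentity q n m k₁ k₂ k₃) :
    ChainIdentity q m n (-k₁) (-k₂) (-k₃) := by
  unfold ChainIdentity at *
  rw [← (Equiv.prodComm ℤ ℤ).hasSum_iff]
  convert h using 1
  · funext p
    simp only [Function.comp, chainTerm, Equiv.prodComm_apply, Prod.fst_swap, Prod.snd_swap,
      kernel_neg]
    rw [mul_comm (qFacInv q (m - p.2))]
    congr 2; ring
  · simp only [chainValue, kernel_neg]
    congr 2; ring

lemma chainTerm_rel (hq0 : q ≠ 0) (hq : ‖q‖ < 1) (n m : ℤ) {k₁ k₂ : ℤ} (k₃ : ℤ)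
    (h₁₂ : k₁ ≠ k₂) (p : ℤ × ℤ) :
    (q ^ (-n) - q ^ (-k₃)) * chainTerm q n m k₁ k₂ k₃ p =
      q ^ (-n) * chainTerm q (n - 1) m k₁ k₂ k₃ p +
      q ^ (-(k₁ + k₂ + k₃)) * (
        (1 - q ^ (k₁ - k₂))⁻¹ * chainTerm q (n - 1) m (k₁ - 1) k₂ k₃ (p.1 - 1, p.2) +
        (1 - q ^ (k₂ - k₁))⁻¹ * chainTerm q (n - 1) m k₁ (k₂ - 1) k₃ (p.1 - 1, p.2)) := by
  obtain ⟨r, s⟩ := p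
  have key := kernel_rel_lower hq0 hq r s k₃ h₁₂
  simp only [chainTerm]
  rw [show n - 1 - r = n - r - 1 by ring, qFacInv_sub_one hq,
    show n - 1 - (r - 1) = n - r by ring,
    show (r - 1) ^ 2 - (r - 1) * s + s ^ 2 - (k₁ - 1 + k₂ + k₃) * (r - 1 - s) =
      (r ^ 2 - r * s + s ^ 2 - (k₁ + k₂ + k₃) * (r - s)) + (k₁ + k₂ + k₃) - r by ring,
    show (r - 1) ^ 2 - (r - 1) * s + s ^ 2 - (k₁ + (k₂ - 1) + k₃) * (r - 1 - s) =
      (r ^ 2 - r * s + s ^ 2 - (k₁ + k₂ + k₃) * (r - s)) + (k₁ + k₂ + k₃) - r by ring]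
  generalize r ^ 2 - r * s + s ^ 2 - (k₁ + k₂ + k₃) * (r - s) = E
  generalize k₁ + k₂ + k₃ = c
  rw [div_eq_mul_inv, div_eq_mul_inv] at key
  have hr := zpow_ne_zero r hq0
  have hc := zpow_ne_zero c hq0
  have hn := zpow_ne_zero n hq0
  have hk := zpow_ne_zero k₃ hq0
  have e1 : q ^ (E + c - r) = q ^ E * q ^ c / q ^ r := by
    rw [zpow_sub₀ hq0, zpow_add₀ hq0]
  have e2 : q ^ (n - r) = q ^ n / q ^ r := zpow_sub₀ hq0 _ _
  have e3 : q ^ (r - k₃) = q ^ r / q ^ k₃ := zpow_sub₀ hq0 _ _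
  rw [e1, e2, zpow_neg, zpow_neg, zpow_neg]
  rw [e3] at key
  generalize (1 - q ^ (k₁ - k₂))⁻¹ = A at *
  generalize (1 - q ^ (k₂ - k₁))⁻¹ = B at *
  have key' : kernel q (r - 1) s (k₁ - 1) k₂ k₃ * A + kernel q (r - 1) s k₁ (k₂ - 1) k₃ * B =
      (1 - q ^ r / q ^ k₃) * kernel q r s k₁ k₂ k₃ := key.symm
  have : ∀ X Y Z : ℂ, (q ^ c)⁻¹ * (A * (q ^ E * q ^ c / q ^ r *
      (X * kernel q (r - 1) s (k₁ - 1) k₂ k₃)) +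
      B * (q ^ E * q ^ c / q ^ r * (X * kernel q (r - 1) s k₁ (k₂ - 1) k₃))) =
      q ^ E / q ^ r * X * ((1 - q ^ r / q ^ k₃) * kernel q r s k₁ k₂ k₃) := by
    intro X Y Z
    rw [← key']
    field_simp
  rw [this _ 0 0]
  field_simp
  ring

lemma chainValue_rel (hq0 : q ≠ 0) (hq : ‖q‖ < 1) (n m : ℤ) {k₁ k₂ : ℤ} (k₃ : ℤ)
    (h₁₂ : k₁ ≠ k₂) :
    (q ^ (-n) - q ^ (-k₃)) * chainValue q n m k₁ k₂ k₃ =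
      q ^ (-n) * chainValue q (n - 1) m k₁ k₂ k₃ +
      q ^ (-(k₁ + k₂ + k₃)) * (
        (1 - q ^ (k₁ - k₂))⁻¹ * chainValue q (n - 1) m (k₁ - 1) k₂ k₃ +
        (1 - q ^ (k₂ - k₁))⁻¹ * chainValue q (n - 1) m k₁ (k₂ - 1) k₃) := by
  simp only [chainValue]
  rcases le_or_gt 1 (n + m) with h | h
  · have hl : kernel q (n - 1) m k₁ k₂ k₃ = (1 - q ^ (n - k₁)) * (1 - q ^ (n - k₂)) *
        (1 - q ^ (n - k₃)) * (qFac q (n + m - 1) *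
      (qFacInv q (n - k₁) * qFacInv q (n - k₂) * qFacInv q (n - k₃) *
    (qFacInv q (m + k₁) * qFacInv q (m + k₂) * qFacInv q (m + k₃)))) := by
      unfold kernel
      rw [show n - 1 - k₁ = n - k₁ - 1 by ring, show n - 1 - k₂ = n - k₂ - 1 by ring,
        show n - 1 - k₃ = n - k₃ - 1 by ring, show n - 1 + m = n + m - 1 by ring,
        qFacInv_sub_one hq, qFacInv_sub_one hq, qFacInv_sub_one hq]
      ring
    rw [kernel_lower hq, kernel_lower₂ hq, kernel_eq q h, hl]
    generalize qFac q (n + m - 1) * _ = P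
    rw [show -((k₁ - 1) * k₂ + (k₁ - 1) * k₃ + k₂ * k₃) =
        -(k₁ * k₂ + k₁ * k₃ + k₂ * k₃) + (k₂ + k₃) by ring,
      show -(k₁ * (k₂ - 1) + k₁ * k₃ + (k₂ - 1) * k₃) =
        -(k₁ * k₂ + k₁ * k₃ + k₂ * k₃) + (k₁ + k₃) by ring]
    generalize -(k₁ * k₂ + k₁ * k₃ + k₂ * k₃) = E
    have e₁₂ := zpow_inj_of_norm_lt_one hq0 hq h₁₂
    have z₁ := zpow_ne_zero k₁ hq0
    have z₂ := zpow_ne_zero k₂ hq0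
    have z₃ := zpow_ne_zero k₃ hq0
    have zN := zpow_ne_zero n hq0
    simp only [zpow_add₀ hq0, zpow_sub₀ hq0, zpow_neg]
    generalize q ^ E = Q at *
    generalize q ^ k₁ = y₁ at *
    generalize q ^ k₂ = y₂ at *
    generalize q ^ k₃ = y₃ at *
    generalize q ^ n = N at *
    generalize q ^ m = M at *
    have d₁₂ : y₁ - y₂ ≠ 0 := sub_ne_zero.mpr e₁₂
    rw [show 1 - y₁ / y₂ = -(y₁ - y₂) / y₂ by field_simp; ring,
      show 1 - y₂ / y₁ = (y₁ - y₂) / y₁ by field_simp]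
    field_simp
    ring
  · rw [kernel_eq_zero q (by omega), kernel_eq_zero q (by omega), kernel_eq_zero q (by omega),
      kernel_eq_zero q (by omega)]
    simp

lemma hasSum_of_eq {ι : Type*} {f g : ι → ℂ} {a b : ℂ} (h : HasSum g b) (hf : ∀ p, f p = g p)
    (hab : a = b) : HasSum f a := by
  rw [hab, funext hf]; exact h

lemma hasSum_shift_fst {f : ℤ × ℤ → ℂ} {a : ℂ} (h : HasSum f a) :
    HasSum (fun p : ℤ × ℤ => f (p.1 - 1, p.2)) a :=
  (((Equiv.subRight (1 : ℤ)).prodCongr (Equiv.refl ℤ)).hasSum_iff (f := f)).mpr h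

lemma ChainIdentity.step (hq0 : q ≠ 0) (hq : ‖q‖ < 1) {n m k₁ k₂ k₃ : ℤ} (h₁₂ : k₁ ≠ k₂)
    (hn : k₃ ≠ n) (h₀ : ChainIdentity q (n - 1) m k₁ k₂ k₃)
    (h₁ : ChainIdentity q (n - 1) m (k₁ - 1) k₂ k₃)
    (h₂ : ChainIdentity q (n - 1) m k₁ (k₂ - 1) k₃) : ChainIdentity q n m k₁ k₂ k₃ := by
  have hne : q ^ (-n) - q ^ (-k₃) ≠ 0 :=
    sub_ne_zero.mpr (zpow_inj_of_norm_lt_one hq0 hq (by omega))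
  have := ((h₀.mul_left (q ^ (-n))).add
    ((((hasSum_shift_fst h₁).mul_left (1 - q ^ (k₁ - k₂))⁻¹).add
      ((hasSum_shift_fst h₂).mul_left (1 - q ^ (k₂ - k₁))⁻¹)).mul_left
        (q ^ (-(k₁ + k₂ + k₃))))).mul_left (q ^ (-n) - q ^ (-k₃))⁻¹
  refine hasSum_of_eq this (fun p => ?_) ?_
  · rw [← chainTerm_rel hq0 hq n m k₃ h₁₂ p, inv_mul_cancel_left₀ hne]
  · rw [← chainValue_rel hq0 hq n m k₃ h₁₂, inv_mul_cancel_left₀ hne]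

lemma ChainIdentity.step_raise (hq0 : q ≠ 0) (hq : ‖q‖ < 1) {n m k₁ k₂ k₃ : ℤ}
    (h₁₂ : k₁ ≠ k₂) (hm : m + k₃ ≠ 0) (h₀ : ChainIdentity q n (m - 1) k₁ k₂ k₃)
    (h₁ : ChainIdentity q n (m - 1) (k₁ + 1) k₂ k₃)
    (h₂ : ChainIdentity q n (m - 1) k₁ (k₂ + 1) k₃) : ChainIdentity q n m k₁ k₂ k₃ := by
  have h₁' := h₁.neg
  have h₂' := h₂.neg
  rw [neg_add, ← sub_eq_add_neg] at h₁' h₂'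
  simpa using (ChainIdentity.step hq0 hq (by omega) (by omega) h₀.neg h₁' h₂').neg

lemma ChainIdentity.of_step (hq0 : q ≠ 0) (hq : ‖q‖ < 1) {n m k₁ k₂ k₃ : ℤ} (h₁₂ : k₁ ≠ k₂)
    (h : ChainIdentity q n m k₁ k₂ k₃) (h₀ : ChainIdentity q (n - 1) m k₁ k₂ k₃)
    (h₂ : ChainIdentity q (n - 1) m k₁ (k₂ - 1) k₃) :
    ChainIdentity q (n - 1) m (k₁ - 1) k₂ k₃ := by
  have hd := one_sub_zpow_ne_zero hq0 hq (sub_ne_zero.mpr h₁₂)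
  have hc := zpow_ne_zero (-(k₁ + k₂ + k₃)) hq0
  have key : ∀ a b c d : ℂ, (q ^ (-n) - q ^ (-k₃)) * a = q ^ (-n) * b +
      q ^ (-(k₁ + k₂ + k₃)) * ((1 - q ^ (k₁ - k₂))⁻¹ * c + (1 - q ^ (k₂ - k₁))⁻¹ * d) →
      (1 - q ^ (k₁ - k₂)) * ((q ^ (-(k₁ + k₂ + k₃)))⁻¹ * ((q ^ (-n) - q ^ (-k₃)) * a -
        q ^ (-n) * b) - (1 - q ^ (k₂ - k₁))⁻¹ * d) = c := by
    intro a b c d e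
    rw [e, add_sub_cancel_left, inv_mul_cancel_left₀ hc, add_sub_cancel_right,
      mul_inv_cancel_left₀ hd]
  have := (((((h.mul_left (q ^ (-n) - q ^ (-k₃))).sub (h₀.mul_left (q ^ (-n)))).mul_left
    (q ^ (-(k₁ + k₂ + k₃)))⁻¹).sub
    ((hasSum_shift_fst h₂).mul_left (1 - q ^ (k₂ - k₁))⁻¹)).mul_left (1 - q ^ (k₁ - k₂)))
  rw [key _ _ _ _ (chainValue_rel hq0 hq n m k₃ h₁₂)] at this
  unfold ChainIdentity
  rw [← ((Equiv.subRight (1 : ℤ)).prodCongr (Equiv.refl ℤ)).hasSum_iff]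
  refine hasSum_of_eq this (fun p => ?_) rfl
  rw [key _ _ _ _ (chainTerm_rel hq0 hq n m k₃ h₁₂ p)]
  rfl

lemma ChainIdentity.of_out (q : ℂ) {n m k₁ k₂ k₃ : ℤ}
    (h : n < k₁ ∨ n < k₂ ∨ n < k₃ ∨ k₁ < -m ∨ k₂ < -m ∨ k₃ < -m) :
    ChainIdentity q n m k₁ k₂ k₃ := by
  unfold ChainIdentity
  rw [chainValue, kernel_eq_zero q h, mul_zero]
  convert hasSum_zero using 1
  funext p
  rw [chainTerm]
  by_cases h1 : n < p.1
  · rw [qFacInv_of_neg q (z := n - p.1) (by omega)]; ring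
  by_cases h2 : m < p.2
  · rw [qFacInv_of_neg q (z := m - p.2) (by omega)]; ring
  rw [kernel_eq_zero q (by omega)]; ring

lemma ChainIdentity.diag (q : ℂ) (n : ℤ) : ChainIdentity q n (-n) n n n := by
  unfold ChainIdentity
  have : chainValue q n (-n) n n n = chainTerm q n (-n) n n n (n, -n) := by
    simp only [chainValue, chainTerm, sub_self, qFacInv_zero, one_mul]
    congr 2; ring
  rw [this]
  apply hasSum_single
  rintro ⟨r, s⟩ hp
  rw [chainTerm]
  by_cases h1 : n < r
  · rw [qFacInv_of_neg q (z := n - r) (by omega)]; ring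
  by_cases h2 : -n < s
  · rw [qFacInv_of_neg q (z := -n - s) (by omega)]; ring
  have hp' : ¬ (r = n ∧ s = -n) := by simpa using hp
  rw [kernel_eq_zero q (by omega)]; ring

lemma ChainIdentity.of_distinct (hq0 : q ≠ 0) (hq : ‖q‖ < 1) {L : ℤ} (hL : 0 ≤ L)
    (ih : ∀ n m, n + m = L → ∀ k₁ k₂ k₃, ChainIdentity q n m k₁ k₂ k₃)
    {n m k₁ k₂ : ℤ} (k₃ : ℤ) (h : n + m = L + 1) (h₁₂ : k₁ ≠ k₂) :
    ChainIdentity q n m k₁ k₂ k₃ := by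
  by_cases hk : k₃ = n
  · refine ChainIdentity.step_raise hq0 hq h₁₂ (by omega) ?_ ?_ ?_ <;>
      exact ih _ _ (by omega) _ _ _
  · refine ChainIdentity.step hq0 hq h₁₂ hk ?_ ?_ ?_ <;>
      exact ih _ _ (by omega) _ _ _

lemma ChainIdentity.of_const (hq0 : q ≠ 0) (hq : ‖q‖ < 1) {L : ℤ} (hL : 0 ≤ L)
    (ih : ∀ n m, n + m = L → ∀ k₁ k₂ k₃, ChainIdentity q n m k₁ k₂ k₃)
    {n m : ℤ} (κ : ℤ) (h : n + m = L + 1) (hm : 1 ≤ m + κ) :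
    ChainIdentity q n m κ κ κ := by
  have a₁ : ChainIdentity q n m (κ + 1) κ κ := .of_distinct hq0 hq hL ih _ h (by omega)
  have a₂ : ChainIdentity q n m (κ + 1) (κ - 1) κ := .of_distinct hq0 hq hL ih _ h (by omega)
  have b₀ : ChainIdentity q (n + 1) (m - 1) (κ + 1) κ κ :=
    .of_distinct hq0 hq hL ih _ (by omega) (by omega)
  have b₁ : ChainIdentity q (n + 1) (m - 1) (κ + 1 + 1) κ κ :=
    .of_distinct hq0 hq hL ih _ (by omega) (by omega)
  have b₂ : ChainIdentity q (n + 1) (m - 1) (κ + 1) (κ + 1) κ :=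
    (ChainIdentity.of_distinct hq0 hq hL ih (κ + 1) (by omega) (by omega : κ + 1 ≠ κ)).swap₂₃
  have c : ChainIdentity q (n + 1) m (κ + 1) κ κ :=
    .step_raise hq0 hq (by omega) (by omega) b₀ b₁ b₂
  have := ChainIdentity.of_step hq0 hq (by omega) c
    (by rwa [add_sub_cancel_right]) (by rwa [add_sub_cancel_right])
  rwa [add_sub_cancel_right, add_sub_cancel_right] at this

theorem chainIdentity (hq0 : q ≠ 0) (hq : ‖q‖ < 1) (n m k₁ k₂ k₃ : ℤ) :
    ChainIdentity q n m k₁ k₂ k₃ := by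
  by_cases hneg : n + m < 0
  · exact .of_out q (by omega)
  obtain ⟨L, hL⟩ : ∃ L : ℕ, n + m = L := ⟨(n + m).toNat, by omega⟩
  clear hneg
  induction L generalizing n m k₁ k₂ k₃ with
  | zero =>
    by_cases h : n < k₁ ∨ n < k₂ ∨ n < k₃ ∨ k₁ < -m ∨ k₂ < -m ∨ k₃ < -m
    · exact .of_out q h
    · obtain ⟨h₀, h₁, h₂, h₃⟩ : m = -n ∧ k₁ = n ∧ k₂ = n ∧ k₃ = n := by
        push_cast at hL; omega
      rw [h₀, h₁, h₂, h₃]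
      exact .diag q n
  | succ L ih =>
    have hL0 : (0 : ℤ) ≤ L := by positivity
    have ih' : ∀ n m : ℤ, n + m = L → ∀ k₁ k₂ k₃, ChainIdentity q n m k₁ k₂ k₃ :=
      fun n m h k₁ k₂ k₃ => ih n m k₁ k₂ k₃ h
    push_cast at hL
    by_cases h₁₂ : k₁ = k₂
    · by_cases h₁₃ : k₁ = k₃
      · subst h₁₂ h₁₃
        by_cases hm : 1 ≤ m + k₁
        · exact .of_const hq0 hq hL0 ih' _ hL hm
        · simpa using (ChainIdentity.of_const hq0 hq hL0 ih' (-k₁) (n := m) (m := n)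
            (by omega) (by omega)).neg
      · exact (ChainIdentity.of_distinct hq0 hq hL0 ih' k₂ hL h₁₃).swap₂₃
    · exact .of_distinct hq0 hq hL0 ih' k₃ hL h₁₂

end Chain

section LatticeSums

variable {q : ℂ}

/-- Sum over the `A₂` root lattice `k₁ + k₂ + k₃ = 0`. -/
def asum (F : ℤ → ℤ → ℤ → ℂ) : ℂ := ∑' p : ℤ × ℤ, F p.1 (-p.1 - p.2) p.2

/-- Summability over the `A₂` root lattice. -/
def ASummable (F : ℤ → ℤ → ℤ → ℂ) : Prop :=
  Summable fun p : ℤ × ℤ => F p.1 (-p.1 - p.2) p.2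

/-- Finite support on the `A₂` root lattice. -/
def AFinite (F : ℤ → ℤ → ℤ → ℂ) : Prop :=
  ∃ B : ℤ, ∀ k₁ k₂ k₃, k₁ + k₂ + k₃ = 0 → F k₁ k₂ k₃ ≠ 0 →
    |k₁| ≤ B ∧ |k₂| ≤ B ∧ |k₃| ≤ B

lemma AFinite.of_imp {F G : ℤ → ℤ → ℤ → ℂ} (hF : AFinite F)
    (h : ∀ k₁ k₂ k₃, F k₁ k₂ k₃ = 0 → G k₁ k₂ k₃ = 0) : AFinite G := by
  obtain ⟨B, hB⟩ := hF
  exact ⟨B, fun k₁ k₂ k₃ h0 h1 => hB k₁ k₂ k₃ h0 fun h2 => h1 (h _ _ _ h2)⟩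

lemma AFinite.mul_left {F : ℤ → ℤ → ℤ → ℂ} (hF : AFinite F) (w : ℤ → ℤ → ℤ → ℂ) :
    AFinite fun k₁ k₂ k₃ => w k₁ k₂ k₃ * F k₁ k₂ k₃ :=
  hF.of_imp fun _ _ _ h => by simp [h]

lemma AFinite.swap₁₂ {F : ℤ → ℤ → ℤ → ℂ} (hF : AFinite F) :
    AFinite fun k₁ k₂ k₃ => F k₂ k₁ k₃ := by
  obtain ⟨B, hB⟩ := hF
  refine ⟨B, fun k₁ k₂ k₃ h0 h1 => ?_⟩
  have := hB k₂ k₁ k₃ (by omega) h1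
  tauto

lemma AFinite.swap₂₃ {F : ℤ → ℤ → ℤ → ℂ} (hF : AFinite F) :
    AFinite fun k₁ k₂ k₃ => F k₁ k₃ k₂ := by
  obtain ⟨B, hB⟩ := hF
  refine ⟨B, fun k₁ k₂ k₃ h0 h1 => ?_⟩
  have := hB k₁ k₃ k₂ (by omega) h1
  tauto

lemma AFinite.swap₁₃ {F : ℤ → ℤ → ℤ → ℂ} (hF : AFinite F) :
    AFinite fun k₁ k₂ k₃ => F k₃ k₂ k₁ := by
  obtain ⟨B, hB⟩ := hF
  refine ⟨B, fun k₁ k₂ k₃ h0 h1 => ?_⟩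
  have := hB k₃ k₂ k₁ (by omega) h1
  tauto

lemma AFinite.summable {F : ℤ → ℤ → ℤ → ℂ} (hF : AFinite F) : ASummable F := by
  obtain ⟨B, hB⟩ := hF
  refine summable_of_ne_finset_zero (s := Finset.Icc (-B) B ×ˢ Finset.Icc (-B) B) ?_
  rintro ⟨x, y⟩ hp
  by_contra h
  have := hB _ _ _ (by ring) h
  apply hp
  simp only [Finset.mem_product, Finset.mem_Icc]
  rw [abs_le, abs_le, abs_le] at this
  omega

lemma asum_congr {F G : ℤ → ℤ → ℤ → ℂ}
    (h : ∀ k₁ k₂ k₃, k₁ + k₂ + k₃ = 0 → F k₁ k₂ k₃ = G k₁ k₂ k₃) : asum F = asum G :=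
  tsum_congr fun p => h _ _ _ (by ring)

lemma asum_add {F G : ℤ → ℤ → ℤ → ℂ} (hF : ASummable F) (hG : ASummable G) :
    asum (fun k₁ k₂ k₃ => F k₁ k₂ k₃ + G k₁ k₂ k₃) = asum F + asum G :=
  hF.tsum_add hG

lemma asum_sub {F G : ℤ → ℤ → ℤ → ℂ} (hF : ASummable F) (hG : ASummable G) :
    asum (fun k₁ k₂ k₃ => F k₁ k₂ k₃ - G k₁ k₂ k₃) = asum F - asum G :=
  hF.tsum_sub hG

lemma asum_mul_left (c : ℂ) (F : ℤ → ℤ → ℤ → ℂ) :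
    asum (fun k₁ k₂ k₃ => c * F k₁ k₂ k₃) = c * asum F :=
  tsum_mul_left

lemma asum_neg (F : ℤ → ℤ → ℤ → ℂ) :
    asum (fun k₁ k₂ k₃ => -F k₁ k₂ k₃) = -asum F :=
  tsum_neg

lemma asum_swap₁₃ (F : ℤ → ℤ → ℤ → ℂ) :
    asum (fun k₁ k₂ k₃ => F k₃ k₂ k₁) = asum F := by
  unfold asum
  rw [← (Equiv.prodComm ℤ ℤ).tsum_eq]
  refine tsum_congr fun p => ?_
  simp only [Equiv.prodComm_apply, Prod.fst_swap, Prod.snd_swap]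
  congr 1; ring

/-- The transposition of the last two coordinates of the `A₂` lattice. -/
def swapEquiv : ℤ × ℤ ≃ ℤ × ℤ where
  toFun p := (p.1, -p.1 - p.2)
  invFun p := (p.1, -p.1 - p.2)
  left_inv p := by ext <;> simp
  right_inv p := by ext <;> simp

lemma asum_swap₂₃ (F : ℤ → ℤ → ℤ → ℂ) :
    asum (fun k₁ k₂ k₃ => F k₁ k₃ k₂) = asum F := by
  unfold asum
  rw [← swapEquiv.tsum_eq]
  refine tsum_congr fun p => ?_
  simp [swapEquiv]

lemma asum_swap₁₂ (F : ℤ → ℤ → ℤ → ℂ) :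
    asum (fun k₁ k₂ k₃ => F k₂ k₁ k₃) = asum F := by
  rw [← asum_swap₁₃ (fun k₁ k₂ k₃ => F k₂ k₁ k₃), ← asum_swap₂₃ (fun k₁ k₂ k₃ => F k₂ k₃ k₁),
    ← asum_swap₁₃ F]

/-- Rotation combined with translation on the `A₂` lattice. -/
def rotEquiv : ℤ × ℤ ≃ ℤ × ℤ where
  toFun p := (-p.1 - p.2 + 1, p.1 - 2)
  invFun p := (p.2 + 2, -p.1 - p.2 - 1)
  left_inv p := by ext <;> dsimp only <;> ring
  right_inv p := by ext <;> dsimp only <;> ring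

lemma asum_rot (F : ℤ → ℤ → ℤ → ℂ) :
    asum (fun k₁ k₂ k₃ => F (k₂ + 1) (k₃ + 1) (k₁ - 2)) = asum F := by
  unfold asum
  conv_rhs => rw [← rotEquiv.tsum_eq]
  refine tsum_congr fun p => ?_
  simp only [rotEquiv, Equiv.coe_fn_mk]
  congr 1; ring

/-- An affine reflection of the `A₂` lattice. -/
def reflEquiv : ℤ × ℤ ≃ ℤ × ℤ where
  toFun p := (p.2 + 3, p.1 - 3)
  invFun p := (p.2 + 3, p.1 - 3)
  left_inv p := by ext <;> simp
  right_inv p := by ext <;> simp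

lemma asum_refl (F : ℤ → ℤ → ℤ → ℂ) :
    asum (fun k₁ k₂ k₃ => F (k₃ + 3) k₂ (k₁ - 3)) = asum F := by
  unfold asum
  conv_rhs => rw [← reflEquiv.tsum_eq]
  refine tsum_congr fun p => ?_
  simp only [reflEquiv, Equiv.coe_fn_mk]
  congr 1; ring

lemma asum_eq_zero_of_swap₁₂ {F : ℤ → ℤ → ℤ → ℂ}
    (h : ∀ k₁ k₂ k₃, k₁ + k₂ + k₃ = 0 → F k₂ k₁ k₃ = -F k₁ k₂ k₃) : asum F = 0 := by
  have := asum_swap₁₂ F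
  rw [asum_congr h, asum_neg] at this
  exact self_eq_neg.mp this.symm

lemma asum_eq_zero_of_swap₂₃ {F : ℤ → ℤ → ℤ → ℂ}
    (h : ∀ k₁ k₂ k₃, k₁ + k₂ + k₃ = 0 → F k₁ k₃ k₂ = -F k₁ k₂ k₃) : asum F = 0 := by
  have := asum_swap₂₃ F
  rw [asum_congr h, asum_neg] at this
  exact self_eq_neg.mp this.symm

lemma asum_eq_zero_of_refl {F : ℤ → ℤ → ℤ → ℂ}
    (h : ∀ k₁ k₂ k₃, k₁ + k₂ + k₃ = 0 → F (k₃ + 3) k₂ (k₁ - 3) = -F k₁ k₂ k₃) :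
    asum F = 0 := by
  have := asum_refl F
  rw [asum_congr h, asum_neg] at this
  exact self_eq_neg.mp this.symm

/-- Antisymmetry on the `A₂` lattice. -/
structure AAnti (W : ℤ → ℤ → ℤ → ℂ) : Prop where
  swap₁₂ : ∀ k₁ k₂ k₃, k₁ + k₂ + k₃ = 0 → W k₂ k₁ k₃ = -W k₁ k₂ k₃
  swap₂₃ : ∀ k₁ k₂ k₃, k₁ + k₂ + k₃ = 0 → W k₁ k₃ k₂ = -W k₁ k₂ k₃

lemma AAnti.swap₁₃ {W : ℤ → ℤ → ℤ → ℂ} (hW : AAnti W) (k₁ k₂ k₃ : ℤ) (h : k₁ + k₂ + k₃ = 0) :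
    W k₃ k₂ k₁ = -W k₁ k₂ k₃ := by
  rw [hW.swap₁₂ k₂ k₃ k₁ (by omega), hW.swap₂₃ k₂ k₁ k₃ (by omega), hW.swap₁₂ k₁ k₂ k₃ h]
  simp

lemma AAnti.eq_zero {W : ℤ → ℤ → ℤ → ℂ} (hW : AAnti W) {k₁ k₂ k₃ : ℤ}
    (h : k₁ + k₂ + k₃ = 0) (h' : k₁ = k₂ ∨ k₁ = k₃ ∨ k₂ = k₃) : W k₁ k₂ k₃ = 0 := by
  rcases h' with rfl | rfl | rfl
  · exact self_eq_neg.mp (hW.swap₁₂ _ _ _ h)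
  · exact self_eq_neg.mp (hW.swap₁₃ _ _ _ h)
  · exact self_eq_neg.mp (hW.swap₂₃ _ _ _ h)

lemma asum_symmetrize (hq0 : q ≠ 0) (hq : ‖q‖ < 1) {W D : ℤ → ℤ → ℤ → ℂ} (hW : AAnti W)
    (hD : AFinite D) (hDs : ∀ k₁ k₂ k₃, D k₁ k₃ k₂ = D k₁ k₂ k₃) :
    asum (fun k₁ k₂ k₃ => W k₁ k₂ k₃ * q ^ (k₃ - k₁) *
      (D k₁ k₂ k₃ / ((1 - q ^ (k₁ - k₂)) * (1 - q ^ (k₁ - k₃))) +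
       D k₂ k₁ k₃ / ((1 - q ^ (k₂ - k₁)) * (1 - q ^ (k₂ - k₃))) +
       D k₃ k₁ k₂ / ((1 - q ^ (k₃ - k₁)) * (1 - q ^ (k₃ - k₂))))) =
    asum (fun k₁ k₂ k₃ => W k₁ k₂ k₃ * q ^ (k₃ - k₁) * D k₁ k₂ k₃) := by
  set c : ℤ → ℤ → ℤ → ℂ := fun k₁ k₂ k₃ => ((1 - q ^ (k₁ - k₂)) * (1 - q ^ (k₁ - k₃)))⁻¹
    with hc
  have hcs : ∀ k₁ k₂ k₃, c k₁ k₃ k₂ = c k₁ k₂ k₃ := fun k₁ k₂ k₃ => by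
    simp only [hc]; rw [mul_comm]
  have s₁ : ASummable (fun k₁ k₂ k₃ => W k₁ k₂ k₃ * q ^ (k₃ - k₁) * c k₁ k₂ k₃ * D k₁ k₂ k₃) :=
    (hD.mul_left _).summable
  have s₂ : ASummable (fun k₁ k₂ k₃ => W k₁ k₂ k₃ * q ^ (k₃ - k₁) * c k₂ k₁ k₃ * D k₂ k₁ k₃) :=
    (hD.swap₁₂.mul_left _).summable
  have s₃ : ASummable (fun k₁ k₂ k₃ => W k₁ k₂ k₃ * q ^ (k₃ - k₁) * c k₃ k₂ k₁ * D k₃ k₂ k₁) :=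
    (hD.swap₁₃.mul_left _).summable
  have s₁' : ASummable (fun k₁ k₂ k₃ => W k₁ k₂ k₃ * q ^ (k₃ - k₂) * c k₁ k₂ k₃ * D k₁ k₂ k₃) :=
    (hD.mul_left _).summable
  have s₁'' : ASummable (fun k₁ k₂ k₃ => W k₁ k₂ k₃ * q ^ (k₁ - k₃) * c k₁ k₂ k₃ * D k₁ k₂ k₃) :=
    (hD.mul_left _).summable
  have e₂ : asum (fun k₁ k₂ k₃ => W k₁ k₂ k₃ * q ^ (k₃ - k₁) * c k₂ k₁ k₃ * D k₂ k₁ k₃) =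
      -asum (fun k₁ k₂ k₃ => W k₁ k₂ k₃ * q ^ (k₃ - k₂) * c k₁ k₂ k₃ * D k₁ k₂ k₃) := by
    rw [← asum_swap₁₂, ← asum_neg]
    refine asum_congr fun k₁ k₂ k₃ h => ?_
    rw [hW.swap₁₂ _ _ _ h]; ring
  have e₃ : asum (fun k₁ k₂ k₃ => W k₁ k₂ k₃ * q ^ (k₃ - k₁) * c k₃ k₂ k₁ * D k₃ k₂ k₁) =
      -asum (fun k₁ k₂ k₃ => W k₁ k₂ k₃ * q ^ (k₁ - k₃) * c k₁ k₂ k₃ * D k₁ k₂ k₃) := by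
    rw [← asum_swap₁₃, ← asum_neg]
    refine asum_congr fun k₁ k₂ k₃ h => ?_
    rw [hW.swap₁₃ _ _ _ h]; ring
  set X : ℤ → ℤ → ℤ → ℂ := fun k₁ k₂ k₃ =>
    W k₁ k₂ k₃ * (q ^ (k₃ - k₁) - q ^ (k₃ - k₂) - q ^ (k₁ - k₃)) * c k₁ k₂ k₃ * D k₁ k₂ k₃
    with hX
  set Y : ℤ → ℤ → ℤ → ℂ := fun k₁ k₂ k₃ => W k₁ k₂ k₃ * q ^ (k₃ - k₁) * D k₁ k₂ k₃ with hY
  have sX : AFinite X := hD.mul_left _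
  have sY : AFinite Y := hD.mul_left _
  have key : asum X = asum Y := by
    have hX2 := asum_add sX.summable sX.swap₂₃.summable
    have hY2 := asum_add sY.summable sY.swap₂₃.summable
    rw [asum_swap₂₃ X] at hX2
    rw [asum_swap₂₃ Y] at hY2
    have : asum (fun k₁ k₂ k₃ => X k₁ k₂ k₃ + X k₁ k₃ k₂) =
        asum (fun k₁ k₂ k₃ => Y k₁ k₂ k₃ + Y k₁ k₃ k₂) := by
      refine asum_congr fun k₁ k₂ k₃ h => ?_
      by_cases hd : k₁ = k₂ ∨ k₁ = k₃ ∨ k₂ = k₃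
      · simp [hX, hY, hW.eq_zero h hd, hW.eq_zero (k₁ := k₁) (k₂ := k₃) (k₃ := k₂) (by omega)
          (by tauto)]
      simp only [hX, hY]
      rw [hW.swap₂₃ _ _ _ h, hcs, hDs]
      push Not at hd
      have e₁₂ := zpow_inj_of_norm_lt_one hq0 hq hd.1
      have e₁₃ := zpow_inj_of_norm_lt_one hq0 hq hd.2.1
      have z₁ := zpow_ne_zero k₁ hq0
      have z₂ := zpow_ne_zero k₂ hq0
      have z₃ := zpow_ne_zero k₃ hq0
      simp only [hc, zpow_sub₀ hq0]
      generalize W k₁ k₂ k₃ = w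
      generalize D k₁ k₂ k₃ = d
      generalize q ^ k₁ = y₁ at *
      generalize q ^ k₂ = y₂ at *
      generalize q ^ k₃ = y₃ at *
      have d₁₂ : y₂ - y₁ ≠ 0 := sub_ne_zero.mpr e₁₂.symm
      have d₁₃ : y₃ - y₁ ≠ 0 := sub_ne_zero.mpr e₁₃.symm
      rw [show 1 - y₁ / y₂ = (y₂ - y₁) / y₂ by field_simp,
        show 1 - y₁ / y₃ = (y₃ - y₁) / y₃ by field_simp]
      field_simp
      ring
    rw [this, hY2] at hX2
    linear_combination (-1 / 2 : ℂ) * hX2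
  rw [← key]
  have hXe : asum X =
      asum (fun k₁ k₂ k₃ => W k₁ k₂ k₃ * q ^ (k₃ - k₁) * c k₁ k₂ k₃ * D k₁ k₂ k₃) -
      asum (fun k₁ k₂ k₃ => W k₁ k₂ k₃ * q ^ (k₃ - k₂) * c k₁ k₂ k₃ * D k₁ k₂ k₃) -
      asum (fun k₁ k₂ k₃ => W k₁ k₂ k₃ * q ^ (k₁ - k₃) * c k₁ k₂ k₃ * D k₁ k₂ k₃) := by
    rw [← asum_sub s₁ s₁', ← asum_sub (by exact s₁.sub s₁') s₁'']
    refine asum_congr fun k₁ k₂ k₃ h => ?_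
    simp only [hX]; ring
  rw [hXe, sub_eq_add_neg, sub_eq_add_neg, ← e₂, ← e₃, ← asum_add s₁ s₂,
    ← asum_add (by exact s₁.add s₂) s₃]
  refine asum_congr fun k₁ k₂ k₃ h => ?_
  simp only [hc]
  rw [hDs k₃ k₁ k₂]
  ring

lemma asum_symmetrize₂₃ (hq0 : q ≠ 0) (hq : ‖q‖ < 1) {W H : ℤ → ℤ → ℤ → ℂ}
    (hW : ∀ k₁ k₂ k₃, k₁ + k₂ + k₃ = 0 → W k₁ k₃ k₂ = -W k₁ k₂ k₃) (hH : AFinite H) :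
    asum (fun k₁ k₂ k₃ => W k₁ k₂ k₃ * q ^ (k₃ - k₁) *
      (H k₁ k₃ k₂ / (1 - q ^ (k₃ - k₂)) + H k₁ k₂ k₃ / (1 - q ^ (k₂ - k₃)))) =
    asum (fun k₁ k₂ k₃ => W k₁ k₂ k₃ * q ^ (k₃ - k₁) * H k₁ k₂ k₃) := by
  have s₁ : ASummable (fun k₁ k₂ k₃ => W k₁ k₂ k₃ * q ^ (k₃ - k₁) * (1 - q ^ (k₃ - k₂))⁻¹ *
    H k₁ k₃ k₂) := (hH.swap₂₃.mul_left _).summable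
  have s₂ : ASummable (fun k₁ k₂ k₃ => W k₁ k₂ k₃ * q ^ (k₃ - k₁) * (1 - q ^ (k₂ - k₃))⁻¹ *
    H k₁ k₂ k₃) := (hH.mul_left _).summable
  have s₃ : ASummable (fun k₁ k₂ k₃ => W k₁ k₂ k₃ * -q ^ (k₂ - k₁) * (1 - q ^ (k₂ - k₃))⁻¹ *
    H k₁ k₂ k₃) := (hH.mul_left _).summable
  have e₁ : asum (fun k₁ k₂ k₃ => W k₁ k₂ k₃ * q ^ (k₃ - k₁) * (1 - q ^ (k₃ - k₂))⁻¹ *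
      H k₁ k₃ k₂) = asum (fun k₁ k₂ k₃ => W k₁ k₂ k₃ * -q ^ (k₂ - k₁) *
        (1 - q ^ (k₂ - k₃))⁻¹ * H k₁ k₂ k₃) := by
    rw [← asum_swap₂₃]
    refine asum_congr fun k₁ k₂ k₃ h => ?_
    rw [hW _ _ _ h]; ring
  have : asum (fun k₁ k₂ k₃ => W k₁ k₂ k₃ * q ^ (k₃ - k₁) *
      (H k₁ k₃ k₂ / (1 - q ^ (k₃ - k₂)) + H k₁ k₂ k₃ / (1 - q ^ (k₂ - k₃)))) =
      asum (fun k₁ k₂ k₃ => W k₁ k₂ k₃ * q ^ (k₃ - k₁) * (1 - q ^ (k₃ - k₂))⁻¹ *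
        H k₁ k₃ k₂ + W k₁ k₂ k₃ * q ^ (k₃ - k₁) * (1 - q ^ (k₂ - k₃))⁻¹ * H k₁ k₂ k₃) :=
    asum_congr fun k₁ k₂ k₃ h => by ring
  rw [this, asum_add s₁ s₂, e₁, ← asum_add s₃ s₂]
  refine asum_congr fun k₁ k₂ k₃ h => ?_
  by_cases hd : k₂ = k₃
  · subst hd
    have := self_eq_neg.mp (hW _ _ _ h)
    simp [this]
  have e₂₃ := zpow_inj_of_norm_lt_one hq0 hq hd
  have z₁ := zpow_ne_zero k₁ hq0
  have z₂ := zpow_ne_zero k₂ hq0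
  have z₃ := zpow_ne_zero k₃ hq0
  simp only [zpow_sub₀ hq0]
  generalize W k₁ k₂ k₃ = w
  generalize H k₁ k₂ k₃ = d
  generalize q ^ k₁ = y₁ at *
  generalize q ^ k₂ = y₂ at *
  generalize q ^ k₃ = y₃ at *
  have d₂₃ : y₃ - y₂ ≠ 0 := sub_ne_zero.mpr e₂₃.symm
  rw [show 1 - y₂ / y₃ = (y₃ - y₂) / y₃ by field_simp]
  field_simp
  ring

end LatticeSums

section Weights

variable {q : ℂ}

/-- The odd function on residues modulo `3` with value `1` at `2`. -/
def chi (d : ℤ) : ℂ := if d % 3 = 2 then 1 else if d % 3 = 1 then -1 else 0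

/-- The normalized quadratic form on the `A₂` lattice. -/
def quad (k₁ k₃ : ℤ) : ℤ := (k₁ ^ 2 + k₁ * k₃ + k₃ ^ 2 - 1) / 3

/-- The alternating Gaussian weight on the `A₂` lattice. -/
def wt (q : ℂ) (M k₁ _k₂ k₃ : ℤ) : ℂ := chi (k₁ - k₃) * q ^ (M * quad k₁ k₃)

lemma chi_eq_neg {a b : ℤ} (h : (a + b) % 3 = 0) : chi b = -chi a := by
  unfold chi
  have : a % 3 = 0 ∨ a % 3 = 1 ∨ a % 3 = 2 := by omega
  rcases this with h1 | h1 | h1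
  · have : b % 3 = 0 := by omega
    simp [h1, this]
  · have : b % 3 = 2 := by omega
    simp [h1, this]
  · have : b % 3 = 1 := by omega
    simp [h1, this]

lemma chi_congr {a b : ℤ} (h : a % 3 = b % 3) : chi a = chi b := by
  unfold chi; rw [h]

lemma quad_swap₁₂ {k₁ k₂ k₃ : ℤ} (h : k₁ + k₂ + k₃ = 0) : quad k₂ k₃ = quad k₁ k₃ := by
  obtain rfl : k₂ = -k₁ - k₃ := by omega
  unfold quad; congr 1; ring

lemma quad_swap₂₃ {k₁ k₂ k₃ : ℤ} (h : k₁ + k₂ + k₃ = 0) : quad k₁ k₂ = quad k₁ k₃ := by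
  obtain rfl : k₂ = -k₁ - k₃ := by omega
  unfold quad; congr 1; ring

lemma quad_refl (k₁ k₃ : ℤ) : quad (k₃ + 3) (k₁ - 3) = quad k₁ k₃ + (3 + k₃ - k₁) := by
  unfold quad
  rw [show (k₃ + 3) ^ 2 + (k₃ + 3) * (k₁ - 3) + (k₁ - 3) ^ 2 - 1 =
    (k₁ ^ 2 + k₁ * k₃ + k₃ ^ 2 - 1) + (3 + k₃ - k₁) * 3 by ring]
  rw [Int.add_mul_ediv_right _ _ (by norm_num)]

lemma quad_rot {k₁ k₂ k₃ : ℤ} (h : k₁ + k₂ + k₃ = 0) :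
    quad (k₂ + 1) (k₁ - 2) = quad k₁ k₃ + (1 - k₁) := by
  obtain rfl : k₂ = -k₁ - k₃ := by omega
  unfold quad
  rw [show (-k₁ - k₃ + 1) ^ 2 + (-k₁ - k₃ + 1) * (k₁ - 2) + (k₁ - 2) ^ 2 - 1 =
    (k₁ ^ 2 + k₁ * k₃ + k₃ ^ 2 - 1) + (1 - k₁) * 3 by ring]
  rw [Int.add_mul_ediv_right _ _ (by norm_num)]

lemma wt_anti (q : ℂ) (M : ℤ) : AAnti (wt q M) where
  swap₁₂ k₁ k₂ k₃ h := by
    unfold wt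
    rw [quad_swap₁₂ h, chi_eq_neg (a := k₁ - k₃) (b := k₂ - k₃) (by omega), neg_mul]
  swap₂₃ k₁ k₂ k₃ h := by
    unfold wt
    rw [quad_swap₂₃ h, chi_eq_neg (a := k₁ - k₃) (b := k₁ - k₂) (by omega), neg_mul]

lemma wt_refl (hq0 : q ≠ 0) (M k₁ k₂ k₃ : ℤ) :
    wt q M (k₃ + 3) k₂ (k₁ - 3) = -wt q M k₁ k₂ k₃ * q ^ (M * (3 + k₃ - k₁)) := by
  unfold wt
  rw [quad_refl, chi_eq_neg (a := k₁ - k₃) (b := k₃ + 3 - (k₁ - 3)) (by omega), mul_add,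
    zpow_add₀ hq0]
  ring

lemma wt_rot (hq0 : q ≠ 0) (M : ℤ) {k₁ k₂ k₃ : ℤ} (h : k₁ + k₂ + k₃ = 0) :
    wt q M (k₂ + 1) (k₃ + 1) (k₁ - 2) = wt q M k₁ k₂ k₃ * q ^ (M * (1 - k₁)) := by
  unfold wt
  rw [quad_rot h, chi_congr (a := k₂ + 1 - (k₁ - 2)) (b := k₁ - k₃) (by omega), mul_add,
    zpow_add₀ hq0]
  ring

/-- Weighted product of three values of a function on `ℤ`. -/
def triple (q : ℂ) (j : ℤ → ℂ) (M : ℤ) (ex : ℤ → ℤ → ℤ → ℤ) (c₁ c₂ c₃ k₁ k₂ k₃ : ℤ) : ℂ :=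
  wt q M k₁ k₂ k₃ * q ^ ex k₁ k₂ k₃ * (j (k₁ + c₁) * j (k₂ + c₂) * j (k₃ + c₃))

lemma triple_finite {j : ℤ → ℂ} {B : ℤ} (hj : ∀ x, j x ≠ 0 → |x| ≤ B) (q : ℂ) (M : ℤ)
    (ex : ℤ → ℤ → ℤ → ℤ) (c₁ c₂ c₃ : ℤ) : AFinite (triple q j M ex c₁ c₂ c₃) := by
  refine ⟨B + |c₁| + |c₂| + |c₃|, fun k₁ k₂ k₃ _ h => ?_⟩
  have h' : j (k₁ + c₁) ≠ 0 ∧ j (k₂ + c₂) ≠ 0 ∧ j (k₃ + c₃) ≠ 0 := by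
    unfold triple at h
    refine ⟨?_, ?_, ?_⟩ <;> intro h0 <;> exact h (by rw [h0]; ring)
  have b₁ := hj _ h'.1
  have b₂ := hj _ h'.2.1
  have b₃ := hj _ h'.2.2
  rw [abs_le] at b₁ b₂ b₃
  have := neg_abs_le c₁
  have := neg_abs_le c₂
  have := neg_abs_le c₃
  have := le_abs_self c₁
  have := le_abs_self c₂
  have := le_abs_self c₃
  simp only [abs_le]
  omega

lemma asum_triple_swap₁₂ (q : ℂ) (j : ℤ → ℂ) (M : ℤ) {ex : ℤ → ℤ → ℤ → ℤ} (c c₃ : ℤ)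
    (hex : ∀ k₁ k₂ k₃, k₁ + k₂ + k₃ = 0 → ex k₂ k₁ k₃ = ex k₁ k₂ k₃) :
    asum (triple q j M ex c c c₃) = 0 := by
  refine asum_eq_zero_of_swap₁₂ fun k₁ k₂ k₃ h => ?_
  unfold triple
  rw [(wt_anti q M).swap₁₂ _ _ _ h, hex _ _ _ h]
  ring

lemma asum_triple_swap₂₃ (q : ℂ) (j : ℤ → ℂ) (M : ℤ) {ex : ℤ → ℤ → ℤ → ℤ} (c₁ c : ℤ)
    (hex : ∀ k₁ k₂ k₃, k₁ + k₂ + k₃ = 0 → ex k₁ k₃ k₂ = ex k₁ k₂ k₃) :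
    asum (triple q j M ex c₁ c c) = 0 := by
  refine asum_eq_zero_of_swap₂₃ fun k₁ k₂ k₃ h => ?_
  unfold triple
  rw [(wt_anti q M).swap₂₃ _ _ _ h, hex _ _ _ h]
  ring

lemma asum_triple_refl (hq0 : q ≠ 0) (j : ℤ → ℂ) (M : ℤ) {ex : ℤ → ℤ → ℤ → ℤ} (c₂ : ℤ)
    (hex : ∀ k₁ k₂ k₃, k₁ + k₂ + k₃ = 0 →
      M * (3 + k₃ - k₁) + ex (k₃ + 3) k₂ (k₁ - 3) = ex k₁ k₂ k₃) :
    asum (triple q j M ex (-1) c₂ 2) = 0 := by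
  refine asum_eq_zero_of_refl fun k₁ k₂ k₃ h => ?_
  unfold triple
  rw [wt_refl hq0, ← hex _ _ _ h, zpow_add₀ hq0, show k₃ + 3 + -1 = k₃ + 2 by ring,
    show k₁ - 3 + 2 = k₁ + -1 by ring]
  ring

lemma ASummable.plus {F G : ℤ → ℤ → ℤ → ℂ} (hF : ASummable F) (hG : ASummable G) :
    ASummable (fun k₁ k₂ k₃ => F k₁ k₂ k₃ + G k₁ k₂ k₃) := hF.add hG

lemma asum_eight {j : ℤ → ℂ} {B : ℤ} (hj : ∀ x, j x ≠ 0 → |x| ≤ B) (hq0 : q ≠ 0) (M : ℤ)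
    {e₀ e₁ e₂ e₃ e₁₂ e₁₃ e₂₃ e₁₂₃ : ℤ → ℤ → ℤ → ℤ}
    (h₁ : ∀ k₁ k₂ k₃, k₁ + k₂ + k₃ = 0 → e₁ k₂ k₁ k₃ = e₁ k₁ k₂ k₃)
    (h₁₃ : ∀ k₁ k₂ k₃, k₁ + k₂ + k₃ = 0 → e₁₃ k₂ k₁ k₃ = e₁₃ k₁ k₂ k₃)
    (h₂ : ∀ k₁ k₂ k₃, k₁ + k₂ + k₃ = 0 → e₂ k₁ k₃ k₂ = e₂ k₁ k₂ k₃)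
    (h₁₂ : ∀ k₁ k₂ k₃, k₁ + k₂ + k₃ = 0 → e₁₂ k₁ k₃ k₂ = e₁₂ k₁ k₂ k₃)
    (h₃ : ∀ k₁ k₂ k₃, k₁ + k₂ + k₃ = 0 →
      M * (3 + k₃ - k₁) + e₃ (k₃ + 3) k₂ (k₁ - 3) = e₃ k₁ k₂ k₃)
    (h₂₃ : ∀ k₁ k₂ k₃, k₁ + k₂ + k₃ = 0 →
      M * (3 + k₃ - k₁) + e₂₃ (k₃ + 3) k₂ (k₁ - 3) = e₂₃ k₁ k₂ k₃) :
    asum (fun k₁ k₂ k₃ =>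
      triple q j M e₁ 0 0 1 k₁ k₂ k₃ + triple q j M e₁₃ 0 0 2 k₁ k₂ k₃ +
      triple q j M e₂ (-1) 1 1 k₁ k₂ k₃ + triple q j M e₁₂ 0 1 1 k₁ k₂ k₃ +
      triple q j M e₃ (-1) 0 2 k₁ k₂ k₃ + triple q j M e₂₃ (-1) 1 2 k₁ k₂ k₃ +
      triple q j M e₁₂₃ 0 1 2 k₁ k₂ k₃ + triple q j M e₀ (-1) 0 1 k₁ k₂ k₃) =
    asum (triple q j M e₁₂₃ 0 1 2) + asum (triple q j M e₀ (-1) 0 1) := by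
  have s : ∀ ex c₁ c₂ c₃, ASummable (triple q j M ex c₁ c₂ c₃) := fun ex c₁ c₂ c₃ =>
    (triple_finite hj q M ex c₁ c₂ c₃).summable
  have s₁ := s e₁ 0 0 1
  have s₂ := s₁.plus (s e₁₃ 0 0 2)
  have s₃ := s₂.plus (s e₂ (-1) 1 1)
  have s₄ := s₃.plus (s e₁₂ 0 1 1)
  have s₅ := s₄.plus (s e₃ (-1) 0 2)
  have s₆ := s₅.plus (s e₂₃ (-1) 1 2)
  have s₇ := s₆.plus (s e₁₂₃ 0 1 2)
  rw [asum_add s₇ (s _ _ _ _), asum_add s₆ (s _ _ _ _), asum_add s₅ (s _ _ _ _),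
    asum_add s₄ (s _ _ _ _), asum_add s₃ (s _ _ _ _), asum_add s₂ (s _ _ _ _),
    asum_add s₁ (s _ _ _ _)]
  have z₁ : asum (fun k₁ k₂ k₃ => triple q j M e₁ 0 0 1 k₁ k₂ k₃) = 0 :=
    asum_triple_swap₁₂ q j M 0 1 h₁
  rw [z₁, asum_triple_swap₁₂ q j M 0 2 h₁₃,
    asum_triple_swap₂₃ q j M (-1) 1 h₂, asum_triple_swap₂₃ q j M 0 1 h₁₂,
    asum_triple_refl hq0 j M 0 h₃, asum_triple_refl hq0 j M 1 h₂₃]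
  ring

/-- `1/((q;q)_{n-κ} (q;q)_{m+κ})`. -/
def pairInv (q : ℂ) (n m κ : ℤ) : ℂ := qFacInv q (n - κ) * qFacInv q (m + κ)

lemma pairInv_shift (q : ℂ) (n m κ : ℤ) : pairInv q (n - 1) m κ = pairInv q n (m - 1) (κ + 1) := by
  unfold pairInv
  rw [show n - 1 - κ = n - (κ + 1) by ring, show m - 1 + (κ + 1) = m + κ by ring]

lemma pairInv_eq_zero (q : ℂ) {n m κ : ℤ} (h : n < κ ∨ κ < -m) : pairInv q n m κ = 0 := by
  unfold pairInv
  rcases h with h | h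
  · rw [qFacInv_of_neg q (z := n - κ) (by omega), zero_mul]
  · rw [qFacInv_of_neg q (z := m + κ) (by omega), mul_zero]

lemma pairInv_bound (q : ℂ) (n m κ : ℤ) (h : pairInv q n m κ ≠ 0) : |κ| ≤ |n| + |m| := by
  by_contra h'
  apply h
  apply pairInv_eq_zero
  have := le_abs_self n
  have := le_abs_self m
  have := abs_nonneg n
  have := abs_nonneg m
  rw [abs_le] at h'
  omega

lemma pairInv_rel (hq0 : q ≠ 0) (hq : ‖q‖ < 1) (n m κ : ℤ) :
    (1 - q ^ (n + m)) * pairInv q n m κ =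
      pairInv q n (m - 1) (κ + 1) + q ^ (n - κ) * pairInv q n (m - 1) κ := by
  rw [← pairInv_shift]
  unfold pairInv
  rw [show n - 1 - κ = n - κ - 1 by ring, show m - 1 + κ = m + κ - 1 by ring,
    qFacInv_sub_one hq, qFacInv_sub_one hq, show n + m = (n - κ) + (m + κ) by ring,
    zpow_add₀ hq0]
  ring

lemma pairInv_rel' (hq0 : q ≠ 0) (hq : ‖q‖ < 1) (n m κ : ℤ) :
    (1 - q ^ (n + m)) * pairInv q n m κ =
      q ^ (m + κ) * pairInv q n (m - 1) (κ + 1) + pairInv q n (m - 1) κ := by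
  rw [← pairInv_shift]
  unfold pairInv
  rw [show n - 1 - κ = n - κ - 1 by ring, show m - 1 + κ = m + κ - 1 by ring,
    qFacInv_sub_one hq, qFacInv_sub_one hq, show n + m = (n - κ) + (m + κ) by ring,
    zpow_add₀ hq0]
  ring

/-- The initial lattice sum. -/
def initSum (q : ℂ) (M n m : ℤ) : ℂ :=
  asum (triple q (pairInv q n m) M (fun k₁ _ k₃ => k₃ - k₁) (-1) 0 1)

lemma asum_triple_full (q : ℂ) (M n m : ℤ) :
    asum (triple q (pairInv q n (m - 1)) M (fun k₁ _ k₃ => k₃ - k₁) 0 1 2) =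
      initSum q M (n - 1) m := by
  refine asum_congr fun k₁ k₂ k₃ h => ?_
  unfold triple
  rw [pairInv_shift, pairInv_shift, pairInv_shift]
  ring_nf

lemma cube_mul_of_eq {R : Type*} [CommRing R] {c A B C a b d : R} (hA : c * A = a)
    (hB : c * B = b) (hC : c * C = d) : c ^ 3 * (A * B * C) = a * b * d := by
  rw [← hA, ← hB, ← hC]; ring

lemma cube_mul_of_eq_add {R : Type*} [CommRing R] {c A B C x y b b' d d' : R} (hA : c * A = x + y)
    (hB : c * B = b) (hB' : c * B = b') (hC : c * C = d) (hC' : c * C = d') :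
    c ^ 3 * (A * B * C) = x * (b * d) + y * (b' * d') := by
  rw [← hB, ← hC, ← hB', ← hC', ← add_mul, ← hA]; ring

lemma initSum_rec_three (hq0 : q ≠ 0) (hq : ‖q‖ < 1) (n m : ℤ) :
    (1 - q ^ (n + m)) ^ 3 * initSum q 3 n m =
      initSum q 3 (n - 1) m + q ^ (3 * n) * initSum q 3 n (m - 1) := by
  rw [← asum_triple_full, initSum, initSum, ← asum_mul_left, ← asum_mul_left]
  have := asum_eight (q := q) (pairInv_bound q n (m - 1)) hq0 3
    (e₀ := fun k₁ k₂ k₃ => k₃ - k₁ + (n - (k₁ - 1)) + (n - k₂) + (n - (k₃ + 1)))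
    (e₁ := fun k₁ k₂ k₃ => k₃ - k₁ + (n - k₂) + (n - (k₃ + 1)))
    (e₂ := fun k₁ k₂ k₃ => k₃ - k₁ + (n - (k₁ - 1)) + (n - (k₃ + 1)))
    (e₃ := fun k₁ k₂ k₃ => k₃ - k₁ + (n - (k₁ - 1)) + (n - k₂))
    (e₁₂ := fun k₁ k₂ k₃ => k₃ - k₁ + (n - (k₃ + 1)))
    (e₁₃ := fun k₁ k₂ k₃ => k₃ - k₁ + (n - k₂))
    (e₂₃ := fun k₁ k₂ k₃ => k₃ - k₁ + (n - (k₁ - 1)))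
    (e₁₂₃ := fun k₁ k₂ k₃ => k₃ - k₁)
    (by intros; ring) (by intros; ring) (by intros; ring) (by intros; ring)
    (by intro k₁ k₂ k₃ h; omega) (by intro k₁ k₂ k₃ h; omega)
  refine Eq.trans ?_ (this.trans ?_)
  · refine asum_congr fun k₁ k₂ k₃ h => ?_
    unfold triple
    have r₁ := pairInv_rel hq0 hq n m (k₁ - 1)
    have r₂ := pairInv_rel hq0 hq n m k₂
    have r₃ := pairInv_rel hq0 hq n m (k₃ + 1)
    have e := cube_mul_of_eq r₁ r₂ r₃
    simp only [add_zero, ← sub_eq_add_neg]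
    rw [mul_left_comm, e, show k₁ - 1 + 1 = k₁ by ring, show k₃ + 1 + 1 = k₃ + 2 by ring]
    simp only [zpow_add₀ hq0]
    ring
  · congr 1
    refine asum_congr fun k₁ k₂ k₃ h => ?_
    simp only [triple]
    rw [show k₃ - k₁ + (n - (k₁ - 1)) + (n - k₂) + (n - (k₃ + 1)) = 3 * n + (k₃ - k₁) by omega,
      zpow_add₀ hq0]
    ring

lemma initSum_rec_four (hq0 : q ≠ 0) (hq : ‖q‖ < 1) (n m : ℤ) :
    (1 - q ^ (n + m)) ^ 3 * initSum q 4 n m =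
      initSum q 4 (n - 1) m + q ^ n * initSum q 4 n (m - 1) := by
  rw [← asum_triple_full, initSum, initSum, ← asum_mul_left, ← asum_mul_left]
  have := asum_eight (q := q) (pairInv_bound q n (m - 1)) hq0 4
    (e₀ := fun k₁ k₂ k₃ => k₃ - k₁ + (n - (k₁ - 1)))
    (e₁ := fun k₁ k₂ k₃ => k₃ - k₁ + (n - k₂) + (n - (k₃ + 1)))
    (e₂ := fun k₁ k₂ k₃ => k₃ - k₁ + (n - (k₁ - 1)) + (m + k₂))
    (e₃ := fun k₁ k₂ k₃ => k₃ - k₁ + (n - (k₁ - 1)) + (m + (k₃ + 1)))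
    (e₁₂ := fun k₁ k₂ k₃ => k₃ - k₁ + (n - (k₃ + 1)))
    (e₁₃ := fun k₁ k₂ k₃ => k₃ - k₁ + (n - k₂))
    (e₂₃ := fun k₁ k₂ k₃ => k₃ - k₁ + (n - (k₁ - 1)) + (m + k₂) + (m + (k₃ + 1)))
    (e₁₂₃ := fun k₁ k₂ k₃ => k₃ - k₁)
    (by intros; ring) (by intros; ring) (by intros; omega) (by intros; ring)
    (by intro k₁ k₂ k₃ h; omega) (by intro k₁ k₂ k₃ h; omega)
  refine Eq.trans ?_ (this.trans ?_)
  · refine asum_congr fun k₁ k₂ k₃ h => ?_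
    unfold triple
    have r₁ := pairInv_rel hq0 hq n m (k₁ - 1)
    have r₂ := pairInv_rel hq0 hq n m k₂
    have r₃ := pairInv_rel hq0 hq n m (k₃ + 1)
    have r₂' := pairInv_rel' hq0 hq n m k₂
    have r₃' := pairInv_rel' hq0 hq n m (k₃ + 1)
    have e := cube_mul_of_eq_add r₁ r₂ r₂' r₃ r₃'
    simp only [add_zero, ← sub_eq_add_neg]
    rw [mul_left_comm, e, show k₁ - 1 + 1 = k₁ by ring, show k₃ + 1 + 1 = k₃ + 2 by ring]
    simp only [zpow_add₀ hq0]
    ring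
  · congr 1
    rw [asum_mul_left]
    conv_rhs => rw [← asum_rot, ← asum_mul_left]
    refine asum_congr fun k₁ k₂ k₃ h => ?_
    simp only [triple]
    rw [wt_rot hq0 _ h, show k₂ + 1 + -1 = k₂ + 0 by ring, show k₃ + 1 + 0 = k₃ + 1 by ring,
      show k₁ - 2 + 1 = k₁ + -1 by ring]
    have : q ^ (k₃ - k₁ + (n - (k₁ - 1))) =
        q ^ n * (q ^ (4 * (1 - k₁)) * q ^ (k₁ - 2 - (k₂ + 1))) := by
      rw [← zpow_add₀ hq0, ← zpow_add₀ hq0]; congr 1; omega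
    rw [this]
    ring

lemma initSum_rec_two (hq0 : q ≠ 0) (hq : ‖q‖ < 1) (n m : ℤ) :
    (1 - q ^ (n + m)) ^ 3 * initSum q 2 n m =
      q ^ (3 * m) * initSum q 2 (n - 1) m + q ^ (2 * n) * initSum q 2 n (m - 1) := by
  rw [← asum_triple_full, initSum, initSum, ← asum_mul_left, ← asum_mul_left, ← asum_mul_left]
  have := asum_eight (q := q) (pairInv_bound q n (m - 1)) hq0 2
    (e₀ := fun k₁ k₂ k₃ => k₃ - k₁ + (n - k₂) + (n - (k₃ + 1)))
    (e₁ := fun k₁ k₂ k₃ => k₃ - k₁ + (m + (k₁ - 1)))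
    (e₂ := fun k₁ k₂ k₃ => k₃ - k₁ + (n - (k₃ + 1)))
    (e₃ := fun k₁ k₂ k₃ => k₃ - k₁ + (n - k₂))
    (e₁₂ := fun k₁ k₂ k₃ => k₃ - k₁ + (m + (k₁ - 1)) + (m + k₂))
    (e₁₃ := fun k₁ k₂ k₃ => k₃ - k₁ + (m + (k₁ - 1)) + (m + (k₃ + 1)))
    (e₂₃ := fun k₁ k₂ k₃ => k₃ - k₁)
    (e₁₂₃ := fun k₁ k₂ k₃ => k₃ - k₁ + (m + (k₁ - 1)) + (m + k₂) + (m + (k₃ + 1)))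
    (by intros; ring) (by intros; ring) (by intros; omega)
    (by intros; omega)
    (by intro k₁ k₂ k₃ h; omega) (by intro k₁ k₂ k₃ h; omega)
  refine Eq.trans ?_ (this.trans ?_)
  · refine asum_congr fun k₁ k₂ k₃ h => ?_
    unfold triple
    have r₁ := pairInv_rel' hq0 hq n m (k₁ - 1)
    have r₂ := pairInv_rel hq0 hq n m k₂
    have r₃ := pairInv_rel hq0 hq n m (k₃ + 1)
    have r₂' := pairInv_rel' hq0 hq n m k₂
    have r₃' := pairInv_rel' hq0 hq n m (k₃ + 1)
    have e := cube_mul_of_eq_add r₁ r₂' r₂ r₃' r₃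
    simp only [add_zero, ← sub_eq_add_neg]
    rw [mul_left_comm, e, show k₁ - 1 + 1 = k₁ by ring, show k₃ + 1 + 1 = k₃ + 2 by ring]
    simp only [zpow_add₀ hq0]
    ring
  · congr 1
    · refine asum_congr fun k₁ k₂ k₃ h => ?_
      simp only [triple]
      rw [show k₃ - k₁ + (m + (k₁ - 1)) + (m + k₂) + (m + (k₃ + 1)) = 3 * m + (k₃ - k₁) by omega,
        zpow_add₀ hq0]
      ring
    rw [asum_mul_left]
    conv_rhs => rw [← asum_rot, ← asum_mul_left]
    refine asum_congr fun k₁ k₂ k₃ h => ?_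
    simp only [triple]
    rw [wt_rot hq0 _ h, show k₂ + 1 + -1 = k₂ + 0 by ring, show k₃ + 1 + 0 = k₃ + 1 by ring,
      show k₁ - 2 + 1 = k₁ + -1 by ring]
    have : q ^ (k₃ - k₁ + (n - k₂) + (n - (k₃ + 1))) =
        q ^ (2 * n) * (q ^ (2 * (1 - k₁)) * q ^ (k₁ - 2 - (k₂ + 1))) := by
      rw [← zpow_add₀ hq0, ← zpow_add₀ hq0]; congr 1; omega
    rw [this]
    ring

end Weights

section KernelSums

variable {q : ℂ}

lemma kernel_bound (q : ℂ) {n m k₁ k₂ k₃ : ℤ} (h : kernel q n m k₁ k₂ k₃ ≠ 0) :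
    (-m ≤ k₁ ∧ k₁ ≤ n) ∧ (-m ≤ k₂ ∧ k₂ ≤ n) ∧ (-m ≤ k₃ ∧ k₃ ≤ n) := by
  by_contra h'
  exact h (kernel_eq_zero q (by omega))

lemma kernel_finite (q : ℂ) (n m c₁ c₂ c₃ : ℤ) :
    AFinite fun k₁ k₂ k₃ => kernel q n m (k₁ + c₁) (k₂ + c₂) (k₃ + c₃) := by
  refine ⟨|n| + |m| + |c₁| + |c₂| + |c₃|, fun k₁ k₂ k₃ _ h => ?_⟩
  have := kernel_bound q h
  have := neg_abs_le c₁
  have := neg_abs_le c₂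
  have := neg_abs_le c₃
  have := le_abs_self c₁
  have := le_abs_self c₂
  have := le_abs_self c₃
  have := le_abs_self n
  have := le_abs_self m
  have := abs_nonneg n
  have := abs_nonneg m
  simp only [abs_le]
  omega

lemma kernel_finite_zero (q : ℂ) (n m : ℤ) :
    AFinite fun k₁ k₂ k₃ => kernel q n m k₁ k₂ k₃ := by
  simpa using kernel_finite q n m 0 0 0

lemma kernel_finite_one (q : ℂ) (n m : ℤ) :
    AFinite fun k₁ k₂ k₃ => kernel q n m (k₁ - 1) k₂ k₃ := by
  simpa [sub_eq_add_neg] using kernel_finite q n m (-1) 0 0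

lemma kernel_finite_two (q : ℂ) (n m : ℤ) :
    AFinite fun k₁ k₂ k₃ => kernel q n m (k₁ - 1) k₂ (k₃ + 1) := by
  simpa [sub_eq_add_neg] using kernel_finite q n m (-1) 0 1

/-- Raising relation with distinguished index `1`. -/
lemma kernel_rel_raise₁ (hq0 : q ≠ 0) (hq : ‖q‖ < 1) (n m : ℤ) (k₁ : ℤ) {k₂ k₃ : ℤ}
    (h : k₂ ≠ k₃) :
    (1 - q ^ (m + k₁)) * kernel q n m k₁ k₂ k₃ =
      kernel q n (m - 1) k₁ (k₂ + 1) k₃ / (1 - q ^ (k₃ - k₂)) +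
      kernel q n (m - 1) k₁ k₂ (k₃ + 1) / (1 - q ^ (k₂ - k₃)) := by
  have := kernel_rel_raise hq0 hq n m k₁ h
  rw [← kernel_swap₁₂, ← kernel_swap₂₃, this, ← kernel_swap₁₂ q n _ k₁,
    ← kernel_swap₂₃ q n _ _ k₁, ← kernel_swap₁₂ q n _ k₁, ← kernel_swap₂₃ q n _ _ k₁]

lemma asum_raise (hq0 : q ≠ 0) (hq : ‖q‖ < 1) {W : ℤ → ℤ → ℤ → ℂ}
    (hW : ∀ k₁ k₂ k₃, k₁ + k₂ + k₃ = 0 → W k₁ k₃ k₂ = -W k₁ k₂ k₃) (n m : ℤ) :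
    asum (fun k₁ k₂ k₃ => W k₁ k₂ k₃ * q ^ (k₃ - k₁) *
      ((1 - q ^ (m + (k₁ - 1))) * kernel q n m (k₁ - 1) k₂ k₃)) =
    asum (fun k₁ k₂ k₃ => W k₁ k₂ k₃ * q ^ (k₃ - k₁) *
      kernel q n (m - 1) (k₁ - 1) k₂ (k₃ + 1)) := by
  rw [← asum_symmetrize₂₃ hq0 hq hW (kernel_finite_two q n (m - 1))]
  refine asum_congr fun k₁ k₂ k₃ h => ?_
  by_cases h' : k₂ = k₃
  · subst h'
    have := hW k₁ k₂ k₂ h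
    rw [self_eq_neg.mp this]
    simp
  · rw [kernel_rel_raise₁ hq0 hq n m _ h', kernel_swap₂₃ q n (m - 1) (k₁ - 1) (k₂ + 1) k₃]

lemma AAnti.eq_zero' {W : ℤ → ℤ → ℤ → ℂ} (hW : AAnti W) {k₁ k₂ k₃ : ℤ} (h : k₁ + k₂ + k₃ = 0)
    (h' : ¬ (k₁ ≠ k₂ ∧ k₁ ≠ k₃ ∧ k₂ ≠ k₃)) : W k₁ k₂ k₃ = 0 := by
  have : k₁ = k₂ ∨ k₁ = k₃ ∨ k₂ = k₃ := by tauto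
  rcases this with rfl | rfl | rfl
  · exact self_eq_neg.mp (hW.swap₁₂ _ _ _ h)
  · exact self_eq_neg.mp (hW.swap₁₃ _ _ _ h)
  · exact self_eq_neg.mp (hW.swap₂₃ _ _ _ h)

lemma asum_lower (hq0 : q ≠ 0) (hq : ‖q‖ < 1) {W : ℤ → ℤ → ℤ → ℂ} (hW : AAnti W) (n m : ℤ) :
    asum (fun k₁ k₂ k₃ => W k₁ k₂ k₃ * q ^ (k₃ - k₁) * kernel q n m k₁ k₂ k₃) =
    asum (fun k₁ k₂ k₃ => W k₁ k₂ k₃ * q ^ (k₃ - k₁) * kernel q (n - 1) m (k₁ - 1) k₂ k₃) := by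
  rw [← asum_symmetrize hq0 hq hW (kernel_finite_one q (n - 1) m)
    (fun k₁ k₂ k₃ => kernel_swap₂₃ ..)]
  refine asum_congr fun k₁ k₂ k₃ h => ?_
  by_cases h' : k₁ ≠ k₂ ∧ k₁ ≠ k₃ ∧ k₂ ≠ k₃
  · rw [kernel_rel_one hq0 hq n m h'.1 h'.2.1 h'.2.2, kernel_swap₁₂ q (n - 1) m k₁ (k₂ - 1) k₃,
      ← kernel_swap₂₃ q (n - 1) m (k₃ - 1) k₁ k₂, kernel_swap₁₃ q (n - 1) m k₁ k₂ (k₃ - 1)]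
  · rw [hW.eq_zero' h h']; simp

lemma asum_lower_pow (hq0 : q ≠ 0) (hq : ‖q‖ < 1) {W : ℤ → ℤ → ℤ → ℂ} (hW : AAnti W) (n m : ℤ) :
    asum (fun k₁ k₂ k₃ => W k₁ k₂ k₃ * q ^ (k₃ - k₁) * (q ^ n * kernel q n m k₁ k₂ k₃)) =
    asum (fun k₁ k₂ k₃ => W k₁ k₂ k₃ * q ^ (k₃ - k₁) *
      (q ^ k₁ * kernel q (n - 1) m (k₁ - 1) k₂ k₃)) := by
  rw [← asum_symmetrize hq0 hq hW ((kernel_finite_one q (n - 1) m).mul_left (fun k₁ _ _ => q ^ k₁))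
    (fun k₁ k₂ k₃ => by rw [kernel_swap₂₃])]
  refine asum_congr fun k₁ k₂ k₃ h => ?_
  by_cases h' : k₁ ≠ k₂ ∧ k₁ ≠ k₃ ∧ k₂ ≠ k₃
  · rw [kernel_rel_pow hq0 hq n m h'.1 h'.2.1 h'.2.2, kernel_swap₁₂ q (n - 1) m k₁ (k₂ - 1) k₃,
      ← kernel_swap₂₃ q (n - 1) m (k₃ - 1) k₁ k₂, kernel_swap₁₃ q (n - 1) m k₁ k₂ (k₃ - 1)]
  · rw [hW.eq_zero' h h']; simp

lemma asum_kernel_reduce (hq0 : q ≠ 0) (hq : ‖q‖ < 1) {W : ℤ → ℤ → ℤ → ℂ} (hW : AAnti W)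
    (n m : ℤ) :
    (1 - q ^ (n + m + 1)) *
      asum (fun k₁ k₂ k₃ => W k₁ k₂ k₃ * q ^ (k₃ - k₁) * kernel q (n + 1) (m + 1) k₁ k₂ k₃) =
    asum (fun k₁ k₂ k₃ => W k₁ k₂ k₃ * q ^ (k₃ - k₁) * kernel q n m (k₁ - 1) k₂ (k₃ + 1)) := by
  have h₁ := asum_lower hq0 hq hW (n + 1) (m + 1)
  have h₂ := asum_lower_pow hq0 hq hW (n + 1) (m + 1)
  have h₃ := asum_raise hq0 hq hW.swap₂₃ n (m + 1)
  rw [add_sub_cancel_right] at h₁ h₂ h₃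
  have h₂' : q ^ (n + m + 1) * asum (fun k₁ k₂ k₃ => W k₁ k₂ k₃ * q ^ (k₃ - k₁) *
      kernel q (n + 1) (m + 1) k₁ k₂ k₃) = q ^ m * asum (fun k₁ k₂ k₃ => W k₁ k₂ k₃ *
        q ^ (k₃ - k₁) * (q ^ k₁ * kernel q n (m + 1) (k₁ - 1) k₂ k₃)) := by
    rw [← h₂, ← asum_mul_left, ← asum_mul_left]
    refine asum_congr fun k₁ k₂ k₃ _ => ?_
    rw [show n + m + 1 = m + (n + 1) by ring, zpow_add₀ hq0]
    ring
  rw [← h₃, sub_mul, one_mul, h₂', h₁, ← asum_mul_left, ← asum_sub]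
  · refine asum_congr fun k₁ k₂ k₃ _ => ?_
    rw [show m + 1 + (k₁ - 1) = m + k₁ by ring, zpow_add₀ hq0]
    ring
  · exact ((kernel_finite_one q n (m + 1)).mul_left _).summable
  · exact ((((kernel_finite_one q n (m + 1)).mul_left _).mul_left _).mul_left _).summable

lemma asum_kernel_eq_initSum (q : ℂ) (M n m : ℤ) :
    asum (fun k₁ k₂ k₃ => wt q M k₁ k₂ k₃ * q ^ (k₃ - k₁) *
      kernel q n m (k₁ - 1) k₂ (k₃ + 1)) = qFac q (n + m) * initSum q M n m := by
  rw [initSum, ← asum_mul_left]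
  refine asum_congr fun k₁ k₂ k₃ _ => ?_
  unfold triple pairInv kernel
  rw [← sub_eq_add_neg, add_zero]
  ring

lemma initSum_diag (q : ℂ) (M : ℤ) {n m : ℤ} (h : n + m = 0) :
    initSum q M n m = if n = 0 then q ^ (-2 : ℤ) else 0 := by
  obtain rfl : m = -n := by omega
  have key : ∀ κ, pairInv q n (-n) κ = if κ = n then 1 else 0 := by
    intro κ
    split_ifs with h
    · subst h
      simp [pairInv, qFacInv_zero]
    · exact pairInv_eq_zero q (by omega)
  unfold initSum asum triple
  simp only [key]
  split_ifs with hn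
  · subst hn
    rw [tsum_eq_single (1, -1)]
    · simp [wt, chi, quad]
    · rintro ⟨x, y⟩ hxy
      have : ¬ (x + -1 = 0 ∧ y + 1 = 0) := by
        rintro ⟨h1, h2⟩
        exact hxy (Prod.ext (by simp only; omega) (by simp only; omega))
      by_cases h1 : x + -1 = 0
      · have h2 : ¬ (y + 1 = 0) := fun h2 => this ⟨h1, h2⟩
        simp [h2]
      · simp [h1]
  · have : ∀ p : ℤ × ℤ, ¬ (p.1 + -1 = n ∧ -p.1 - p.2 + 0 = n ∧ p.2 + 1 = n) := by
      intro p; omega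
    convert tsum_zero with p
    have := this p
    by_cases h1 : p.1 + -1 = n
    · by_cases h2 : -p.1 - p.2 + 0 = n
      · have h3 : ¬ p.2 + 1 = n := fun h3 => this ⟨h1, h2, h3⟩
        simp [h3]
      · rw [if_neg h2]; simp
    · rw [if_neg h1]; simp

/-- The `p`-binomial coefficient `[n+m, n]_p` for integers `n, m`. -/
def binom (p : ℂ) (n m : ℤ) : ℂ := qFac p (n + m) * (qFacInv p n * qFacInv p m)

lemma binom_rec {p : ℂ} (hp0 : p ≠ 0) (hp : ‖p‖ < 1) {n m : ℤ} (h : 1 ≤ n + m) :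
    binom p n m = binom p (n - 1) m + p ^ n * binom p n (m - 1) := by
  unfold binom
  rw [qFac_eq p h, qFacInv_sub_one hp, qFacInv_sub_one hp, show n - 1 + m = n + m - 1 by ring,
    show n + (m - 1) = n + m - 1 by ring, zpow_add₀ hp0]
  ring

lemma binom_rec' {p : ℂ} (hp0 : p ≠ 0) (hp : ‖p‖ < 1) {n m : ℤ} (h : 1 ≤ n + m) :
    binom p n m = p ^ m * binom p (n - 1) m + binom p n (m - 1) := by
  unfold binom
  rw [qFac_eq p h, qFacInv_sub_one hp, qFacInv_sub_one hp, show n - 1 + m = n + m - 1 by ring,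
    show n + (m - 1) = n + m - 1 by ring, zpow_add₀ hp0]
  ring

lemma binom_diag (p : ℂ) {n m : ℤ} (h : n + m = 0) : binom p n m = if n = 0 then 1 else 0 := by
  obtain rfl : m = -n := by omega
  unfold binom
  split_ifs with hn
  · subst hn; simp [qFacInv_zero, qFac, qPoch_zero]
  · rcases lt_or_gt_of_ne hn with h | h
    · rw [qFacInv_of_neg p h]; simp
    · rw [qFacInv_of_neg p (z := -n) (by omega)]; simp

lemma qFacInv_eq_rec (hq : ‖q‖ < 1) {z : ℤ} (hz : 1 ≤ z) :
    (1 - q ^ z) * (qFac q z)⁻¹ = (qFac q (z - 1))⁻¹ := by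
  have h := qFac_eq q hz
  have h1 := qFac_ne_zero hq z
  have h2 := qFac_ne_zero hq (z - 1)
  have h3 : (1 - q ^ z) ≠ 0 := by
    intro h3; rw [h3, zero_mul] at h; exact h1 h
  rw [h]
  field_simp

lemma closed_of_rec (hq0 : q ≠ 0) (hq : ‖q‖ < 1) (M : ℤ) (F u v : ℤ → ℤ → ℂ)
    (hF0 : ∀ n m, n + m = 0 → F n m = if n = 0 then 1 else 0)
    (hF : ∀ n m, 1 ≤ n + m → F n m = u n m * F (n - 1) m + v n m * F n (m - 1))
    (hS : ∀ n m, (1 - q ^ (n + m)) ^ 3 * initSum q M n m =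
      u n m * initSum q M (n - 1) m + v n m * initSum q M n (m - 1)) (L : ℕ) :
    ∀ n m : ℤ, n + m = L →
      initSum q M n m = q ^ (-2 : ℤ) * F n m * (qFac q (n + m))⁻¹ ^ 3 := by
  induction L with
  | zero =>
    intro n m h
    have h : n + m = 0 := by simpa using h
    rw [initSum_diag q M h, hF0 n m h, h]
    split_ifs <;> simp [qFac, qPoch_zero]
  | succ L ih =>
    intro n m h
    push_cast at h
    have h1 : 1 ≤ n + m := by omega
    have hne : (1 - q ^ (n + m)) ≠ 0 := one_sub_zpow_ne_zero hq0 hq (by omega)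
    apply mul_left_cancel₀ (pow_ne_zero 3 hne)
    rw [hS, ih (n - 1) m (by omega), ih n (m - 1) (by omega), hF n m h1,
      show n - 1 + m = n + m - 1 by ring, show n + (m - 1) = n + m - 1 by ring,
      ← qFacInv_eq_rec hq h1]
    ring

lemma initSum_closed (hq0 : q ≠ 0) (hq : ‖q‖ < 1) {τ : ℤ} (hτ : τ = -1 ∨ τ = 0 ∨ τ = 1)
    (n m : ℕ) :
    initSum q (3 + τ) n m = q ^ (-2 : ℤ) * (q ^ ((τ * (τ - 1)).toNat * (n * m)) *
      binom (if τ = 0 then q ^ 3 else q) n m) * (qFac q (n + m))⁻¹ ^ 3 := by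
  have hq3 : ‖q ^ 3‖ < 1 := by
    rw [norm_pow]; exact pow_lt_one₀ (norm_nonneg _) hq (by norm_num)
  rcases hτ with rfl | rfl | rfl
  · have := closed_of_rec hq0 hq 2 (fun n m => q ^ (2 * (n * m)) * binom q n m)
      (fun _ m => q ^ (3 * m)) (fun n _ => q ^ (2 * n)) ?_ ?_ (initSum_rec_two hq0 hq) (n + m) n m
      (by push_cast; rfl)
    · norm_num
      norm_num at this
      rw [this]
      congr 3
    · intro n m h
      simp only [binom_diag q h]
      split_ifs with h0
      · simp [h0]
      · simp
    · intro n m h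
      rw [binom_rec' hq0 hq h, show 2 * ((n - 1) * m) = 2 * (n * m) - 2 * m by ring,
        show 2 * (n * (m - 1)) = 2 * (n * m) - 2 * n by ring, zpow_sub₀ hq0, zpow_sub₀ hq0,
        show 3 * m = m + 2 * m by ring, zpow_add₀ hq0]
      have := zpow_ne_zero (2 * m) hq0
      have := zpow_ne_zero (2 * n) hq0
      field_simp
  · have := closed_of_rec hq0 hq 3 (fun n m => binom (q ^ 3) n m)
      (fun _ _ => 1) (fun n _ => q ^ (3 * n)) ?_ ?_ ?_ (n + m) n m
      (by push_cast; rfl)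
    · norm_num
      norm_num at this
      rw [this]
    · intro n m h
      simp only [binom_diag _ h]
    · intro n m h
      rw [binom_rec (pow_ne_zero 3 hq0) hq3 h, zpow_mul, one_mul]
      norm_cast
    · intro n m
      rw [initSum_rec_three hq0 hq, one_mul]
  · have := closed_of_rec hq0 hq 4 (fun n m => binom q n m)
      (fun _ _ => 1) (fun n _ => q ^ n) ?_ ?_ ?_ (n + m) n m
      (by push_cast; rfl)
    · norm_num
      norm_num at this
      rw [this]
    · intro n m h
      simp only [binom_diag _ h]
    · intro n m h
      rw [binom_rec hq0 hq h, one_mul]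
    · intro n m
      rw [initSum_rec_four hq0 hq, one_mul]

lemma qBinom_eq_binom (p : ℂ) (n m : ℕ) : qBinom p (n + m) n = binom p n m := by
  unfold qBinom binom
  rw [if_pos (by omega), qFacInv_natCast, qFacInv_natCast]
  simp only [qFac]
  rw [show (n : ℤ) + m - n = m by ring]
  simp only [Int.toNat_natCast]
  rw [div_eq_mul_inv, mul_inv]

lemma qPoch_sq_eq (hq : ‖q‖ < 1) (n : ℕ) :
    qPoch (q ^ 2) q n = qPoch q q (n + 1) / (1 - q) := by
  have h1 : 1 - q ≠ 0 := by simpa using one_sub_pow_ne_zero hq one_ne_zero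
  rw [eq_div_iff h1]
  unfold qPoch
  rw [Finset.prod_range_succ']
  congr 1
  · refine Finset.prod_congr rfl fun j _ => ?_
    ring
  · ring

/-- Lattice-sum representation of the seed `g`. -/
lemma g_eq_asum (hq0 : q ≠ 0) (hq : ‖q‖ < 1) {τ : ℤ} (hτ : τ = -1 ∨ τ = 0 ∨ τ = 1)
    (n m : ℕ) :
    g q τ n m = q ^ 2 * (1 - q) * asum (fun k₁ k₂ k₃ => wt q (3 + τ) k₁ k₂ k₃ * q ^ (k₃ - k₁) *
      kernel q (n + 1) (m + 1) k₁ k₂ k₃) := by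
  have h := asum_kernel_reduce hq0 hq (wt_anti q (3 + τ)) n m
  rw [asum_kernel_eq_initSum, initSum_closed hq0 hq hτ] at h
  have h1 : (1 - q ^ ((n : ℤ) + m + 1)) ≠ 0 := one_sub_zpow_ne_zero hq0 hq (by omega)
  rw [mul_comm, ← eq_div_iff h1] at h
  rw [h]
  unfold g
  rw [qBinom_eq_binom, qPoch_sq_eq hq, qPoch_self_succ]
  have e : (n : ℤ) + m = ((n + m : ℕ) : ℤ) := by push_cast; rfl
  have e' : (n : ℤ) + m + 1 = ((n + m + 1 : ℕ) : ℤ) := by push_cast; rfl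
  rw [e', zpow_natCast] at *
  rw [e, qFac_natCast]
  have h2 := qPoch_self_ne_zero hq (n + m)
  have h3 : 1 - q ≠ 0 := by simpa using one_sub_pow_ne_zero hq one_ne_zero
  generalize binom _ _ _ = B
  have : q ^ (-2 : ℤ) = (q ^ 2)⁻¹ := by rw [zpow_neg]; rfl
  rw [this]
  field_simp

end KernelSums

section Levels

variable {q : ℂ}

/-- One level of the multisum, truncated by `n` and `m`. -/
def levelSum (q : ℂ) (ε δ : ℕ) (β : ℕ → ℕ → ℂ) (n m : ℕ) : ℂ :=
  ∑ p ∈ Finset.range (n + 1) ×ˢ Finset.range (m + 1),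
    q ^ (p.1 ^ 2 + p.2 ^ 2 - p.1 * p.2 + ε * p.1 + δ * p.2) *
      (qFacInv q ((n : ℤ) - p.1) * qFacInv q ((m : ℤ) - p.2)) * β p.1 p.2

lemma levelSum_sub_mul (q : ℂ) (ε δ : ℕ) (β γ : ℕ → ℕ → ℂ) (c : ℂ) (n m : ℕ) :
    levelSum q ε δ (fun r s => β r s - c * γ r s) n m =
      levelSum q ε δ β n m - c * levelSum q ε δ γ n m := by
  unfold levelSum
  rw [Finset.mul_sum, ← Finset.sum_sub_distrib]
  exact Finset.sum_congr rfl fun p _ => by ring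

lemma levelSum_add (q : ℂ) (ε δ : ℕ) (β γ : ℕ → ℕ → ℂ) (n m : ℕ) :
    levelSum q ε δ (fun r s => β r s + γ r s) n m =
      levelSum q ε δ β n m + levelSum q ε δ γ n m := by
  unfold levelSum
  rw [← Finset.sum_add_distrib]
  exact Finset.sum_congr rfl fun p _ => by ring

lemma levelSum_mul (q : ℂ) (ε δ : ℕ) (β : ℕ → ℕ → ℂ) (c : ℂ) (n m : ℕ) :
    levelSum q ε δ (fun r s => c * β r s) n m = c * levelSum q ε δ β n m := by
  unfold levelSum
  rw [Finset.mul_sum]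
  exact Finset.sum_congr rfl fun p _ => by ring

lemma levelSum_pow (q : ℂ) (ε δ : ℕ) (β : ℕ → ℕ → ℂ) (n m : ℕ) :
    levelSum q ε δ (fun r s => q ^ s * β r s) n m = levelSum q ε (δ + 1) β n m := by
  unfold levelSum
  refine Finset.sum_congr rfl fun p _ => ?_
  rw [show p.1 ^ 2 + p.2 ^ 2 - p.1 * p.2 + ε * p.1 + (δ + 1) * p.2 =
    p.1 ^ 2 + p.2 ^ 2 - p.1 * p.2 + ε * p.1 + δ * p.2 + p.2 by ring, pow_add q _ p.2]
  ring

lemma asum_finset_sum {ι : Type*} (s : Finset ι) (F : ι → ℤ → ℤ → ℤ → ℂ)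
    (h : ∀ i ∈ s, ASummable (F i)) :
    asum (fun k₁ k₂ k₃ => ∑ i ∈ s, F i k₁ k₂ k₃) = ∑ i ∈ s, asum (F i) :=
  Summable.tsum_finsetSum h

lemma levelSum_asum (q : ℂ) (ε δ : ℕ) (w : ℤ → ℤ → ℤ → ℂ) (B : ℕ → ℕ → ℤ → ℤ → ℤ → ℂ)
    (hB : ∀ r s, AFinite (B r s)) (n m : ℕ) :
    levelSum q ε δ (fun r s => asum fun k₁ k₂ k₃ => w k₁ k₂ k₃ * B r s k₁ k₂ k₃) n m =
      asum fun k₁ k₂ k₃ => w k₁ k₂ k₃ * levelSum q ε δ (fun r s => B r s k₁ k₂ k₃) n m := by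
  unfold levelSum
  simp only [Finset.mul_sum]
  rw [asum_finset_sum]
  · refine Finset.sum_congr rfl fun p _ => ?_
    rw [← asum_mul_left]
    exact asum_congr fun k₁ k₂ k₃ _ => by ring
  · intro p _
    exact (((hB p.1 p.2).mul_left _).mul_left _).summable

lemma sum_eq_of_hasSum {F : ℤ × ℤ → ℂ} {c : ℂ} (hF : HasSum F c) (n m : ℕ) (x y : ℤ)
    (h : ∀ r s, F (r, s) ≠ 0 → (x ≤ r ∧ r ≤ n + x) ∧ (y ≤ s ∧ s ≤ m + y)) :
    ∑ p ∈ Finset.range (n + 1) ×ˢ Finset.range (m + 1), F (p.1 + x, p.2 + y) = c := by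
  let e : ℕ × ℕ ↪ ℤ × ℤ := ⟨fun p => (p.1 + x, p.2 + y), by
    rintro ⟨a, b⟩ ⟨c, d⟩ h
    simp only [Prod.mk.injEq] at h
    ext <;> simp only <;> omega⟩
  have := hasSum_sum_of_ne_finset_zero (f := F) (L := SummationFilter.unconditional _)
    (s := (Finset.range (n + 1) ×ˢ Finset.range (m + 1)).map e) (by
      rintro ⟨r, s⟩ hrs
      by_contra h0
      have h1 := h r s h0
      apply hrs
      rw [Finset.mem_map]
      refine ⟨((r - x).toNat, (s - y).toNat), ?_, ?_⟩
      · simp only [Finset.mem_product, Finset.mem_range]; omega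
      · change ((((r - x).toNat : ℤ) + x, ((s - y).toNat : ℤ) + y) : ℤ × ℤ) = (r, s)
        rw [Int.toNat_of_nonneg (by omega), Int.toNat_of_nonneg (by omega)]
        simp)
  rw [Finset.sum_map] at this
  exact this.unique hF

lemma cast_form (r s ε δ : ℕ) :
    ((r ^ 2 + s ^ 2 - r * s + ε * r + δ * s : ℕ) : ℤ) =
      (r : ℤ) ^ 2 + s ^ 2 - r * s + ε * r + δ * s := by
  have : r * s ≤ r ^ 2 + s ^ 2 := by nlinarith [Nat.zero_le (r * s), sq_nonneg ((r : ℤ) - s)]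
  push_cast [Nat.cast_sub this]
  ring

/-- The value of the `A₂` quadratic form. -/
def form (k₁ k₂ k₃ : ℤ) : ℤ := -(k₁ * k₂ + k₁ * k₃ + k₂ * k₃)

lemma levelSum_kernel (hq0 : q ≠ 0) (hq : ‖q‖ < 1) (ε δ : ℕ) (x y : ℤ) (e : ℤ) (n m : ℕ)
    {k₁ k₂ k₃ : ℤ}
    (hs : ∀ r s, kernel q r s k₁ k₂ k₃ ≠ 0 → x ≤ r ∧ y ≤ s)
    (hform : ∀ r s : ℤ, (r + x) ^ 2 - (r + x) * (s + y) + (s + y) ^ 2 -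
      (k₁ + k₂ + k₃) * (r + x - (s + y)) = r ^ 2 + s ^ 2 - r * s + ε * r + δ * s + e) :
    levelSum q ε δ (fun r s => kernel q (r + x) (s + y) k₁ k₂ k₃) n m =
      q ^ (form k₁ k₂ k₃ - e) * kernel q (n + x) (m + y) k₁ k₂ k₃ := by
  have h := chainIdentity hq0 hq (n + x) (m + y) k₁ k₂ k₃
  have := sum_eq_of_hasSum h n m x y (by
    intro r s h0
    unfold chainTerm at h0
    have h1 : kernel q r s k₁ k₂ k₃ ≠ 0 := fun h1 => h0 (by simp [h1])
    have h2 : 0 ≤ (n : ℤ) + x - r := by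
      by_contra h2
      exact h0 (by simp [qFacInv_of_neg q (lt_of_not_ge h2)])
    have h3 : 0 ≤ (m : ℤ) + y - s := by
      by_contra h3
      exact h0 (by simp [qFacInv_of_neg q (lt_of_not_ge h3)])
    have := hs _ _ h1
    omega)
  have hqe := zpow_ne_zero e hq0
  rw [zpow_sub₀ hq0, div_mul_eq_mul_div, eq_div_iff hqe]
  unfold chainValue at this
  rw [form, ← this, levelSum, Finset.sum_mul]
  refine Finset.sum_congr rfl fun p _ => ?_
  simp only [chainTerm]
  rw [hform, zpow_add₀ hq0, ← cast_form, zpow_natCast,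
    show (n : ℤ) + x - (p.1 + x) = n - p.1 by ring, show (m : ℤ) + y - (p.2 + y) = m - p.2 by ring]
  ring

lemma levelSum_one_one (hq0 : q ≠ 0) (hq : ‖q‖ < 1) (n m : ℕ) {k₁ k₂ k₃ : ℤ}
    (h : k₁ + k₂ + k₃ = 0) (h' : k₁ ≠ k₃) :
    levelSum q 1 1 (fun r s => kernel q (r + 1) (s + 1) k₁ k₂ k₃) n m =
      q ^ (form k₁ k₂ k₃ - 1) * kernel q (n + 1) (m + 1) k₁ k₂ k₃ := by
  refine levelSum_kernel hq0 hq 1 1 1 1 1 n m (fun r s h0 => ?_) (fun r s => ?_)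
  · have := kernel_bound q h0
    omega
  · rw [h]; push_cast; ring

lemma levelSum_zero_one (hq0 : q ≠ 0) (hq : ‖q‖ < 1) (n m : ℕ) {k₁ k₂ k₃ : ℤ}
    (h : k₁ + k₂ + k₃ = -1) :
    levelSum q 0 1 (fun r s => kernel q r (s + 1) k₁ k₂ k₃) n m =
      q ^ form k₁ k₂ k₃ * kernel q n (m + 1) k₁ k₂ k₃ := by
  have := levelSum_kernel hq0 hq 0 1 0 1 0 n m (k₁ := k₁) (k₂ := k₂) (k₃ := k₃)
    (fun r s h0 => ?_) (fun r s => ?_)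
  · simpa using this
  · have := kernel_bound q h0
    omega
  · rw [h]; push_cast; ring

lemma levelSum_zero_zero (hq0 : q ≠ 0) (hq : ‖q‖ < 1) (n m : ℕ) {k₁ k₂ k₃ : ℤ}
    (h : k₁ + k₂ + k₃ = 0) :
    levelSum q 0 0 (fun r s => kernel q r s k₁ k₂ k₃) n m =
      q ^ form k₁ k₂ k₃ * kernel q n m k₁ k₂ k₃ := by
  have := levelSum_kernel hq0 hq 0 0 0 0 0 n m (k₁ := k₁) (k₂ := k₂) (k₃ := k₃)
    (fun r s h0 => ?_) (fun r s => ?_)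
  · simpa using this
  · have := kernel_bound q h0
    omega
  · rw [h]; push_cast; ring

lemma form_lower (k₁ k₂ k₃ : ℤ) (h : k₁ + k₂ + k₃ = 0) :
    form (k₁ - 1) k₂ k₃ = form k₁ k₂ k₃ - k₁ := by
  unfold form
  linear_combination h

lemma levelSum_step (hq0 : q ≠ 0) (hq : ‖q‖ < 1) (n m : ℕ) {k₁ k₂ k₃ : ℤ}
    (h : k₁ + k₂ + k₃ = 0) (h' : k₂ ≠ k₃) :
    levelSum q 0 0 (fun r s => kernel q r (s + 1) (k₁ - 1) k₂ k₃) n m =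
      q ^ form k₁ k₂ k₃ * kernel q n (m + 1) (k₁ - 1) k₂ k₃ +
      (q ^ form (k₁ - 1) (k₂ + 1) k₃ * kernel q n m (k₁ - 1) (k₂ + 1) k₃ / (1 - q ^ (k₃ - k₂)) +
       q ^ form (k₁ - 1) k₂ (k₃ + 1) * kernel q n m (k₁ - 1) k₂ (k₃ + 1) /
        (1 - q ^ (k₂ - k₃))) := by
  have key : (fun r s : ℕ => kernel q r (s + 1) (k₁ - 1) k₂ k₃) = fun r s : ℕ =>
      q ^ k₁ * (q ^ s * kernel q r (s + 1) (k₁ - 1) k₂ k₃) +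
      ((1 - q ^ (k₃ - k₂))⁻¹ * kernel q r s (k₁ - 1) (k₂ + 1) k₃ +
       (1 - q ^ (k₂ - k₃))⁻¹ * kernel q r s (k₁ - 1) k₂ (k₃ + 1)) := by
    funext r s
    have := kernel_rel_raise₁ hq0 hq r (s + 1) (k₁ - 1) h'
    rw [add_sub_cancel_right, show (s : ℤ) + 1 + (k₁ - 1) = k₁ + s by ring, zpow_add₀ hq0,
      zpow_natCast] at this
    linear_combination this
  rw [key, levelSum_add, levelSum_add, levelSum_mul, levelSum_mul, levelSum_mul, levelSum_pow,
    levelSum_zero_one hq0 hq n m (by omega), levelSum_zero_zero hq0 hq n m (by omega),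
    levelSum_zero_zero hq0 hq n m (by omega), form_lower _ _ _ h, zpow_sub₀ hq0]
  have := zpow_ne_zero k₁ hq0
  field_simp

end Levels

section Truncated

variable {q : ℂ}

lemma levelSum_asummable (q : ℂ) (ε δ : ℕ) (w : ℤ → ℤ → ℤ → ℂ)
    (B : ℕ → ℕ → ℤ → ℤ → ℤ → ℂ) (hB : ∀ r s, AFinite (B r s)) (n m : ℕ) :
    ASummable fun k₁ k₂ k₃ =>
      w k₁ k₂ k₃ * levelSum q ε δ (fun r s => B r s k₁ k₂ k₃) n m := by
  unfold levelSum ASummable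
  simp only [Finset.mul_sum]
  exact summable_sum fun p _ => (((hB p.1 p.2).mul_left
    (fun _ _ _ => q ^ (p.1 ^ 2 + p.2 ^ 2 - p.1 * p.2 + ε * p.1 + δ * p.2) *
      (qFacInv q ((n : ℤ) - p.1) * qFacInv q ((m : ℤ) - p.2)))).mul_left w).summable

/-- The truncated multisum with `j` levels. -/
def truncSum (q : ℂ) (β : ℕ → ℕ → ℂ) : ℕ → ℕ → ℕ → ℕ → ℕ → ℂ
  | 0, _, _ => β
  | j + 1, a, b => levelSum q (if a = 0 then 1 else 0) (if b = 0 then 1 else 0)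
      (truncSum q β j (a - 1) (b - 1))

/-- The lattice weight after `t` levels. -/
def levelWt (q : ℂ) (M : ℤ) (t : ℕ) (k₁ k₂ k₃ : ℤ) : ℂ :=
  wt q M k₁ k₂ k₃ * q ^ (t * (form k₁ k₂ k₃ - 1))

lemma form_swap₁₂ (k₁ k₂ k₃ : ℤ) : form k₂ k₁ k₃ = form k₁ k₂ k₃ := by unfold form; ring

lemma form_swap₂₃ (k₁ k₂ k₃ : ℤ) : form k₁ k₃ k₂ = form k₁ k₂ k₃ := by unfold form; ring

lemma levelWt_anti (q : ℂ) (M : ℤ) (t : ℕ) : AAnti (levelWt q M t) where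
  swap₁₂ k₁ k₂ k₃ h := by
    unfold levelWt
    rw [(wt_anti q M).swap₁₂ _ _ _ h, form_swap₁₂, neg_mul]
  swap₂₃ k₁ k₂ k₃ h := by
    unfold levelWt
    rw [(wt_anti q M).swap₂₃ _ _ _ h, form_swap₂₃, neg_mul]

lemma levelWt_succ (hq0 : q ≠ 0) (M : ℤ) (t : ℕ) (k₁ k₂ k₃ : ℤ) :
    levelWt q M (t + 1) k₁ k₂ k₃ = levelWt q M t k₁ k₂ k₃ * q ^ (form k₁ k₂ k₃ - 1) := by
  unfold levelWt
  push_cast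
  rw [add_mul, zpow_add₀ hq0, one_mul, mul_assoc]

lemma truncSum_zero_zero (hq0 : q ≠ 0) (hq : ‖q‖ < 1) {τ : ℤ} (hτ : τ = -1 ∨ τ = 0 ∨ τ = 1)
    (t n m : ℕ) :
    truncSum q (g q τ) t 0 0 n m = q ^ 2 * (1 - q) *
      asum (fun k₁ k₂ k₃ => levelWt q (3 + τ) t k₁ k₂ k₃ * q ^ (k₃ - k₁) *
        kernel q (n + 1) (m + 1) k₁ k₂ k₃) := by
  induction t generalizing n m with
  | zero =>
    simp only [truncSum, levelWt, Nat.cast_zero, zero_mul, zpow_zero, mul_one]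
    exact g_eq_asum hq0 hq hτ n m
  | succ t ih =>
    have e := funext₂ ih
    simp only [truncSum, zero_tsub, if_true]
    rw [e, levelSum_mul, levelSum_asum]
    · congr 1
      refine asum_congr fun k₁ k₂ k₃ h => ?_
      by_cases h' : k₁ = k₃
      · rw [levelWt_succ hq0, (levelWt_anti q (3 + τ) t).eq_zero' h (by tauto)]
        simp
      · rw [levelSum_one_one hq0 hq n m h h', levelWt_succ hq0]
        ring
    · intro r s
      exact kernel_finite_zero q _ _

lemma truncSum_any_zero (hq0 : q ≠ 0) (hq : ‖q‖ < 1) {τ : ℤ} (hτ : τ = -1 ∨ τ = 0 ∨ τ = 1)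
    (t u n m : ℕ) :
    truncSum q (g q τ) (t + u) u 0 n m = q ^ 2 * (1 - q) *
      asum (fun k₁ k₂ k₃ => levelWt q (3 + τ) t k₁ k₂ k₃ * q ^ (u * form (k₁ - 1) k₂ k₃) *
        q ^ (k₃ - k₁) * kernel q n (m + 1) (k₁ - 1) k₂ k₃) := by
  induction u generalizing n m with
  | zero =>
    have := asum_lower hq0 hq (levelWt_anti q (3 + τ) t) (n + 1) (m + 1)
    rw [add_zero, truncSum_zero_zero hq0 hq hτ, this]
    simp
  | succ u ih =>
    have e := funext₂ ih
    rw [← add_assoc, truncSum]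
    simp only [zero_tsub, add_tsub_cancel_right, if_true, Nat.add_eq_zero_iff, one_ne_zero,
      and_false, if_false]
    rw [e, levelSum_mul, levelSum_asum]
    · congr 1
      refine asum_congr fun k₁ k₂ k₃ h => ?_
      rw [levelSum_zero_one hq0 hq n m (by omega)]
      push_cast
      rw [add_mul, zpow_add₀ hq0, one_mul]
      ring
    · intro r s
      exact kernel_finite_one q _ _

lemma truncSum_diff (hq0 : q ≠ 0) (hq : ‖q‖ < 1) {τ : ℤ} (hτ : τ = -1 ∨ τ = 0 ∨ τ = 1)
    (t u b n m : ℕ) :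
    truncSum q (g q τ) (t + u + b + 1) (u + b + 1) (b + 1) n m -
      q * truncSum q (g q τ) (t + u + b + 1) (u + b) b n m = q ^ 2 * (1 - q) *
      asum (fun k₁ k₂ k₃ => levelWt q (3 + τ) t k₁ k₂ k₃ * q ^ (u * form (k₁ - 1) k₂ k₃) *
        q ^ ((b + 1 : ℕ) * form (k₁ - 1) k₂ (k₃ + 1)) *
        q ^ (k₃ - k₁) * kernel q n m (k₁ - 1) k₂ (k₃ + 1)) := by
  induction b generalizing n m with
  | zero =>
    have e := funext₂ (truncSum_any_zero hq0 hq hτ t u)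
    rw [add_zero, add_zero, truncSum, show t + u + 1 = t + 1 + u by ring,
      truncSum_any_zero hq0 hq hτ]
    simp only [add_tsub_cancel_right, Nat.add_eq_zero_iff, one_ne_zero,
      and_false, if_false]
    rw [e, levelSum_mul, levelSum_asum _ _ _ _ _ (fun r s => kernel_finite_one q _ _),
      mul_left_comm, ← mul_sub, ← asum_mul_left, ← asum_sub]
    · congr 1
      have hW : ∀ k₁ k₂ k₃, k₁ + k₂ + k₃ = 0 →
          levelWt q (3 + τ) t k₁ k₃ k₂ * q ^ (u * form (k₁ - 1) k₃ k₂) =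
          -(levelWt q (3 + τ) t k₁ k₂ k₃ * q ^ (u * form (k₁ - 1) k₂ k₃)) := by
        intro k₁ k₂ k₃ h
        rw [(levelWt_anti q (3 + τ) t).swap₂₃ _ _ _ h, form_swap₂₃, neg_mul]
      have := asum_symmetrize₂₃ hq0 hq hW ((kernel_finite_two q n m).mul_left
        (fun k₁ k₂ k₃ => q ^ form (k₁ - 1) k₂ (k₃ + 1)))
      refine Eq.trans (asum_congr fun k₁ k₂ k₃ h => ?_) (this.trans ?_)
      · by_cases h' : k₂ = k₃
        · rw [levelWt_succ hq0, (levelWt_anti q (3 + τ) t).eq_zero' h (by tauto)]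
          simp
        · rw [levelSum_step hq0 hq n m h h', levelWt_succ hq0, kernel_swap₂₃ q n m _ (k₂ + 1) k₃,
            form_swap₂₃ (k₁ - 1) (k₂ + 1) k₃]
          have hz : q ^ form k₁ k₂ k₃ = q * q ^ (form k₁ k₂ k₃ - 1) := by
            rw [zpow_sub_one₀ hq0]; field_simp
          linear_combination levelWt q (3 + τ) t k₁ k₂ k₃ * q ^ (u * form (k₁ - 1) k₂ k₃) *
            q ^ (k₃ - k₁) * kernel q n (m + 1) (k₁ - 1) k₂ k₃ * hz
      · refine asum_congr fun k₁ k₂ k₃ h => ?_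
        simp only [zero_add, Nat.cast_one, one_mul]
        ring
    · exact levelSum_asummable q 0 0 _ _ (fun r s => kernel_finite_one q _ _) n m
    · exact (((kernel_finite_one q _ _).mul_left _).mul_left _).summable
  | succ b ih =>
    have e := funext₂ ih
    have e' := congrArg (fun β => levelSum q 0 0 β n m) e
    rw [levelSum_sub_mul, levelSum_mul, levelSum_asum _ _ _ _ _
      (fun r s => kernel_finite_two q _ _)] at e'
    have h1 : truncSum q (g q τ) (t + u + (b + 1) + 1) (u + (b + 1) + 1) (b + 1 + 1) n m =
        levelSum q 0 0 (truncSum q (g q τ) (t + u + b + 1) (u + b + 1) (b + 1)) n m := by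
      rw [← add_assoc, truncSum]; simp [← add_assoc]
    have h2 : truncSum q (g q τ) (t + u + (b + 1) + 1) (u + (b + 1)) (b + 1) n m =
        levelSum q 0 0 (truncSum q (g q τ) (t + u + b + 1) (u + b) b) n m := by
      rw [← add_assoc, truncSum]; simp [← add_assoc]
    rw [h1, h2, e']
    congr 1
    refine asum_congr fun k₁ k₂ k₃ h => ?_
    rw [levelSum_zero_zero hq0 hq n m (by omega)]
    rw [show ((b + 1 + 1 : ℕ) : ℤ) = (b + 1 : ℕ) + 1 by push_cast; ring, add_mul,
      zpow_add₀ hq0, one_mul]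
    ring

end Truncated

section Bounds

open Filter Topology

variable {q : ℂ}

lemma summable_norm_mul_pow (a : ℂ) (hq : ‖q‖ < 1) : Summable fun j : ℕ => ‖-(a * q ^ j)‖ := by
  simp only [norm_neg, norm_mul, norm_pow]
  exact (summable_geometric_of_lt_one (norm_nonneg q) hq).mul_left _

lemma tendsto_qPoch (a : ℂ) (hq : ‖q‖ < 1) :
    Tendsto (qPoch a q) atTop (𝓝 (qPochInf a q)) := by
  have h := multipliable_one_add_of_summable (summable_norm_mul_pow a hq)
  have := h.tendsto_prod_tprod_nat
  change Tendsto (fun n => qPoch a q n) _ _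
  simpa only [qPoch, qPochInf, sub_eq_add_neg] using this

lemma qPochInf_ne_zero {a : ℂ} (hq : ‖q‖ < 1) (h : ∀ j : ℕ, 1 - a * q ^ j ≠ 0) :
    qPochInf a q ≠ 0 := by
  have := tprod_one_add_ne_zero_of_summable (f := fun j : ℕ => -(a * q ^ j))
    (fun j => by simpa only [sub_eq_add_neg] using h j) (summable_norm_mul_pow a hq)
  simpa only [qPochInf, sub_eq_add_neg] using this

lemma qPochInf_self_ne_zero (hq : ‖q‖ < 1) : qPochInf q q ≠ 0 :=
  qPochInf_ne_zero hq fun j => by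
    rw [← pow_succ']; exact one_sub_pow_ne_zero hq (Nat.succ_ne_zero j)

lemma exists_norm_le_of_tendsto {u : ℕ → ℂ} {l : ℂ} (h : Tendsto u atTop (𝓝 l)) :
    ∃ C, 0 ≤ C ∧ ∀ n, ‖u n‖ ≤ C := by
  obtain ⟨C, hC⟩ := h.norm.bddAbove_range
  exact ⟨C, (norm_nonneg _).trans (hC ⟨0, rfl⟩), fun n => hC ⟨n, rfl⟩⟩

lemma exists_norm_qPoch_le (a : ℂ) (hq : ‖q‖ < 1) : ∃ C, 0 ≤ C ∧ ∀ n, ‖qPoch a q n‖ ≤ C :=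
  exists_norm_le_of_tendsto (tendsto_qPoch a hq)

lemma tendsto_inv_qPoch (hq : ‖q‖ < 1) :
    Tendsto (fun n => (qPoch q q n)⁻¹) atTop (𝓝 (qPochInf q q)⁻¹) :=
  (tendsto_qPoch q hq).inv₀ (qPochInf_self_ne_zero hq)

lemma exists_norm_qFacInv_le (hq : ‖q‖ < 1) : ∃ C, 0 ≤ C ∧ ∀ z, ‖qFacInv q z‖ ≤ C := by
  obtain ⟨C, hC0, hC⟩ := exists_norm_le_of_tendsto (tendsto_inv_qPoch hq)
  refine ⟨C, hC0, fun z => ?_⟩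
  unfold qFacInv
  split_ifs
  · exact hC _
  · simpa using hC0

lemma tendsto_toNat_add (z : ℤ) : Tendsto (fun N : ℕ => ((N : ℤ) + z).toNat) atTop atTop := by
  refine tendsto_atTop.2 fun b => ?_
  filter_upwards [eventually_ge_atTop (b + z.natAbs)] with N hN
  omega

lemma tendsto_qFacInv (hq : ‖q‖ < 1) (z : ℤ) :
    Tendsto (fun N : ℕ => qFacInv q (N + z)) atTop (𝓝 (qPochInf q q)⁻¹) := by
  refine ((tendsto_inv_qPoch hq).comp (tendsto_toNat_add z)).congr' ?_
  filter_upwards [eventually_ge_atTop z.natAbs] with N hN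
  simp only [Function.comp_apply, qFacInv]
  rw [if_pos (by omega)]

lemma tendsto_qFac (hq : ‖q‖ < 1) (z : ℤ) :
    Tendsto (fun N : ℕ => qFac q (N + N + z)) atTop (𝓝 (qPochInf q q)) := by
  refine (tendsto_qPoch q hq).comp (tendsto_atTop.2 fun b => ?_)
  filter_upwards [eventually_ge_atTop (b + z.natAbs)] with N hN
  omega

lemma tendsto_kernel (hq : ‖q‖ < 1) (c d k₁ k₂ k₃ : ℤ) :
    Tendsto (fun N : ℕ => kernel q (N + c) (N + d) k₁ k₂ k₃) atTop
      (𝓝 ((qPochInf q q)⁻¹ ^ 5)) := by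
  have hP := qPochInf_self_ne_zero hq
  have := ((tendsto_qFac hq (c + d)).mul (((tendsto_qFacInv hq (c - k₁)).mul
    (tendsto_qFacInv hq (c - k₂))).mul (tendsto_qFacInv hq (c - k₃)) |>.mul
    (((tendsto_qFacInv hq (d + k₁)).mul
    (tendsto_qFacInv hq (d + k₂))).mul (tendsto_qFacInv hq (d + k₃)))))
  convert this using 2 with N
  · unfold kernel
    simp only [add_add_add_comm (N : ℤ) c N d, add_sub_assoc, add_assoc (N : ℤ) d]
  · field_simp

lemma exists_norm_kernel_le (hq : ‖q‖ < 1) :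
    ∃ C, 0 ≤ C ∧ ∀ n m k₁ k₂ k₃, ‖kernel q n m k₁ k₂ k₃‖ ≤ C := by
  obtain ⟨A, hA0, hA⟩ := exists_norm_qFacInv_le hq
  obtain ⟨B, hB0, hB⟩ := exists_norm_qPoch_le q hq
  refine ⟨B * (A * A * A * (A * A * A)), by positivity, fun n m k₁ k₂ k₃ => ?_⟩
  unfold kernel qFac
  simp only [norm_mul]
  gcongr <;> first | exact hA _ | exact hB _

lemma exists_norm_g_le (hq : ‖q‖ < 1) (τ : ℤ) : ∃ C, 0 ≤ C ∧ ∀ n m, ‖g q τ n m‖ ≤ C := by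
  obtain ⟨A, hA0, hA⟩ := exists_norm_le_of_tendsto (tendsto_inv_qPoch hq)
  obtain ⟨A', hA'0, hA'⟩ : ∃ C, 0 ≤ C ∧ ∀ n, ‖(qPoch (q ^ 2) q n)⁻¹‖ ≤ C := by
    refine exists_norm_le_of_tendsto ((tendsto_qPoch (q ^ 2) hq).inv₀
      (qPochInf_ne_zero hq fun j => ?_))
    rw [← pow_add]
    exact one_sub_pow_ne_zero hq (by omega)
  obtain ⟨B, hB0, hB⟩ : ∃ C, 0 ≤ C ∧ ∀ n m, ‖qBinom (if τ = 0 then q ^ 3 else q) n m‖ ≤ C := by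
    have hp : ‖if τ = 0 then q ^ 3 else q‖ < 1 := by
      split_ifs
      · rw [norm_pow]; exact pow_lt_one₀ (norm_nonneg _) hq (by norm_num)
      · exact hq
    generalize (if τ = 0 then q ^ 3 else q) = p at hp
    obtain ⟨C, hC0, hC⟩ := exists_norm_le_of_tendsto (tendsto_inv_qPoch hp)
    obtain ⟨D, hD0, hD⟩ := exists_norm_qPoch_le p hp
    refine ⟨D * (C * C), by positivity, fun n m => ?_⟩
    unfold qBinom
    split_ifs
    · rw [div_eq_mul_inv, mul_inv]
      simp only [norm_mul]
      gcongr <;> first | exact hC _ | exact hD _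
    · rw [norm_zero]; positivity
  refine ⟨1 * (A * A') * B, by positivity, fun n m => ?_⟩
  unfold g
  rw [div_eq_mul_inv, mul_inv]
  simp only [norm_mul]
  gcongr
  · rw [norm_pow]; exact pow_le_one₀ (norm_nonneg _) hq.le
  · exact hA _
  · exact hA' _
  · exact hB _ _

end Bounds

section MultiTerm

open Filter Topology

variable {q : ℂ}

/-- Exponent of `q` contributed by one level of the multisum. -/
def levelExp (ε δ r s : ℕ) : ℕ := r ^ 2 + s ^ 2 - r * s + ε * r + δ * s

/-- The summand of the truncated multisum with `j` levels. -/
def multiTerm (q : ℂ) (β : ℕ → ℕ → ℂ) :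
    (j a b n m : ℕ) → (Fin j → ℕ) → (Fin j → ℕ) → ℂ
  | 0, _, _, n, m, _, _ => β n m
  | j + 1, a, b, n, m, f, h =>
    q ^ levelExp (if a = 0 then 1 else 0) (if b = 0 then 1 else 0) (f 0) (h 0) *
      (qFacInv q ((n : ℤ) - f 0) * qFacInv q ((m : ℤ) - h 0)) *
      multiTerm q β j (a - 1) (b - 1) (f 0) (h 0) (Fin.tail f) (Fin.tail h)

/-- Geometric majorant on `Fin j → ℕ`. -/
def geo (ρ : ℝ) (j : ℕ) (f : Fin j → ℕ) : ℝ := ∏ i, ρ ^ f i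

lemma geo_nonneg {ρ : ℝ} (h : 0 ≤ ρ) (j : ℕ) (f : Fin j → ℕ) : 0 ≤ geo ρ j f :=
  Finset.prod_nonneg fun _ _ => pow_nonneg h _

lemma geo_succ (ρ : ℝ) (j : ℕ) (f : Fin (j + 1) → ℕ) :
    geo ρ (j + 1) f = ρ ^ f 0 * geo ρ j (Fin.tail f) := by
  rw [geo, Fin.prod_univ_succ]; rfl

lemma summable_geo {ρ : ℝ} (h0 : 0 ≤ ρ) (h1 : ρ < 1) (j : ℕ) : Summable (geo ρ j) := by
  induction j with
  | zero => exact .of_finite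
  | succ j ih =>
    rw [← (Fin.consEquiv fun _ => ℕ).summable_iff]
    have := (summable_geometric_of_lt_one h0 h1).mul_of_nonneg ih (fun n => pow_nonneg h0 n)
      (geo_nonneg h0 j)
    refine this.congr fun p => ?_
    change _ = geo ρ (j + 1) (Fin.cons p.1 p.2 : Fin (j + 1) → ℕ)
    rw [geo_succ, Fin.tail_cons, Fin.cons_zero]

lemma levelExp_le (ε δ r s : ℕ) : r + s ≤ 2 * levelExp ε δ r s := by
  unfold levelExp
  have h1 : r * s ≤ r ^ 2 + s ^ 2 := by nlinarith [sq_nonneg ((r : ℤ) - s), sq_nonneg (r - s)]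
  zify [h1]
  have h2 : (r : ℤ) ≤ r ^ 2 := by exact_mod_cast Nat.le_self_pow two_ne_zero r
  have h3 : (s : ℤ) ≤ s ^ 2 := by exact_mod_cast Nat.le_self_pow two_ne_zero s
  have h4 : (0 : ℤ) ≤ ε * r := by positivity
  have h5 : (0 : ℤ) ≤ δ * s := by positivity
  nlinarith [sq_nonneg ((r : ℤ) - s)]

lemma norm_pow_levelExp_le (hq : ‖q‖ < 1) (ε δ r s : ℕ) :
    ‖q ^ levelExp ε δ r s‖ ≤ √‖q‖ ^ r * √‖q‖ ^ s := by
  rw [norm_pow, ← pow_add]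
  nth_rewrite 1 [← Real.sq_sqrt (norm_nonneg q)]
  rw [← pow_mul]
  exact pow_le_pow_of_le_one (Real.sqrt_nonneg _)
    (Real.sqrt_le_one.2 hq.le) (levelExp_le ε δ r s)

lemma exists_norm_multiTerm_le (hq : ‖q‖ < 1) {β : ℕ → ℕ → ℂ} {C : ℝ} (hC0 : 0 ≤ C)
    (hC : ∀ n m, ‖β n m‖ ≤ C) (j : ℕ) : ∃ D, 0 ≤ D ∧ ∀ a b n m f h,
    ‖multiTerm q β j a b n m f h‖ ≤ D * (geo √‖q‖ j f * geo √‖q‖ j h) := by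
  induction j with
  | zero => exact ⟨C, hC0, fun a b n m f h => by simpa [multiTerm, geo] using hC n m⟩
  | succ j ih =>
    obtain ⟨D, hD0, hD⟩ := ih
    obtain ⟨A, hA0, hA⟩ := exists_norm_qFacInv_le hq
    refine ⟨A * A * D, by positivity, fun a b n m f h => ?_⟩
    rw [multiTerm, geo_succ, geo_succ]
    simp only [norm_mul]
    have e1 := norm_pow_levelExp_le hq (if a = 0 then 1 else 0) (if b = 0 then 1 else 0)
      (f 0) (h 0)
    have e2 := hD (a - 1) (b - 1) (f 0) (h 0) (Fin.tail f) (Fin.tail h)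
    have e3 := hA (n - f 0)
    have e4 := hA (m - h 0)
    calc _ ≤ (√‖q‖ ^ f 0 * √‖q‖ ^ h 0) * (A * A) *
          (D * (geo √‖q‖ j (Fin.tail f) * geo √‖q‖ j (Fin.tail h))) := by gcongr
      _ = _ := by ring

lemma summable_geo_mul (hq : ‖q‖ < 1) (j : ℕ) : Summable fun p : (Fin j → ℕ) × (Fin j → ℕ) =>
    geo √‖q‖ j p.1 * geo √‖q‖ j p.2 := by
  have h0 := Real.sqrt_nonneg ‖q‖
  have h1 : √‖q‖ < 1 := by
    rw [Real.sqrt_lt' one_pos]; simpa using hq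
  exact (summable_geo h0 h1 j).mul_of_nonneg (summable_geo h0 h1 j) (geo_nonneg h0 j)
    (geo_nonneg h0 j)

lemma summable_multiTerm (hq : ‖q‖ < 1) {β : ℕ → ℕ → ℂ} {C : ℝ} (hC0 : 0 ≤ C)
    (hC : ∀ n m, ‖β n m‖ ≤ C) (j a b n m : ℕ) :
    Summable fun p : (Fin j → ℕ) × (Fin j → ℕ) => multiTerm q β j a b n m p.1 p.2 := by
  obtain ⟨D, hD0, hD⟩ := exists_norm_multiTerm_le hq hC0 hC j
  exact Summable.of_norm_bounded ((summable_geo_mul hq j).mul_left D)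
    fun p => hD a b n m p.1 p.2

/-- Splitting off the first entries of a pair of sequences. -/
def consPairEquiv (j : ℕ) :
    (ℕ × ℕ) × ((Fin j → ℕ) × (Fin j → ℕ)) ≃ (Fin (j + 1) → ℕ) × (Fin (j + 1) → ℕ) :=
  (Equiv.prodProdProdComm _ _ _ _).trans
    ((Fin.consEquiv fun _ => ℕ).prodCongr (Fin.consEquiv fun _ => ℕ))

lemma multiTerm_cons (q : ℂ) (β : ℕ → ℕ → ℂ) (j a b n m : ℕ)
    (x : (ℕ × ℕ) × ((Fin j → ℕ) × (Fin j → ℕ))) :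
    multiTerm q β (j + 1) a b n m (consPairEquiv j x).1 (consPairEquiv j x).2 =
    q ^ levelExp (if a = 0 then 1 else 0) (if b = 0 then 1 else 0) x.1.1 x.1.2 *
      (qFacInv q ((n : ℤ) - x.1.1) * qFacInv q ((m : ℤ) - x.1.2)) *
      multiTerm q β j (a - 1) (b - 1) x.1.1 x.1.2 x.2.1 x.2.2 := by
  change multiTerm q β (j + 1) a b n m (Fin.cons x.1.1 x.2.1 : Fin (j + 1) → ℕ)
    (Fin.cons x.1.2 x.2.2 : Fin (j + 1) → ℕ) = _
  simp only [multiTerm, Fin.tail_cons, Fin.cons_zero]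

lemma tsum_multiTerm (hq : ‖q‖ < 1) {β : ℕ → ℕ → ℂ} {C : ℝ} (hC0 : 0 ≤ C)
    (hC : ∀ n m, ‖β n m‖ ≤ C) (j a b n m : ℕ) :
    ∑' p : (Fin j → ℕ) × (Fin j → ℕ), multiTerm q β j a b n m p.1 p.2 =
      truncSum q β j a b n m := by
  induction j generalizing a b n m with
  | zero =>
    rw [tsum_eq_single (fun i => i.elim0, fun i => i.elim0)]
    · rfl
    · intro p hp
      exact absurd (Subsingleton.elim _ _) hp
  | succ j ih =>
    have hs := summable_multiTerm hq hC0 hC (j + 1) a b n m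
    rw [← (consPairEquiv j).summable_iff] at hs
    simp only [Function.comp_def, multiTerm_cons] at hs
    rw [← (consPairEquiv j).tsum_eq]
    simp only [multiTerm_cons]
    rw [Summable.tsum_prod' hs]
    · simp only [tsum_mul_left, ih]
      rw [truncSum, levelSum, tsum_eq_sum (s := Finset.range (n + 1) ×ˢ Finset.range (m + 1))]
      · rfl
      · rintro ⟨r, s⟩ hp
        have : (n : ℤ) - r < 0 ∨ (m : ℤ) - s < 0 := by
          simp only [Finset.mem_product, Finset.mem_range] at hp
          omega
        rcases this with h | h <;> simp [qFacInv_of_neg q h]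
    · intro x
      have := summable_multiTerm hq hC0 hC j (a - 1) (b - 1) x.1 x.2
      exact this.mul_left (q ^ levelExp (if a = 0 then 1 else 0) (if b = 0 then 1 else 0) x.1 x.2 *
        (qFacInv q ((n : ℤ) - x.1) * qFacInv q ((m : ℤ) - x.2)))

/-- The summand of the full multisum. -/
def fullTerm (q : ℂ) (β : ℕ → ℕ → ℂ) (j a b : ℕ) (f h : Fin (j + 1) → ℕ) : ℂ :=
  q ^ levelExp (if a = 0 then 1 else 0) (if b = 0 then 1 else 0) (f 0) (h 0) *
    multiTerm q β j (a - 1) (b - 1) (f 0) (h 0) (Fin.tail f) (Fin.tail h)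

lemma summable_fullTerm (hq : ‖q‖ < 1) {β : ℕ → ℕ → ℂ} {C : ℝ} (hC0 : 0 ≤ C)
    (hC : ∀ n m, ‖β n m‖ ≤ C) (j a b : ℕ) :
    Summable fun p : (Fin (j + 1) → ℕ) × (Fin (j + 1) → ℕ) =>
      fullTerm q β j a b p.1 p.2 := by
  obtain ⟨D, hD0, hD⟩ := exists_norm_multiTerm_le hq hC0 hC j
  refine Summable.of_norm_bounded ((summable_geo_mul hq (j + 1)).mul_left D) fun p => ?_
  rw [fullTerm, geo_succ, geo_succ, norm_mul]
  calc _ ≤ (√‖q‖ ^ p.1 0 * √‖q‖ ^ p.2 0) *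
          (D * (geo √‖q‖ j (Fin.tail p.1) * geo √‖q‖ j (Fin.tail p.2))) := by
        gcongr
        · exact norm_pow_levelExp_le hq _ _ _ _
        · exact hD _ _ _ _ _ _
    _ = _ := by ring

lemma tendsto_truncSum (hq : ‖q‖ < 1) {β : ℕ → ℕ → ℂ} {C : ℝ} (hC0 : 0 ≤ C)
    (hC : ∀ n m, ‖β n m‖ ≤ C) (j a b : ℕ) :
    Tendsto (fun N => truncSum q β (j + 1) a b N N) atTop
      (𝓝 ((qPochInf q q)⁻¹ ^ 2 *
        ∑' p : (Fin (j + 1) → ℕ) × (Fin (j + 1) → ℕ), fullTerm q β j a b p.1 p.2)) := by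
  obtain ⟨D, hD0, hD⟩ := exists_norm_multiTerm_le hq hC0 hC (j + 1)
  simp only [← tsum_multiTerm hq hC0 hC, ← tsum_mul_left]
  refine tendsto_tsum_of_dominated_convergence ((summable_geo_mul hq (j + 1)).mul_left D)
    (fun p => ?_) (Eventually.of_forall fun N p => hD a b N N p.1 p.2)
  have h1 := tendsto_qFacInv hq (-(p.1 0 : ℤ))
  have h2 := tendsto_qFacInv hq (-(p.2 0 : ℤ))
  have := ((h1.mul h2).const_mul (q ^ levelExp (if a = 0 then 1 else 0)
    (if b = 0 then 1 else 0) (p.1 0) (p.2 0))).mul_const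
    (multiTerm q β j (a - 1) (b - 1) (p.1 0) (p.2 0) (Fin.tail p.1) (Fin.tail p.2))
  simp only [← sub_eq_add_neg] at this
  convert this using 2
  · rw [multiTerm]
  · unfold fullTerm
    ring

end MultiTerm

section ClosedForm

open Filter Topology

variable {q : ℂ}

lemma nth_one {j : ℕ} (f : Fin (j + 1) → ℕ) : nth f 1 = f 0 := by
  simp [nth]

lemma nth_tail {j : ℕ} (f : Fin (j + 1) → ℕ) {i : ℕ} (hi : 1 ≤ i) :
    nth (Fin.tail f) i = nth f (i + 1) := by
  unfold nth
  by_cases h : i ≤ j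
  · rw [dif_pos ⟨hi, h⟩, dif_pos (by omega)]
    unfold Fin.tail
    congr 1
    ext
    simp
    omega
  · rw [dif_neg (by omega), dif_neg (by omega)]

lemma sum_Icc_shift (F : ℕ → ℕ) (a j : ℕ) :
    ∑ i ∈ Finset.Icc (a + 1) (j + 1), F i =
      (if a = 0 then 1 else 0) * F 1 + ∑ i ∈ Finset.Icc (a - 1 + 1) j, F (i + 1) := by
  have key : ∀ c, ∑ i ∈ Finset.Icc (c + 1) (j + 1), F i = ∑ i ∈ Finset.Icc c j, F (i + 1) := by
    intro c
    rw [← Finset.map_add_right_Icc, Finset.sum_map]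
    rfl
  rcases a with _ | a
  · rw [zero_add, ← Finset.add_sum_Ioc_eq_sum_Icc (by omega : 1 ≤ j + 1)]
    have : Finset.Ioc 1 (j + 1) = Finset.Icc (1 + 1) (j + 1) := by
      ext; simp; omega
    rw [this, key]
    simp
  · simp [key]

lemma prod_Icc_shift (F : ℕ → ℂ) (j : ℕ) :
    ∏ i ∈ Finset.Icc 1 (j + 1), F i = F 1 * ∏ i ∈ Finset.Icc 1 j, F (i + 1) := by
  rw [← Finset.mul_prod_Ioc_eq_prod_Icc (by omega : 1 ≤ j + 1)]
  have : Finset.Ioc 1 (j + 1) = Finset.Icc (1 + 1) (j + 1) := by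
    ext; simp; omega
  rw [this, ← Finset.map_add_right_Icc, Finset.prod_map]
  rfl

/-- The exponent of `q` in the summand of the multisum. -/
def multiExp (k a b : ℕ) {l : ℕ} (f h : Fin l → ℕ) : ℕ :=
  (∑ i ∈ Finset.Icc 1 k, (nth f i ^ 2 + nth h i ^ 2 - nth f i * nth h i)) +
    (∑ i ∈ Finset.Icc (a + 1) k, nth f i) + (∑ i ∈ Finset.Icc (b + 1) k, nth h i)

/-- The product of reciprocal factorials in the summand of the multisum. -/
def multiProd (q : ℂ) (k : ℕ) {l : ℕ} (f h : Fin l → ℕ) : ℂ :=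
  ∏ i ∈ Finset.Icc 1 k, qFacInv q ((nth f i : ℤ) - (nth f (i + 1) : ℤ)) *
    qFacInv q ((nth h i : ℤ) - (nth h (i + 1) : ℤ))

lemma fullTerm_eq (q : ℂ) (β : ℕ → ℕ → ℂ) (j a b : ℕ) (f h : Fin (j + 1) → ℕ) :
    fullTerm q β j a b f h = q ^ multiExp (j + 1) a b f h * multiProd q j f h *
      β (nth f (j + 1)) (nth h (j + 1)) := by
  have shift : ∀ (j a b : ℕ) (f h : Fin (j + 1) → ℕ), multiExp (j + 1) a b f h =
      levelExp (if a = 0 then 1 else 0) (if b = 0 then 1 else 0) (f 0) (h 0) +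
        multiExp j (a - 1) (b - 1) (Fin.tail f) (Fin.tail h) := by
    intro j a b f h
    unfold multiExp levelExp
    have e1 := sum_Icc_shift (fun i => nth f i ^ 2 + nth h i ^ 2 - nth f i * nth h i) 0 j
    have e2 := sum_Icc_shift (nth f) a j
    have e3 := sum_Icc_shift (nth h) b j
    have t : ∀ (l : ℕ → ℕ → ℕ) c, 1 ≤ c → ∑ i ∈ Finset.Icc c j, l (nth f (i + 1)) (nth h (i + 1)) =
        ∑ i ∈ Finset.Icc c j, l (nth (Fin.tail f) i) (nth (Fin.tail h) i) := by
      intro l c hc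
      refine Finset.sum_congr rfl fun i hi => ?_
      rw [Finset.mem_Icc] at hi
      rw [nth_tail f (by omega), nth_tail h (by omega)]
    have t1 := t (fun x y => x ^ 2 + y ^ 2 - x * y) 1 le_rfl
    have t2 := t (fun x y => x) (a - 1 + 1) (by omega)
    have t3 := t (fun x y => y) (b - 1 + 1) (by omega)
    simp only [zero_add, zero_tsub, if_true, one_mul, nth_one] at e1 e2 e3 t1 t2 t3
    rw [e1, e2, e3, t1, t2, t3]
    ring
  induction j generalizing a b with
  | zero =>
    rw [shift]
    simp [fullTerm, multiTerm, multiProd, multiExp, nth_one]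
  | succ j ih =>
    have e : fullTerm q β (j + 1) a b f h =
        q ^ levelExp (if a = 0 then 1 else 0) (if b = 0 then 1 else 0) (f 0) (h 0) *
        (qFacInv q ((f 0 : ℤ) - Fin.tail f 0) * qFacInv q ((h 0 : ℤ) - Fin.tail h 0)) *
        fullTerm q β j (a - 1) (b - 1) (Fin.tail f) (Fin.tail h) := by
      unfold fullTerm
      rw [multiTerm]
      ring
    rw [e, ih, shift (j + 1), pow_add]
    have hp : multiProd q (j + 1) f h =
        qFacInv q ((f 0 : ℤ) - Fin.tail f 0) * qFacInv q ((h 0 : ℤ) - Fin.tail h 0) *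
        multiProd q j (Fin.tail f) (Fin.tail h) := by
      unfold multiProd
      rw [prod_Icc_shift]
      congr 1
      refine Finset.prod_congr rfl fun i hi => ?_
      rw [Finset.mem_Icc] at hi
      rw [nth_tail f hi.1, nth_tail h hi.1, nth_tail f (by omega), nth_tail h (by omega)]
    rw [hp, nth_tail f (by omega), nth_tail h (by omega)]
    ring

lemma multiProd_eq_zero (q : ℂ) {j : ℕ} {f h : Fin (j + 1) → ℕ}
    (hd : ¬ ((∀ i l : Fin (j + 1), i ≤ l → f l ≤ f i) ∧
      ∀ i l : Fin (j + 1), i ≤ l → h l ≤ h i)) : multiProd q j f h = 0 := by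
  have key : ∀ f : Fin (j + 1) → ℕ, (∀ i ∈ Finset.Icc 1 j, nth f (i + 1) ≤ nth f i) →
      ∀ i l : Fin (j + 1), i ≤ l → f l ≤ f i := by
    intro f hf
    have : Antitone f := by
      rw [Fin.antitone_iff_succ_le]
      intro i
      have h1 := hf (i + 1) (by simp)
      unfold nth at h1
      rw [dif_pos (by omega), dif_pos (by omega)] at h1
      exact h1
    exact fun i l hil => this hil
  by_contra h0
  unfold multiProd at h0
  rw [← ne_eq, Finset.prod_ne_zero_iff] at h0
  refine hd ⟨key f fun i hi => ?_, key h fun i hi => ?_⟩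
  · have := left_ne_zero_of_mul (h0 i hi)
    by_contra hlt
    exact this (qFacInv_of_neg q (by omega))
  · have := right_ne_zero_of_mul (h0 i hi)
    by_contra hlt
    exact this (qFacInv_of_neg q (by omega))

lemma tsum_decr {j : ℕ} (F : (Fin j → ℕ) → (Fin j → ℕ) → ℂ)
    (hF : ∀ f h, ¬ ((∀ i l : Fin j, i ≤ l → f l ≤ f i) ∧ ∀ i l : Fin j, i ≤ l → h l ≤ h i) →
      F f h = 0) :
    ∑' p : Decr j × Decr j, F p.1.1 p.2.1 = ∑' p : (Fin j → ℕ) × (Fin j → ℕ), F p.1 p.2 := by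
  have inj : Function.Injective fun p : Decr j × Decr j => (p.1.1, p.2.1) := by
    rintro ⟨⟨a, _⟩, ⟨b, _⟩⟩ ⟨⟨c, _⟩, ⟨d, _⟩⟩ h
    simp only [Prod.mk.injEq] at h
    obtain ⟨rfl, rfl⟩ := h
    rfl
  refine inj.tsum_eq (f := fun p : (Fin j → ℕ) × (Fin j → ℕ) => F p.1 p.2) ?_
  intro p hp
  have : (∀ i l : Fin j, i ≤ l → p.1 l ≤ p.1 i) ∧ ∀ i l : Fin j, i ≤ l → p.2 l ≤ p.2 i := by
    by_contra h
    exact hp (hF _ _ h)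
  exact ⟨(⟨p.1, this.1⟩, ⟨p.2, this.2⟩), rfl⟩

end ClosedForm

section JacobiTriple

open Filter Topology

variable {p z : ℂ}

/-- The term of the theta series. -/
def thetaTerm (p z : ℂ) (n : ℤ) : ℂ := (-1) ^ n * p ^ (n * (n - 1) / 2) * z ^ n

lemma two_mul_choose (n : ℤ) : 2 * (n * (n - 1) / 2) = n * (n - 1) :=
  Int.mul_ediv_cancel' (Int.even_mul_pred_self n).two_dvd

lemma thetaTerm_succ (hp : p ≠ 0) (hz : z ≠ 0) (n : ℤ) :
    thetaTerm p z (n + 1) = -(p ^ n * z) * thetaTerm p z n := by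
  have h1 := two_mul_choose n
  have h2 := two_mul_choose (n + 1)
  have : (n + 1) * (n + 1 - 1) / 2 = n * (n - 1) / 2 + n := by linarith
  unfold thetaTerm
  rw [this, zpow_add₀ hp, zpow_add_one₀ hz, zpow_add_one₀ (by norm_num : (-1 : ℂ) ≠ 0)]
  ring

lemma thetaTerm_ne_zero (hp : p ≠ 0) (hz : z ≠ 0) (n : ℤ) : thetaTerm p z n ≠ 0 := by
  unfold thetaTerm
  exact mul_ne_zero (mul_ne_zero (zpow_ne_zero _ (by norm_num)) (zpow_ne_zero _ hp))
    (zpow_ne_zero _ hz)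

lemma summable_thetaTerm (hp : p ≠ 0) (hp1 : ‖p‖ < 1) (hz : z ≠ 0) :
    Summable (thetaTerm p z) := by
  have h0 := tendsto_pow_atTop_nhds_zero_of_norm_lt_one hp1
  refine Summable.of_nat_of_neg ?_ ?_
  · refine summable_of_ratio_test_tendsto_lt_one (l := 0) one_pos
      (Eventually.of_forall fun n => thetaTerm_ne_zero hp hz _) ?_
    have := (h0.mul_const z).norm
    rw [zero_mul, norm_zero] at this
    refine this.congr fun n => ?_
    rw [Nat.cast_succ, thetaTerm_succ hp hz, norm_mul (-(p ^ (n : ℤ) * z)),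
      mul_div_cancel_right₀ _ (norm_ne_zero_iff.2 (thetaTerm_ne_zero hp hz _)), norm_neg,
      zpow_natCast]
  · refine summable_of_ratio_test_tendsto_lt_one (l := 0) one_pos
      (Eventually.of_forall fun n => thetaTerm_ne_zero hp hz _) ?_
    have := (h0.mul_const (p / z)).norm
    rw [zero_mul, norm_zero] at this
    refine this.congr fun n => ?_
    have h := thetaTerm_succ hp hz (-((n + 1 : ℕ) : ℤ))
    rw [show -((n + 1 : ℕ) : ℤ) + 1 = -(n : ℤ) by push_cast; ring] at h
    have hne := thetaTerm_ne_zero hp hz (-((n + 1 : ℕ) : ℤ))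
    rw [h, ← norm_div]
    have e : thetaTerm p z (-((n + 1 : ℕ) : ℤ)) /
        (-(p ^ (-((n + 1 : ℕ) : ℤ)) * z) * thetaTerm p z (-((n + 1 : ℕ) : ℤ))) =
        -(p ^ n * (p / z)) := by
      rw [zpow_neg, zpow_natCast]
      field_simp
      ring
    rw [e, norm_neg]

lemma qFacInv_prev (hp1 : ‖p‖ < 1) {x y : ℤ} (h : x = y - 1) :
    qFacInv p x = (1 - p ^ y) * qFacInv p y := by
  rw [h, qFacInv_sub_one hp1]

/-- Finite form of the triple product identity. -/
lemma hasSum_thetaTerm_finite (hp : p ≠ 0) (hp1 : ‖p‖ < 1) (hz : z ≠ 0) (N : ℕ) :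
    HasSum (fun n : ℤ => qFacInv p (N + -n) * qFacInv p (N + n) * thetaTerm p z n)
      (qPoch z p N * qPoch (p / z) p N / qPoch p p (N + N)) := by
  induction N with
  | zero =>
    refine hasSum_of_eq (hasSum_ite_eq 0 1) (fun n => ?_) (by simp [qPoch_zero])
    by_cases h : n = 0
    · subst h; simp [qFacInv_zero, thetaTerm]
    · rw [if_neg h]
      rcases lt_or_gt_of_ne h with h | h
      · rw [qFacInv_of_neg p (z := ((0 : ℕ) : ℤ) + n) (by simpa using h)]; ring
      · rw [qFacInv_of_neg p (z := ((0 : ℕ) : ℤ) + -n) (by simpa using h)]; ring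
  | succ N ih =>
    have h1 := one_sub_pow_ne_zero hp1 (Nat.succ_ne_zero (N + N))
    have h2 := one_sub_pow_ne_zero hp1 (Nat.succ_ne_zero (N + N + 1))
    have hP := qPoch_self_ne_zero hp1 (N + N)
    have up := (Equiv.subRight (1 : ℤ)).hasSum_iff.2 ih
    have dn := (Equiv.addRight (1 : ℤ)).hasSum_iff.2 ih
    have := ((ih.mul_left (1 + p ^ (2 * N + 1))).sub ((up.mul_left (z * p ^ N)).add
      (dn.mul_left (p ^ (N + 1) / z)))).mul_left
        (((1 - p ^ (N + N + 1)) * (1 - p ^ (N + N + 2)))⁻¹)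
    refine hasSum_of_eq this (fun n => ?_) ?_
    · simp only [Function.comp_apply, Equiv.subRight_apply, Equiv.coe_addRight]
      have t1 := thetaTerm_succ hp hz (n - 1)
      have t2 := thetaTerm_succ hp hz n
      rw [sub_add_cancel] at t1
      have e1 := qFacInv_prev hp1 (x := N + -n) (y := (N + 1 : ℕ) + -n) (by push_cast; ring)
      have e2 := qFacInv_prev hp1 (x := N + n) (y := (N + 1 : ℕ) + n) (by push_cast; ring)
      have e3 := qFacInv_prev hp1 (x := N + (n - 1)) (y := N + n) (by ring)
      have e4 := qFacInv_prev hp1 (x := N + -(n + 1)) (y := N + -n) (by ring)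
      have e5 : (N : ℤ) + -(n - 1) = (N + 1 : ℕ) + -n := by push_cast; ring
      have e6 : (N : ℤ) + (n + 1) = (N + 1 : ℕ) + n := by push_cast; ring
      rw [e3, e4, e5, e6, e1, e2, t2, t1]
      generalize qFacInv p ((N + 1 : ℕ) + -n) = I
      generalize qFacInv p ((N + 1 : ℕ) + n) = J
      generalize thetaTerm p z (n - 1) = T
      have z1 : p ^ (((N + 1 : ℕ) : ℤ) + -n) = p ^ N * p / p ^ n := by
        rw [zpow_add₀ hp, zpow_neg, zpow_natCast, pow_succ]; rfl
      have z2 : p ^ (((N + 1 : ℕ) : ℤ) + n) = p ^ N * p * p ^ n := by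
        rw [zpow_add₀ hp, zpow_natCast, pow_succ]
      have z3 : p ^ ((N : ℤ) + -n) = p ^ N / p ^ n := by
        rw [zpow_add₀ hp, zpow_neg, zpow_natCast]; rfl
      have z4 : p ^ ((N : ℤ) + n) = p ^ N * p ^ n := by
        rw [zpow_add₀ hp, zpow_natCast]
      have z5 : p ^ (n - 1) = p ^ n / p := by rw [zpow_sub_one₀ hp]; rfl
      rw [z1, z2, z3, z4, z5]
      have hpn := zpow_ne_zero n hp
      have q1 : p ^ (N + N + 1) = p ^ N * p ^ N * p := by ring
      have q2 : p ^ (N + N + 2) = p ^ N * p ^ N * p * p := by ring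
      have q3 : p ^ (2 * N + 1) = p ^ N * p ^ N * p := by ring
      have q4 : p ^ (N + 1) = p ^ N * p := by ring
      simp only [Nat.succ_eq_add_one, add_assoc, Nat.reduceAdd] at h1 h2
      rw [← add_assoc, q1] at h1
      rw [← add_assoc, q2] at h2
      rw [q1, q2, q3, q4]
      generalize p ^ n = X at *
      generalize p ^ N = Y at *
      rw [eq_inv_mul_iff_mul_eq₀ (mul_ne_zero h1 h2)]
      field_simp
      ring
    · rw [show N + 1 + (N + 1) = N + N + 1 + 1 by ring, qPoch_self_succ, qPoch_self_succ,
        qPoch_succ, qPoch_succ]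
      simp only [Nat.succ_eq_add_one] at h1 h2
      field_simp
      ring

/-- The Jacobi triple product identity. -/
theorem hasSum_thetaTerm (hp : p ≠ 0) (hp1 : ‖p‖ < 1) (hz : z ≠ 0) :
    HasSum (thetaTerm p z) (qPochInf p p * theta z p) := by
  obtain ⟨A, hA0, hA⟩ := exists_norm_qFacInv_le hp1
  have hs := summable_thetaTerm hp hp1 hz
  have hP := qPochInf_self_ne_zero hp1
  have lim1 : Tendsto (fun N : ℕ => ∑' n : ℤ,
      qFacInv p (N + -n) * qFacInv p (N + n) * thetaTerm p z n) atTop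
      (𝓝 (∑' n, (qPochInf p p)⁻¹ * (qPochInf p p)⁻¹ * thetaTerm p z n)) := by
    refine tendsto_tsum_of_dominated_convergence (hs.norm.mul_left (A * A)) (fun n => ?_)
      (Eventually.of_forall fun N n => ?_)
    · exact ((tendsto_qFacInv hp1 _).mul (tendsto_qFacInv hp1 _)).mul_const _
    · rw [norm_mul, norm_mul]
      gcongr
      · exact hA _
      · exact hA _
  have lim2 : Tendsto (fun N => qPoch z p N * qPoch (p / z) p N / qPoch p p (N + N)) atTop
      (𝓝 (qPochInf z p * qPochInf (p / z) p / qPochInf p p)) := by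
    refine ((tendsto_qPoch z hp1).mul (tendsto_qPoch _ hp1)).div ?_ hP
    exact (tendsto_qPoch p hp1).comp (tendsto_atTop_mono (fun N => Nat.le_add_left N N) tendsto_id)
  have := tendsto_nhds_unique (lim1.congr fun N =>
    (hasSum_thetaTerm_finite hp hp1 hz N).tsum_eq) lim2
  rw [tsum_mul_left] at this
  refine hasSum_of_eq hs.hasSum (fun _ => rfl) ?_
  unfold theta
  field_simp at this
  linear_combination -this

/-- The triple product in base `p³` at `z = p²`. -/
lemma theta_sq_cube (hp : p ≠ 0) (hp1 : ‖p‖ < 1) :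
    qPochInf (p ^ 3) (p ^ 3) * theta (p ^ 2) (p ^ 3) = qPochInf p p := by
  have hp3 : ‖p ^ 3‖ < 1 := by
    rw [norm_pow]; exact pow_lt_one₀ (norm_nonneg _) hp1 (by norm_num)
  have fin : ∀ N, qPoch (p ^ 3) (p ^ 3) N * (qPoch (p ^ 2) (p ^ 3) N * qPoch p (p ^ 3) N) =
      qPoch p p (3 * N) := by
    intro N
    induction N with
    | zero => simp [qPoch_zero]
    | succ N ih =>
      rw [show 3 * (N + 1) = 3 * N + 1 + 1 + 1 by ring]
      simp only [qPoch_succ p p, ← ih]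
      simp only [qPoch_succ]
      ring
  have e : p ^ 3 / p ^ 2 = p := by field_simp
  unfold theta
  rw [e]
  refine tendsto_nhds_unique (((tendsto_qPoch _ hp3).mul ((tendsto_qPoch _ hp3).mul
    (tendsto_qPoch _ hp3))).congr fin) ?_
  exact (tendsto_qPoch p hp1).comp (tendsto_atTop_mono (fun N => by simp; omega) tendsto_id)

end JacobiTriple

section Macdonald

open Filter Topology

variable {p z x y : ℂ}

lemma thetaTerm_add (hp : p ≠ 0) (hz : z ≠ 0) (l m : ℤ) :
    thetaTerm p z (l + m) = thetaTerm p z m * thetaTerm p (z * p ^ m) l := by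
  have h1 := two_mul_choose l
  have h2 := two_mul_choose m
  have h3 := two_mul_choose (l + m)
  have : (l + m) * (l + m - 1) / 2 = l * (l - 1) / 2 + m * (m - 1) / 2 + m * l := by
    linarith
  unfold thetaTerm
  rw [this, zpow_add₀ hp, zpow_add₀ hp, zpow_add₀ hz, mul_zpow, zpow_mul,
    zpow_add₀ (by norm_num : (-1 : ℂ) ≠ 0)]
  ring

lemma hasSum_thetaTerm_shift (hp : p ≠ 0) (hp1 : ‖p‖ < 1) (hz : z ≠ 0) (m : ℤ) :
    HasSum (thetaTerm p (z * p ^ m)) (qPochInf p p * theta z p / thetaTerm p z m) := by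
  have h := thetaTerm_ne_zero hp hz m
  have := ((Equiv.addRight m).hasSum_iff.2 (hasSum_thetaTerm hp hp1 hz)).mul_left
    (thetaTerm p z m)⁻¹
  refine hasSum_of_eq this (fun l => ?_) (by ring)
  simp only [Function.comp_apply, Equiv.coe_addRight]
  rw [thetaTerm_add hp hz]
  field_simp

lemma theta_one (p : ℂ) : theta 1 p = 0 := by
  have : qPochInf 1 p = 0 := tprod_of_exists_eq_zero ⟨0, by simp⟩
  rw [theta, this, zero_mul]

lemma neg_one_zpow_add_two_mul (a l : ℤ) : (-1 : ℂ) ^ (a + 2 * l) = (-1) ^ a := by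
  rw [zpow_add₀ (by norm_num), zpow_mul]
  norm_num

/-- The summand of the lattice form of the theta product. -/
def macTerm (p x y : ℂ) (k₁ _k₂ k₃ : ℤ) : ℂ :=
  chi (k₁ - k₃) * p ^ quad k₁ k₃ * x ^ (1 - k₁) * y ^ (1 + k₃)

lemma six_mul_quad {k₁ k₃ : ℤ} (h : (k₁ - k₃) % 3 ≠ 0) :
    3 * quad k₁ k₃ = k₁ ^ 2 + k₁ * k₃ + k₃ ^ 2 - 1 := by
  refine Int.mul_ediv_cancel' ?_
  obtain ⟨c, e, hc, he⟩ : ∃ c e : ℤ, k₁ = k₃ + 3 * c + e ∧ (e = 1 ∨ e = 2) :=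
    ⟨(k₁ - k₃) / 3, (k₁ - k₃) % 3, by omega, by omega⟩
  subst hc
  rcases he with rfl | rfl
  · exact ⟨k₃ ^ 2 + 3 * k₃ * c + 3 * c ^ 2 + k₃ + 2 * c, by ring⟩
  · exact ⟨k₃ ^ 2 + 3 * k₃ * c + 3 * c ^ 2 + 2 * k₃ + 4 * c + 1, by ring⟩

lemma thetaTerm_triple (hp : p ≠ 0) (hx : x ≠ 0) (hy : y ≠ 0) (k₁ k₃ l : ℤ) :
    thetaTerm p x (1 - k₁ - l) * thetaTerm p y (1 + k₃ - l) * thetaTerm p (x * y) l =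
      (-1) ^ (k₁ - k₃) * p ^ ((1 - k₁) * (1 - k₁ - 1) / 2 + (1 + k₃) * (1 + k₃ - 1) / 2) *
        x ^ (1 - k₁) * y ^ (1 + k₃) * thetaTerm (p ^ 3) (p ^ (k₁ - k₃)) l := by
  have h1 := two_mul_choose (1 - k₁)
  have h2 := two_mul_choose (1 + k₃)
  have h3 := two_mul_choose (1 - k₁ - l)
  have h4 := two_mul_choose (1 + k₃ - l)
  have h5 := two_mul_choose l
  have e : (1 - k₁ - l) * (1 - k₁ - l - 1) / 2 + (1 + k₃ - l) * (1 + k₃ - l - 1) / 2 +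
      l * (l - 1) / 2 = ((1 - k₁) * (1 - k₁ - 1) / 2 + (1 + k₃) * (1 + k₃ - 1) / 2) +
      (3 * (l * (l - 1) / 2) + (k₁ - k₃) * l) := by
    linarith
  have hs : (-1 : ℂ) ^ (1 - k₁ - l) * (-1) ^ (1 + k₃ - l) * (-1) ^ l =
      (-1) ^ (k₁ - k₃) * (-1) ^ l := by
    have h0 : (-1 : ℂ) ≠ 0 := by norm_num
    rw [← zpow_add₀ h0, ← zpow_add₀ h0, ← zpow_add₀ h0,
      ← neg_one_zpow_add_two_mul _ (k₁ - k₃ + l - 1)]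
    congr 1
    ring
  have hX : x ^ (1 - k₁ - l) * x ^ l = x ^ (1 - k₁) := by
    rw [← zpow_add₀ hx, sub_add_cancel]
  have hY : y ^ (1 + k₃ - l) * y ^ l = y ^ (1 + k₃) := by
    rw [← zpow_add₀ hy, sub_add_cancel]
  have hP : p ^ ((1 - k₁ - l) * (1 - k₁ - l - 1) / 2) * p ^ ((1 + k₃ - l) * (1 + k₃ - l - 1) / 2) *
      p ^ (l * (l - 1) / 2) =
      p ^ ((1 - k₁) * (1 - k₁ - 1) / 2 + (1 + k₃) * (1 + k₃ - 1) / 2) *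
        ((p ^ 3) ^ (l * (l - 1) / 2) * (p ^ (k₁ - k₃)) ^ l) := by
    rw [← zpow_add₀ hp, ← zpow_add₀ hp, e, zpow_add₀ hp, zpow_add₀ hp (3 * _), zpow_mul, zpow_mul]
    rfl
  unfold thetaTerm
  rw [mul_zpow, ← hX, ← hY]
  calc _ = ((-1 : ℂ) ^ (1 - k₁ - l) * (-1) ^ (1 + k₃ - l) * (-1) ^ l) *
      (p ^ ((1 - k₁ - l) * (1 - k₁ - l - 1) / 2) * p ^ ((1 + k₃ - l) * (1 + k₃ - l - 1) / 2) *
      p ^ (l * (l - 1) / 2)) * (x ^ (1 - k₁ - l) * x ^ l) * (y ^ (1 + k₃ - l) * y ^ l) := by ring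
    _ = _ := by rw [hs, hP]; ring

lemma hasSum_thetaTerm_triple (hp : p ≠ 0) (hp1 : ‖p‖ < 1) (hx : x ≠ 0) (hy : y ≠ 0)
    (k₁ k₂ k₃ : ℤ) :
    HasSum (fun l => thetaTerm p x (1 - k₁ - l) * thetaTerm p y (1 + k₃ - l) *
      thetaTerm p (x * y) l) (qPochInf p p * macTerm p x y k₁ k₂ k₃) := by
  have hp3 : ‖p ^ 3‖ < 1 := by
    rw [norm_pow]; exact pow_lt_one₀ (norm_nonneg _) hp1 (by norm_num)
  have hp30 : p ^ 3 ≠ 0 := pow_ne_zero 3 hp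
  obtain ⟨m, e, hd, he⟩ : ∃ m : ℤ, ∃ e : ℕ, k₁ - k₃ = 3 * m + e ∧ (e = 0 ∨ e = 1 ∨ e = 2) :=
    ⟨(k₁ - k₃) / 3, ((k₁ - k₃) % 3).toNat, by omega, by omega⟩
  have hz : p ^ (k₁ - k₃) = p ^ e * (p ^ 3) ^ m := by
    rw [hd, zpow_add₀ hp, zpow_mul, mul_comm]; norm_cast
  have := (hasSum_thetaTerm_shift hp30 hp3 (pow_ne_zero e hp) m).mul_left
    ((-1) ^ (k₁ - k₃) * p ^ ((1 - k₁) * (1 - k₁ - 1) / 2 + (1 + k₃) * (1 + k₃ - 1) / 2) *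
        x ^ (1 - k₁) * y ^ (1 + k₃))
  refine hasSum_of_eq this (fun l => by rw [thetaTerm_triple hp hx hy, hz]) ?_
  have key : ∀ e : ℕ, (e = 1 ∨ e = 2) → k₁ - k₃ = 3 * m + e →
      qPochInf p p * macTerm p x y k₁ k₂ k₃ =
      (-1) ^ (k₁ - k₃) * p ^ ((1 - k₁) * (1 - k₁ - 1) / 2 + (1 + k₃) * (1 + k₃ - 1) / 2) *
        x ^ (1 - k₁) * y ^ (1 + k₃) * (qPochInf p p / thetaTerm (p ^ 3) (p ^ e) m) := by
    intro e he hd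
    have h1 := two_mul_choose (1 - k₁)
    have h2 := two_mul_choose (1 + k₃)
    have h3 := two_mul_choose m
    have h4 := six_mul_quad (k₁ := k₁) (k₃ := k₃) (by omega)
    have hk : k₁ = k₃ + 3 * m + e := by omega
    have hE : (1 - k₁) * (1 - k₁ - 1) / 2 + (1 + k₃) * (1 + k₃ - 1) / 2 =
        quad k₁ k₃ + (3 * (m * (m - 1) / 2) + e * m) := by
      have : 6 * ((1 - k₁) * (1 - k₁ - 1) / 2 + (1 + k₃) * (1 + k₃ - 1) / 2) =
        6 * (quad k₁ k₃ + (3 * (m * (m - 1) / 2) + e * m)) := by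
        rw [hk] at h1 h4 ⊢
        rcases he with rfl | rfl <;> push_cast at * <;> nlinarith
      omega
    have hchi : chi (k₁ - k₃) * (-1) ^ m = (-1) ^ (k₁ - k₃) := by
      rw [hd, zpow_add₀ (by norm_num), zpow_mul]
      rcases he with rfl | rfl
      · have : chi (3 * m + (1 : ℕ)) = -1 := by
          unfold chi; rw [if_neg (by omega), if_pos (by omega)]
        rw [this]; norm_num
      · have : chi (3 * m + (2 : ℕ)) = 1 := by
          unfold chi; rw [if_pos (by omega)]
        rw [this]; norm_num
    have hT : thetaTerm (p ^ 3) (p ^ e) m = (-1) ^ m * p ^ (3 * (m * (m - 1) / 2) + e * m) := by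
      unfold thetaTerm
      rw [zpow_add₀ hp, zpow_mul, zpow_mul]
      norm_cast
      ring
    have n1 := zpow_ne_zero m (by norm_num : (-1 : ℂ) ≠ 0)
    have n2 := zpow_ne_zero (3 * (m * (m - 1) / 2) + e * m) hp
    rw [hT, hE, zpow_add₀ hp, ← hchi, macTerm]
    generalize ((-1 : ℂ) ^ m) = S at *
    field_simp
  rcases he with rfl | rfl | rfl
  · rw [pow_zero, theta_one, macTerm, chi, if_neg (by omega), if_neg (by omega)]
    simp
  · have hc : theta (p ^ 1) (p ^ 3) = theta (p ^ 2) (p ^ 3) := by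
      unfold theta
      rw [show p ^ 3 / p ^ 1 = p ^ 2 by field_simp, show p ^ 3 / p ^ 2 = p ^ 1 by field_simp,
        mul_comm]
    rw [hc, theta_sq_cube hp hp1]
    exact key 1 (by simp) hd
  · rw [theta_sq_cube hp hp1]
    exact key 2 (by simp) hd

/-- The change of summation variables in the triple product of theta series. -/
def macEquiv : (ℤ × ℤ) × ℤ ≃ (ℤ × ℤ) × ℤ where
  toFun v := ((1 - v.1.1 - v.2, 1 + v.1.2 - v.2), v.2)
  invFun v := ((1 - v.1.1 - v.2, v.1.2 + v.2 - 1), v.2)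
  left_inv v := by ext <;> dsimp only <;> ring
  right_inv v := by ext <;> dsimp only <;> ring

lemma hasSum_macEquiv {F : ℤ → ℤ → ℤ → ℂ} {s : ℂ}
    (h : HasSum (fun v : (ℤ × ℤ) × ℤ => F v.1.1 v.1.2 v.2) s) :
    HasSum (fun v : (ℤ × ℤ) × ℤ => F (1 - v.1.1 - v.2) (1 + v.1.2 - v.2) v.2) s :=
  macEquiv.hasSum_iff (f := fun v : (ℤ × ℤ) × ℤ => F v.1.1 v.1.2 v.2) |>.2 h

lemma hasSum_mul_prod {ι κ : Type} {f : ι → ℂ} {g : κ → ℂ} {a b : ℂ} (hf : HasSum f a)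
    (hg : HasSum g b) : HasSum (fun v : ι × κ => f v.1 * g v.2) (a * b) :=
  hf.mul hg (summable_mul_of_summable_norm hf.summable.norm hg.summable.norm)

lemma hasSum_mul_mul {f g h : ℤ → ℂ} {a b c : ℂ} (hf : HasSum f a) (hg : HasSum g b)
    (hh : HasSum h c) :
    HasSum (fun v : (ℤ × ℤ) × ℤ => f v.1.1 * g v.1.2 * h v.2) (a * b * c) :=
  hasSum_mul_prod (f := fun v : ℤ × ℤ => f v.1 * g v.2) (hasSum_mul_prod hf hg) hh

/-- The denominator identity for `A₂^{(1)}` in lattice form. -/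
theorem hasSum_macTerm (hp : p ≠ 0) (hp1 : ‖p‖ < 1) (hx : x ≠ 0) (hy : y ≠ 0) :
    HasSum (fun v : ℤ × ℤ => macTerm p x y v.1 (-v.1 - v.2) v.2)
      (qPochInf p p ^ 2 * (theta x p * theta y p * theta (x * y) p)) := by
  have hP := qPochInf_self_ne_zero hp1
  have h := hasSum_macEquiv (F := fun i j l => thetaTerm p x i * thetaTerm p y j *
    thetaTerm p (x * y) l) (hasSum_mul_mul (hasSum_thetaTerm hp hp1 hx)
      (hasSum_thetaTerm hp hp1 hy) (hasSum_thetaTerm hp hp1 (mul_ne_zero hx hy)))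
  have := HasSum.prod_fiberwise h
    (fun v => hasSum_thetaTerm_triple hp hp1 hx hy v.1 (-v.1 - v.2) v.2)
  refine hasSum_of_eq (this.mul_left (qPochInf p p)⁻¹) (fun v => ?_) ?_
  · rw [inv_mul_cancel_left₀ hP]
  · field_simp

end Macdonald

section Limit

open Filter Topology

variable {q : ℂ}

lemma coeff_eq_macTerm (hq0 : q ≠ 0) {τ : ℤ} {t u b K : ℕ}
    (hK : (K : ℤ) = 3 * (t + u + b : ℕ) + τ + 3) {k₁ k₂ k₃ : ℤ} (h : k₁ + k₂ + k₃ = 0) :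
    q ^ 2 * (levelWt q (3 + τ) t k₁ k₂ k₃ * q ^ (u * form (k₁ - 1) k₂ k₃) *
      q ^ (b * form (k₁ - 1) k₂ (k₃ + 1)) * q ^ (k₃ - k₁)) =
    macTerm (q ^ K) (q ^ (u + b + 1)) (q ^ (b + 1)) k₁ k₂ k₃ := by
  unfold levelWt wt macTerm
  by_cases hc : (k₁ - k₃) % 3 = 0
  · rw [chi, if_neg (by omega), if_neg (by omega)]; ring
  have h3 := six_mul_quad hc
  obtain rfl : k₂ = -k₁ - k₃ := by omega
  have f1 : form k₁ (-k₁ - k₃) k₃ = 3 * quad k₁ k₃ + 1 := by rw [h3]; unfold form; ring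
  have f2 : form (k₁ - 1) (-k₁ - k₃) k₃ = 3 * quad k₁ k₃ + 1 - k₁ := by
    rw [h3]; unfold form; ring
  have f3 : form (k₁ - 1) (-k₁ - k₃) (k₃ + 1) = 3 * quad k₁ k₃ + 2 + k₃ - k₁ := by
    rw [h3]; unfold form; ring
  rw [f1, f2, f3]
  simp only [← zpow_natCast q, ← zpow_mul]
  have e : (2 : ℕ) + (3 + τ) * quad k₁ k₃ + t * (3 * quad k₁ k₃ + 1 - 1) +
      u * (3 * quad k₁ k₃ + 1 - k₁) + b * (3 * quad k₁ k₃ + 2 + k₃ - k₁) + (k₃ - k₁) =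
      K * quad k₁ k₃ + (u + b + 1 : ℕ) * (1 - k₁) + (b + 1 : ℕ) * (1 + k₃) := by
    rw [hK]; push_cast; ring
  have := congrArg (fun z : ℤ => q ^ z) e
  simp only [zpow_add₀ hq0] at this
  linear_combination chi (k₁ - k₃) * this

/-- The product side of the theorem. -/
def thetaProd (p x y : ℂ) : ℂ :=
  qPochInf p p ^ 2 * (theta x p * theta y p * theta (x * y) p)

lemma tendsto_asum_macTerm (hq : ‖q‖ < 1) {p x y : ℂ} (hp : p ≠ 0) (hp1 : ‖p‖ < 1)
    (hx : x ≠ 0) (hy : y ≠ 0) (d e : ℤ) :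
    Tendsto (fun N : ℕ => asum fun k₁ k₂ k₃ => macTerm p x y k₁ k₂ k₃ *
      kernel q N (N + d) (k₁ - 1) k₂ (k₃ + e)) atTop
      (𝓝 (thetaProd p x y * (qPochInf q q)⁻¹ ^ 5)) := by
  have hs := hasSum_macTerm hp hp1 hx hy
  obtain ⟨C, hC0, hC⟩ := exists_norm_kernel_le hq
  rw [thetaProd, ← hs.tsum_eq, ← tsum_mul_right]
  refine tendsto_tsum_of_dominated_convergence (hs.summable.norm.mul_right C) (fun v => ?_)
    (.of_forall fun N v => ?_)
  · have := tendsto_kernel hq 0 d (v.1 - 1) (-v.1 - v.2) (v.2 + e)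
    simp only [add_zero] at this
    exact this.const_mul _
  · rw [norm_mul]
    exact mul_le_mul_of_nonneg_left (hC _ _ _ _ _) (norm_nonneg _)

/-- The multisum over all pairs of sequences of length `j + 1`. -/
def multiSum (q : ℂ) (τ : ℤ) (j a b : ℕ) : ℂ :=
  ∑' p : (Fin (j + 1) → ℕ) × (Fin (j + 1) → ℕ), fullTerm q (g q τ) j a b p.1 p.2

lemma tendsto_truncSum_g (hq : ‖q‖ < 1) (τ : ℤ) (j a b : ℕ) :
    Tendsto (fun N => truncSum q (g q τ) (j + 1) a b N N) atTop
      (𝓝 ((qPochInf q q)⁻¹ ^ 2 * multiSum q τ j a b)) := by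
  obtain ⟨C, hC0, hC⟩ := exists_norm_g_le hq τ
  exact tendsto_truncSum hq hC0 hC j a b

lemma summable_multiSum (hq : ‖q‖ < 1) (τ : ℤ) (j a b : ℕ) :
    Summable fun p : (Fin (j + 1) → ℕ) × (Fin (j + 1) → ℕ) =>
      fullTerm q (g q τ) j a b p.1 p.2 := by
  obtain ⟨C, hC0, hC⟩ := exists_norm_g_le hq τ
  exact summable_fullTerm hq hC0 hC j a b

lemma g_comm (q : ℂ) (τ : ℤ) (n m : ℕ) : g q τ n m = g q τ m n := by
  have : ∀ p : ℂ, qBinom p (n + m) n = qBinom p (m + n) m := by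
    intro p
    unfold qBinom
    rw [if_pos (by omega), if_pos (by omega), add_sub_cancel_left, add_sub_cancel_left,
      add_comm (n : ℤ) m, mul_comm (qPoch p p (n : ℤ).toNat)]
  unfold g
  rw [this, mul_comm n m, add_comm n m]

lemma multiSum_comm (q : ℂ) (τ : ℤ) (j a b : ℕ) : multiSum q τ j a b = multiSum q τ j b a := by
  unfold multiSum
  rw [← (Equiv.prodComm _ _).tsum_eq]
  refine tsum_congr fun p => ?_
  rw [Equiv.prodComm_apply, Prod.fst_swap, Prod.snd_swap, fullTerm_eq, fullTerm_eq, g_comm]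
  have e1 : multiExp (j + 1) a b p.2 p.1 = multiExp (j + 1) b a p.1 p.2 := by
    unfold multiExp
    rw [add_right_comm]
    congr 2
    refine Finset.sum_congr rfl fun i _ => ?_
    rw [add_comm, mul_comm]
  have e2 : multiProd q j p.2 p.1 = multiProd q j p.1 p.2 :=
    Finset.prod_congr rfl fun i _ => mul_comm _ _
  rw [e1, e2]

/-- The two-term combination of multisums appearing in the theorem. -/
def multiDiff (q : ℂ) (τ : ℤ) (j a b : ℕ) : ℂ :=
  multiSum q τ j a b - if a = 0 ∨ b = 0 then 0 else q * multiSum q τ j (a - 1) (b - 1)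

lemma multiDiff_eq_of_tendsto (hq : ‖q‖ < 1) {τ : ℤ} {j a b : ℕ} {L : ℂ}
    (h : Tendsto (fun N => truncSum q (g q τ) (j + 1) a b N N -
      if a = 0 ∨ b = 0 then 0 else q * truncSum q (g q τ) (j + 1) (a - 1) (b - 1) N N) atTop
      (𝓝 ((1 - q) * (L * (qPochInf q q)⁻¹ ^ 5)))) :
    multiDiff q τ j a b = (1 - q) * (L / qPochInf q q ^ 3) := by
  have hP := qPochInf_self_ne_zero hq
  have h2 : Tendsto (fun N => truncSum q (g q τ) (j + 1) a b N N -
      if a = 0 ∨ b = 0 then 0 else q * truncSum q (g q τ) (j + 1) (a - 1) (b - 1) N N) atTop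
      (𝓝 ((qPochInf q q)⁻¹ ^ 2 * multiDiff q τ j a b)) := by
    unfold multiDiff
    split_ifs
    · simpa using tendsto_truncSum_g hq τ j a b
    · rw [mul_sub, mul_left_comm _ q]
      exact (tendsto_truncSum_g hq τ j a b).sub ((tendsto_truncSum_g hq τ j _ _).const_mul q)
  have := tendsto_nhds_unique h2 h
  field_simp at this ⊢
  linear_combination this

lemma multiDiff_of_le (hq0 : q ≠ 0) (hq : ‖q‖ < 1) {τ : ℤ} (hτ : τ = -1 ∨ τ = 0 ∨ τ = 1)
    {j a b K : ℕ} (ha : a ≤ j + 1) (hba : b ≤ a) (hK : (K : ℤ) = 3 * (j + 1 : ℕ) + τ + 3) :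
    multiDiff q τ j a b = (1 - q) * (thetaProd (q ^ K) (q ^ (a + 1)) (q ^ (b + 1)) /
      qPochInf q q ^ 3) := by
  have hK1 : ‖q ^ K‖ < 1 := by
    rw [norm_pow]; exact pow_lt_one₀ (norm_nonneg _) hq (by omega)
  obtain ⟨t, ht⟩ := Nat.exists_eq_add_of_le' ha
  refine multiDiff_eq_of_tendsto hq ?_
  obtain ⟨u, rfl⟩ := Nat.exists_eq_add_of_le' hba
  have hK' : (K : ℤ) = 3 * (t + u + b : ℕ) + τ + 3 := by rw [hK, ht, ← add_assoc t]
  have hlim := fun d e => (tendsto_asum_macTerm hq (pow_ne_zero K hq0) hK1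
    (pow_ne_zero (u + b + 1) hq0) (pow_ne_zero (b + 1) hq0) d e).const_mul (1 - q)
  rcases b with _ | b
  · refine (hlim 1 0).congr fun N => ?_
    simp only [or_true, if_true, sub_zero]
    rw [ht, add_zero, truncSum_any_zero hq0 hq hτ, mul_comm (q ^ 2), mul_assoc,
      ← asum_mul_left (q ^ 2)]
    congr 1
    refine asum_congr fun k₁ k₂ k₃ h => ?_
    rw [← coeff_eq_macTerm hq0 hK' h]
    simp only [Nat.cast_zero, zero_mul, zpow_zero, add_zero]
    ring
  · refine (hlim 0 1).congr fun N => ?_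
    rw [if_neg (by omega), ht, ← add_assoc, ← add_assoc, ← add_assoc, add_tsub_cancel_right,
      add_tsub_cancel_right, truncSum_diff hq0 hq hτ, mul_comm (q ^ 2), mul_assoc,
      ← asum_mul_left (q ^ 2)]
    congr 1
    refine asum_congr fun k₁ k₂ k₃ h => ?_
    rw [add_assoc u b 1, ← coeff_eq_macTerm hq0 hK' h]
    simp only [add_zero]
    ring

lemma multiDiff_eq (hq0 : q ≠ 0) (hq : ‖q‖ < 1) {τ : ℤ} (hτ : τ = -1 ∨ τ = 0 ∨ τ = 1)
    {j a b K : ℕ} (ha : a ≤ j + 1) (hb : b ≤ j + 1)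
    (hK : (K : ℤ) = 3 * (j + 1 : ℕ) + τ + 3) :
    multiDiff q τ j a b = (1 - q) * (thetaProd (q ^ K) (q ^ (a + 1)) (q ^ (b + 1)) /
      qPochInf q q ^ 3) := by
  rcases le_total b a with h | h
  · exact multiDiff_of_le hq0 hq hτ ha h hK
  · have := multiDiff_of_le hq0 hq hτ hb h hK
    have e : multiDiff q τ j a b = multiDiff q τ j b a := by
      simp only [multiDiff, or_comm (a := a = 0), multiSum_comm q τ j a,
        multiSum_comm q τ j (a - 1)]
    rw [e, this, thetaProd, thetaProd, mul_comm (theta (q ^ (b + 1)) _), mul_comm (q ^ (b + 1))]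

/-- Lowering both indices of the multisum exponent. -/
lemma multiExp_lower {k a b : ℕ} (ha : 1 ≤ a) (hak : a ≤ k) (hb : 1 ≤ b) (hbk : b ≤ k) {l : ℕ}
    (f h : Fin l → ℕ) :
    multiExp k (a - 1) (b - 1) f h = nth f a + nth h b + multiExp k a b f h := by
  have key : ∀ (F : ℕ → ℕ) {c : ℕ}, 1 ≤ c → c ≤ k →
      ∑ i ∈ Finset.Icc (c - 1 + 1) k, F i = F c + ∑ i ∈ Finset.Icc (c + 1) k, F i := by
    intro F c h1 h2
    rw [Nat.sub_add_cancel h1, ← Finset.add_sum_Ioc_eq_sum_Icc h2]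
    congr 2
    ext i; simp only [Finset.mem_Ioc, Finset.mem_Icc]; omega
  unfold multiExp
  rw [key _ ha hak, key _ hb hbk]
  ring

lemma summand_eq (hq1 : 1 - q ≠ 0) (τ : ℤ) {j a b : ℕ} (ha : a ≤ j + 1) (hb : b ≤ j + 1)
    (f h : Fin (j + 1) → ℕ) :
    (1 - (if a = 0 ∨ b = 0 then (0 : ℂ) else q ^ (nth f a + nth h b + 1))) / (1 - q) *
      q ^ multiExp (j + 1) a b f h * multiProd q j f h * g q τ (nth f (j + 1)) (nth h (j + 1)) =
    (1 - q)⁻¹ * (fullTerm q (g q τ) j a b f h -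
      if a = 0 ∨ b = 0 then 0 else q * fullTerm q (g q τ) j (a - 1) (b - 1) f h) := by
  rw [fullTerm_eq, fullTerm_eq]
  split_ifs with h0
  · field_simp
    ring
  · rw [multiExp_lower (by omega) ha (by omega) hb]
    field_simp
    ring

lemma tsum_fullTerm_sub (hq : ‖q‖ < 1) (τ : ℤ) (j a b : ℕ) :
    ∑' p : (Fin (j + 1) → ℕ) × (Fin (j + 1) → ℕ), (fullTerm q (g q τ) j a b p.1 p.2 -
      if a = 0 ∨ b = 0 then 0 else q * fullTerm q (g q τ) j (a - 1) (b - 1) p.1 p.2) =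
    multiDiff q τ j a b := by
  unfold multiDiff
  split_ifs
  · simp only [sub_zero]; rfl
  · rw [(summable_multiSum hq τ j a b).tsum_sub ((summable_multiSum hq τ j _ _).mul_left q),
      tsum_mul_left]
    rfl

lemma qPochInf_zero (q : ℂ) : qPochInf 0 q = 1 := by simp [qPochInf]

lemma theta_zero_zero : theta 0 0 = 1 := by simp [theta, qPochInf_zero]

lemma multiExp_pos {j : ℕ} (a b : ℕ) {f h : Fin (j + 1) → ℕ} (hne : (f, h) ≠ (0, 0)) :
    multiExp (j + 1) a b f h ≠ 0 := by
  intro h0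
  refine hne ?_
  have h1 : ∀ i ∈ Finset.Icc 1 (j + 1),
      nth f i ^ 2 + nth h i ^ 2 - nth f i * nth h i = 0 := by
    rw [← Finset.sum_eq_zero_iff]
    unfold multiExp at h0
    omega
  have h2 : ∀ i : Fin (j + 1), f i = 0 ∧ h i = 0 := by
    intro i
    have := h1 (i + 1) (Finset.mem_Icc.2 ⟨by omega, by omega⟩)
    have hf : ∀ f : Fin (j + 1) → ℕ, nth f (i + 1) = f i := by
      intro f
      unfold nth
      rw [dif_pos ⟨by omega, by omega⟩]
      rfl
    rw [hf, hf] at this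
    have hle := Nat.sub_eq_zero_iff_le.1 this
    constructor <;> nlinarith [sq_nonneg ((f i : ℤ) - h i)]
  exact Prod.ext (funext fun i => (h2 i).1) (funext fun i => (h2 i).2)

lemma multiSummand_zero (τ : ℤ) (j a b : ℕ) (c : (Fin (j + 1) → ℕ) → (Fin (j + 1) → ℕ) → ℂ)
    (hc : c 0 0 = 1) :
    ∑' p : (Fin (j + 1) → ℕ) × (Fin (j + 1) → ℕ), c p.1 p.2 *
      0 ^ multiExp (j + 1) a b p.1 p.2 * multiProd 0 j p.1 p.2 *
        g 0 τ (nth p.1 (j + 1)) (nth p.2 (j + 1)) = 1 := by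
  have hn : ∀ i, nth (0 : Fin (j + 1) → ℕ) i = 0 := by
    intro i; unfold nth; split_ifs <;> rfl
  rw [tsum_eq_single (0, 0)]
  · simp [hc, multiExp, multiProd, hn, g, qPoch_zero, qBinom, qFacInv_zero]
  · rintro ⟨f, h⟩ hne
    rw [zero_pow (multiExp_pos a b hne)]
    ring

end Limit

/-- The Kanade–Russell conjecture (Theorem 1.2 of the paper): for `k ≥ 1`,
`0 ≤ a, b ≤ k`, `τ ∈ {-1,0,1}` and `K = 3k + τ + 3`, the
Andrews–Schilling–Warnaar-type multisum equals the modulus-`K` theta product. -/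
theorem kanade_russell_conjecture
    (k : ℕ) (hk : 1 ≤ k) (a b : ℕ) (ha : a ≤ k) (hb : b ≤ k)
    (τ : ℤ) (hτ : τ = -1 ∨ τ = 0 ∨ τ = 1)
    (K : ℕ) (hK : (K : ℤ) = 3 * k + τ + 3)
    (q : ℂ) (hq : ‖q‖ < 1) :
    (∑' p : Decr k × Decr k,
      (1 - (if a = 0 ∨ b = 0 then (0 : ℂ) else
          q ^ (nth p.1.1 a + nth p.2.1 b + 1))) / (1 - q) *
        q ^ ((∑ i ∈ Finset.Icc 1 k,
                (nth p.1.1 i ^ 2 + nth p.2.1 i ^ 2 - nth p.1.1 i * nth p.2.1 i)) +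
              (∑ i ∈ Finset.Icc (a + 1) k, nth p.1.1 i) +
              (∑ i ∈ Finset.Icc (b + 1) k, nth p.2.1 i)) *
        (∏ i ∈ Finset.Icc 1 (k - 1),
          qFacInv q ((nth p.1.1 i : ℤ) - (nth p.1.1 (i + 1) : ℤ)) *
            qFacInv q ((nth p.2.1 i : ℤ) - (nth p.2.1 (i + 1) : ℤ))) *
        g q τ (nth p.1.1 k) (nth p.2.1 k))
      = qPochInf (q ^ K) (q ^ K) ^ 2 / qPochInf q q ^ 3 *
          (theta (q ^ (a + 1)) (q ^ K) * theta (q ^ (b + 1)) (q ^ K) *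
            theta (q ^ (a + b + 2)) (q ^ K)) := by
  obtain ⟨j, rfl⟩ := Nat.exists_eq_add_of_le' hk
  have hq1 : 1 - q ≠ 0 := by
    simpa using one_sub_pow_ne_zero hq one_ne_zero
  have hcut : ∀ c : (Fin (j + 1) → ℕ) → (Fin (j + 1) → ℕ) → ℂ,
      ∑' p : Decr (j + 1) × Decr (j + 1), c p.1.1 p.2.1 *
        q ^ multiExp (j + 1) a b p.1.1 p.2.1 * multiProd q j p.1.1 p.2.1 *
          g q τ (nth p.1.1 (j + 1)) (nth p.2.1 (j + 1)) =
      ∑' p : (Fin (j + 1) → ℕ) × (Fin (j + 1) → ℕ), c p.1 p.2 *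
        q ^ multiExp (j + 1) a b p.1 p.2 * multiProd q j p.1 p.2 *
          g q τ (nth p.1 (j + 1)) (nth p.2 (j + 1)) := fun c =>
    tsum_decr (fun f h => c f h * q ^ multiExp (j + 1) a b f h * multiProd q j f h *
      g q τ (nth f (j + 1)) (nth h (j + 1))) fun f h hd => by
        rw [multiProd_eq_zero q hd]; ring
  refine (hcut fun f h => (1 - (if a = 0 ∨ b = 0 then (0 : ℂ) else
    q ^ (nth f a + nth h b + 1))) / (1 - q)).trans ?_
  rcases eq_or_ne q 0 with rfl | hq0
  · have hK0 : K ≠ 0 := by omega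
    refine (multiSummand_zero τ j a b (fun f h => (1 - (if a = 0 ∨ b = 0 then (0 : ℂ) else
      0 ^ (nth f a + nth h b + 1))) / (1 - 0)) (by split_ifs <;> simp)).trans ?_
    simp [hK0, theta_zero_zero, qPochInf_zero]
  · refine (tsum_congr fun p : (Fin (j + 1) → ℕ) × (Fin (j + 1) → ℕ) =>
      summand_eq hq1 τ ha hb p.1 p.2).trans ?_
    rw [tsum_mul_left, tsum_fullTerm_sub hq, multiDiff_eq hq0 hq hτ ha hb hK,
      inv_mul_cancel_left₀ hq1, thetaProd, ← pow_add,
      show a + 1 + (b + 1) = a + b + 2 by ring]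
    ring

end Stmt0
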